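/- arXiv:2109.01842 — 3 statements merged into one kernel-verified Lean document; each statement's English description precedes it below -/
import Mathlib

section
/- Let G be a finite group and ρ a nonzero finite-dimensional complex representation of G such that the McKay graph Γ(G,ρ) is a tree, i.e. for all μ,λ ∈ Irr(G) one has [μ⊗ρ:λ] = [λ⊗ρ:μ] ≤ 1 and [μ⊗ρ:μ] = 0, and the underlying simple graph on Irr(G) (with μ adjacent to λ iff [μ⊗ρ:λ] = 1) is connected and acyclic. Then ρ is irreducible and faithful, and at least one of the following holds: (a) dim ρ = 2; or (b) G is an extra special 2-group, i.e. the center Z(G) has exactly 2 elements and g² ∈ Z(G) for every g ∈ G, the order of G is 2·(dim ρ)², and every irreducible representation of G not isomorphic to ρ is 1-dimensional (so the tree is a star with center ρ). -/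
open scoped TensorProduct

/-- The dimension of the space of `G`-equivariant linear maps between two representations;
when `τ` is irreducible this is the multiplicity `[π : τ]`. -/
noncomputable def multHom {G V W : Type} [Group G]
    [AddCommGroup V] [Module ℂ V] [AddCommGroup W] [Module ℂ W]
    (π : Representation ℂ G V) (τ : Representation ℂ G W) : ℕ :=
  Module.finrank ℂ (Representation.linHom π τ).invariants

/-- A representation is irreducible if it is nonzero and has no nontrivial invariant subspaces. -/
def IsIrreducibleRep {G V : Type} [Group G] [AddCommGroup V] [Module ℂ V]
    (ρ : Representation ℂ G V) : Prop :=
  Nontrivial V ∧ ∀ p : Submodule ℂ V, (∀ g : G, ∀ v ∈ p, ρ g v ∈ p) → p = ⊥ ∨ p = ⊤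

/-- Two representations are isomorphic if there is an equivariant linear equivalence. -/
def RepIso {G V W : Type} [Group G] [AddCommGroup V] [Module ℂ V] [AddCommGroup W] [Module ℂ W]
    (π : Representation ℂ G V) (τ : Representation ℂ G W) : Prop :=
  ∃ e : V ≃ₗ[ℂ] W, ∀ (g : G) (v : V), e (π g v) = τ g (e v)

set_option linter.unusedSectionVars false
open Representation

lemma irr_iff {G V : Type} [Group G] [AddCommGroup V] [Module ℂ V]
    (ρ : Representation ℂ G V) : IsIrreducibleRep ρ ↔ ρ.IsIrreducible := by
  constructor
  · rintro ⟨h1, h2⟩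
    refine { exists_pair_ne := ⟨⊥, ⊤, ?_⟩, eq_bot_or_eq_top := ?_ }
    · intro h
      have : (⊥ : Subrepresentation ρ).toSubmodule = (⊤ : Subrepresentation ρ).toSubmodule := by
        rw [h]
      exact bot_ne_top (α := Submodule ℂ V) this
    · intro a
      rcases h2 a.toSubmodule (fun g v hv => a.apply_mem_toSubmodule g hv) with h | h
      · left; exact Subrepresentation.toSubmodule_injective h
      · right; exact Subrepresentation.toSubmodule_injective h
  · intro h
    constructor
    · by_contra hn
      rw [not_nontrivial_iff_subsingleton] at hn
      apply bot_ne_top (α := Subrepresentation ρ)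
      apply Subrepresentation.toSubmodule_injective
      exact Subsingleton.elim _ _
    · intro p hp
      rcases h.eq_bot_or_eq_top (⟨p, fun g v hv => hp g v hv⟩ : Subrepresentation ρ) with h | h
      · left; exact congrArg Subrepresentation.toSubmodule h
      · right; exact congrArg Subrepresentation.toSubmodule h

lemma repIso_iff {G V W : Type} [Group G] [AddCommGroup V] [Module ℂ V]
    [AddCommGroup W] [Module ℂ W]
    (π : Representation ℂ G V) (τ : Representation ℂ G W) :
    RepIso π τ ↔ Nonempty (π.Equiv τ) := by
  constructor
  · rintro ⟨e, he⟩
    refine ⟨Representation.Equiv.mk e ?_⟩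
    intro g
    ext v
    exact he g v
  · rintro ⟨e⟩
    exact ⟨e.toLinearEquiv, fun g v => e.toIntertwiningMap.isIntertwining _ _ g v⟩

lemma schur_scalar {G V : Type} [Group G] [AddCommGroup V] [Module ℂ V] [FiniteDimensional ℂ V]
    (ρ : Representation ℂ G V) (h : IsIrreducibleRep ρ) (T : V →ₗ[ℂ] V)
    (hT : ∀ g v, T (ρ g v) = ρ g (T v)) : ∃ c : ℂ, T = c • LinearMap.id := by
  obtain ⟨h1, h2⟩ := h
  obtain ⟨c, hc⟩ := Module.End.exists_eigenvalue T
  refine ⟨c, ?_⟩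
  rcases h2 (Module.End.eigenspace T c) (by
    intro g v hv
    rw [Module.End.mem_eigenspace_iff] at hv ⊢
    rw [hT, hv, map_smul]) with h | h
  · exact absurd h hc
  · ext v
    have : v ∈ Module.End.eigenspace T c := h ▸ Submodule.mem_top
    simpa using Module.End.mem_eigenspace_iff.1 this

noncomputable def ip {G : Type} [Fintype G] [Group G] (f f' : G → ℂ) : ℂ :=
  (Nat.card G : ℂ)⁻¹ * ∑ g, f g⁻¹ * f' g

lemma multHom_eq {G V W : Type} [Group G] [Fintype G] [AddCommGroup V] [Module ℂ V]
    [AddCommGroup W] [Module ℂ W] [FiniteDimensional ℂ V] [FiniteDimensional ℂ W]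
    (π : Representation ℂ G V) (τ : Representation ℂ G W) :
    (multHom π τ : ℂ) = ip π.character τ.character := by
  have : Invertible (Nat.card G : ℂ) := invertibleOfNonzero (by simp)
  rw [multHom, ← card_inv_mul_sum_char_eq_finrank]
  simp [ip]

lemma exists_compl_rep {G U : Type} [Group G] [Fintype G] [AddCommGroup U] [Module ℂ U]
    (σ : Representation ℂ G U) (p : Subrepresentation σ) :
    ∃ q : Subrepresentation σ, IsCompl p.toSubmodule q.toSubmodule := by
  obtain ⟨q, hq⟩ := exists_isCompl p
  refine ⟨q, ?_⟩
  constructor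
  · rw [disjoint_iff]
    exact congrArg Subrepresentation.toSubmodule hq.inf_eq_bot
  · rw [codisjoint_iff]
    exact congrArg Subrepresentation.toSubmodule hq.sup_eq_top

lemma T_zero {G : Type} [Group G] [Fintype G] (f : G → ℂ)
    (hf : ∀ g h, f (h * g * h⁻¹) = f g)
    (h0 : ∀ (U : Type) [AddCommGroup U] [Module ℂ U] [FiniteDimensional ℂ U]
      (σ : Representation ℂ G U), IsIrreducibleRep σ → ∑ g, f g * σ.character g = 0) :
    ∀ (n : ℕ) (U : Type) [AddCommGroup U] [Module ℂ U] [FiniteDimensional ℂ U]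
      (σ : Representation ℂ G U), Module.finrank ℂ U = n → ∑ g, f g • σ g = 0 := by
  intro n
  induction n using Nat.strong_induction_on with
  | _ n ih =>
  intro U _ _ _ σ hn
  by_cases hirr : IsIrreducibleRep σ
  · obtain ⟨c, hc⟩ := schur_scalar σ hirr (∑ g, f g • σ g) (by
      intro h v
      simp only [LinearMap.sum_apply, LinearMap.smul_apply, map_sum, map_smul]
      rw [← Equiv.sum_comp (MulAut.conj h).toEquiv]
      refine Finset.sum_congr rfl fun g _ => ?_
      simp [hf, map_mul])
    have h1 := congrArg (LinearMap.trace ℂ U) hc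
    have h2 := h0 U σ hirr
    simp only [map_sum, map_smul, smul_eq_mul, LinearMap.trace_id] at h1
    simp only [Representation.character] at h2
    rw [h2] at h1
    have := hirr.1
    have : (Module.finrank ℂ U : ℂ) ≠ 0 := by
      exact_mod_cast Module.finrank_pos.ne'
    have hc0 : c = 0 := by
      rcases mul_eq_zero.1 h1.symm with h | h
      · exact h
      · exact absurd h this
    rw [hc, hc0, zero_smul]
  · rcases subsingleton_or_nontrivial U with hU | hU
    · exact Subsingleton.elim _ _
    · unfold IsIrreducibleRep at hirr
      push Not at hirr
      obtain ⟨p, hp, hb, ht⟩ := hirr hU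
      obtain ⟨q, hq⟩ := exists_compl_rep σ ⟨p, fun g v hv => hp g v hv⟩
      set P : Subrepresentation σ := ⟨p, fun g v hv => hp g v hv⟩ with hP
      have key : ∀ (r : Subrepresentation σ), Module.finrank ℂ r.toSubmodule < n →
          ∀ v ∈ r.toSubmodule, (∑ g, f g • σ g) v = 0 := by
        intro r hr v hv
        have := congrArg (fun L => ((L ⟨v, hv⟩ : r.toSubmodule) : U))
          (ih _ hr r.toSubmodule r.toRepresentation rfl)
        simpa [Subrepresentation.toRepresentation, LinearMap.sum_apply] using this
      have hsum := Submodule.finrank_add_eq_of_isCompl hq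
      have hp0 : 0 < Module.finrank ℂ P.toSubmodule := by
        rw [Nat.pos_iff_ne_zero]; intro h; exact hb (Submodule.finrank_eq_zero.1 h)
      have hpn : Module.finrank ℂ P.toSubmodule < n := by
        rw [← hn]; exact Submodule.finrank_lt ht
      ext v
      obtain ⟨a, ha, b, hb', rfl⟩ := Submodule.mem_sup.1 
        (show v ∈ P.toSubmodule ⊔ q.toSubmodule by rw [hq.sup_eq_top]; trivial)
      rw [map_add, key P hpn a ha, key q (by omega) b hb']
      simp

noncomputable def rightReg (G : Type) [Group G] : Representation ℂ G (G → ℂ) where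
  toFun g := LinearMap.funLeft ℂ ℂ (fun x => x * g)
  map_one' := by ext; simp [LinearMap.funLeft]
  map_mul' g h := by
    apply LinearMap.ext
    intro φ
    funext x
    simp [LinearMap.funLeft, mul_assoc]

lemma class_zero {G : Type} [Group G] [Fintype G] (f : G → ℂ)
    (hf : ∀ g h, f (h * g * h⁻¹) = f g)
    (h0 : ∀ (U : Type) [AddCommGroup U] [Module ℂ U] [FiniteDimensional ℂ U]
      (σ : Representation ℂ G U), IsIrreducibleRep σ → ∑ g, f g * σ.character g = 0) :
    ∀ g, f g = 0 := by
  classical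
  intro x
  have h := T_zero f hf h0 _ (G → ℂ) (rightReg G) rfl
  have h2 := congrArg (fun L => (L (Pi.single 1 1) : G → ℂ) x⁻¹) h
  simpa [rightReg, LinearMap.sum_apply, LinearMap.funLeft, Pi.single_apply, inv_mul_eq_one] using h2

structure IrrSys {G : Type} [Group G] {ι : Type}
    (W : ι → Type) [∀ i, AddCommGroup (W i)] [∀ i, Module ℂ (W i)]
    [∀ i, FiniteDimensional ℂ (W i)]
    (Irr : (i : ι) → Representation ℂ G (W i)) : Prop where
  hirr : ∀ i, IsIrreducibleRep (Irr i)
  hdist : ∀ i j, RepIso (Irr i) (Irr j) → i = j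
  hcompl : ∀ (U : Type) [AddCommGroup U] [Module ℂ U] [FiniteDimensional ℂ U]
      (σ : Representation ℂ G U), IsIrreducibleRep σ → ∃ i, RepIso σ (Irr i)

lemma char_eq_of_iso {G V W : Type} [Group G] [AddCommGroup V] [Module ℂ V]
    [AddCommGroup W] [Module ℂ W]
    {π : Representation ℂ G V} {τ : Representation ℂ G W} (h : RepIso π τ) :
    π.character = τ.character := by
  obtain ⟨e⟩ := (repIso_iff _ _).1 h
  exact char_iso e

lemma ip_irr {G V W : Type} [Group G] [Fintype G] [AddCommGroup V] [Module ℂ V]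
    [AddCommGroup W] [Module ℂ W] [FiniteDimensional ℂ V] [FiniteDimensional ℂ W]
    (π : Representation ℂ G V) (τ : Representation ℂ G W)
    (h1 : IsIrreducibleRep π) (h2 : IsIrreducibleRep τ) [Decidable (RepIso π τ)] :
    ip π.character τ.character = if RepIso π τ then 1 else 0 := by
  have : Invertible (Nat.card G : ℂ) := invertibleOfNonzero (by simp)
  have i1 := (irr_iff _).1 h1
  have i2 := (irr_iff _).1 h2
  have := char_orthonormal τ π
  rw [ip]
  simp_rw [mul_comm (π.character _)]
  rw [this]
  congr 1
  rw [repIso_iff]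

lemma ip_comm {G : Type} [Group G] [Fintype G] (f f' : G → ℂ) : ip f f' = ip f' f := by
  unfold ip
  congr 1
  rw [← Equiv.sum_comp (Equiv.inv G)]
  refine Finset.sum_congr rfl fun g _ => ?_
  simp [mul_comm]

section
variable {G : Type} [Group G] [Fintype G] {ι : Type} [Fintype ι]
    {W : ι → Type} [∀ i, AddCommGroup (W i)] [∀ i, Module ℂ (W i)]
    [∀ i, FiniteDimensional ℂ (W i)]
    {Irr : (i : ι) → Representation ℂ G (W i)}

lemma IrrSys.orth [DecidableEq ι] (S : IrrSys W Irr) (i j : ι) :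
    ip (Irr i).character (Irr j).character = if i = j then 1 else 0 := by
  classical
  rw [ip_irr _ _ (S.hirr i) (S.hirr j)]
  by_cases h : i = j
  · subst h
    simp only [if_true]
    rw [if_pos]
    exact ⟨LinearEquiv.refl _ _, fun _ _ => rfl⟩
  · rw [if_neg h, if_neg]
    exact fun h' => h (S.hdist _ _ h')

lemma ip_sum_left (c : ι → ℂ) (F : ι → G → ℂ) (f' : G → ℂ) :
    ip (fun g => ∑ i, c i * F i g) f' = ∑ i, c i * ip (F i) f' := by
  unfold ip
  simp only [Finset.sum_mul, Finset.mul_sum]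
  rw [Finset.sum_comm]
  refine Finset.sum_congr rfl fun i _ => Finset.sum_congr rfl fun g _ => ?_
  ring

lemma IrrSys.expand (S : IrrSys W Irr) (f : G → ℂ) (hf : ∀ g h, f (h * g * h⁻¹) = f g) (g : G) :
    f g = ∑ i, ip f (Irr i).character * (Irr i).character g := by
  classical
  have key := class_zero
    (fun g => f g⁻¹ - ∑ i, ip f (Irr i).character * (Irr i).character g⁻¹) (by
      intro g h
      have e : (h * g * h⁻¹)⁻¹ = h * g⁻¹ * h⁻¹ := by group
      simp only [e, hf, char_conj]) (by
      intro U _ _ _ σ hσ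
      obtain ⟨j, hj⟩ := S.hcompl U σ hσ
      rw [char_eq_of_iso hj]
      have h1 : ip (fun g => ∑ i, ip f (Irr i).character * (Irr i).character g)
          (Irr j).character = ip f (Irr j).character := by
        rw [ip_sum_left]
        simp [S.orth]
      have h2 := sub_eq_zero.2 h1.symm
      simp only [ip] at h2 ⊢
      rw [← mul_sub, ← Finset.sum_sub_distrib] at h2
      rcases mul_eq_zero.1 h2 with h | h
      · simp at h
      · rw [← h]
        refine Finset.sum_congr rfl fun g _ => ?_
        rw [sub_mul]) g⁻¹
  simp only [inv_inv] at key
  exact sub_eq_zero.1 key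

lemma IrrSys.parseval (S : IrrSys W Irr) (f f' : G → ℂ) (hf : ∀ g h, f (h * g * h⁻¹) = f g) :
    ip f f' = ∑ i, ip f (Irr i).character * ip (Irr i).character f' := by
  rw [← ip_sum_left]
  congr 1
  funext g
  exact S.expand f hf g

lemma IrrSys.col (S : IrrSys W Irr) (g : G) :
    ∑ i, (Irr i).character g⁻¹ * (Irr i).character g =
      (Nat.card (Subgroup.centralizer {g}) : ℂ) := by
  classical
  have h := S.expand (fun x => ∑ y : G, if y * g * y⁻¹ = x then (1 : ℂ) else 0) (by
    intro x h
    rw [← Equiv.sum_comp (Equiv.mulLeft h)]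
    refine Finset.sum_congr rfl fun y _ => ?_
    have e : (Equiv.mulLeft h) y * g * ((Equiv.mulLeft h) y)⁻¹ = h * (y * g * y⁻¹) * h⁻¹ := by
      simp [mul_assoc]
    simp only [e, mul_left_inj, mul_right_inj]) g
  have e : ∀ i, ip (fun x => ∑ y : G, if y * g * y⁻¹ = x then (1 : ℂ) else 0)
      (Irr i).character = (Irr i).character g⁻¹ := by
    intro i
    unfold ip
    simp only [Finset.sum_mul]
    rw [Finset.sum_comm]
    have : ∀ y : G, (∑ x : G, (if y * g * y⁻¹ = x⁻¹ then (1 : ℂ) else 0) * (Irr i).character x) =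
        (Irr i).character g⁻¹ := by
      intro y
      rw [Finset.sum_eq_single (y * g * y⁻¹)⁻¹]
      · have e : (y * g * y⁻¹)⁻¹ = y * g⁻¹ * y⁻¹ := by group
        rw [inv_inv, if_pos rfl, e, char_conj, one_mul]
      · intro b _ hb
        rw [if_neg, zero_mul]
        intro h; apply hb; rw [h, inv_inv]
      · simp
    simp only [this]
    simp [Nat.card_eq_fintype_card]
  simp only [e] at h
  rw [← h, Finset.sum_boole, Nat.card_eq_fintype_card, Fintype.card_subtype]
  congr 2
  ext y
  simp only [Finset.mem_filter, Finset.mem_univ, true_and, Subgroup.mem_centralizer_singleton_iff]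
  rw [mul_inv_eq_iff_eq_mul]

lemma IrrSys.sep (S : IrrSys W Irr) (x : G)
    (hx : ∀ i, (Irr i).character x = (Irr i).character 1) : x = 1 := by
  classical
  have hf : ∀ g h : G, (if h * g * h⁻¹ = 1 then (1 : ℂ) else 0) = if g = 1 then 1 else 0 := by
    intro g h
    simp
  have h1 := S.expand (fun g => if g = 1 then (1 : ℂ) else 0) hf x
  have h2 := S.expand (fun g => if g = 1 then (1 : ℂ) else 0) hf 1
  simp only [hx] at h1
  rw [← h2] at h1
  by_contra hne
  simp [hne] at h1

end

noncomputable def eC {G V : Type} [Group G] [AddCommGroup V] [Module ℂ V]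
    (ρ : Representation ℂ G V) (h : G) : ℕ :=
  multHom (G := Subgroup.centralizer {h}) (ρ.comp (Subgroup.centralizer {h}).subtype)
    (ρ.comp (Subgroup.centralizer {h}).subtype)

lemma mem_inv_iff {G V W : Type} [Group G] [AddCommGroup V] [Module ℂ V]
    [AddCommGroup W] [Module ℂ W]
    (π : Representation ℂ G V) (τ : Representation ℂ G W) (f : V →ₗ[ℂ] W) :
    f ∈ (linHom π τ).invariants ↔ ∀ g v, f (π g v) = τ g (f v) := by
  rw [mem_invariants]
  constructor
  · intro h g v
    have := congrArg (fun L => L (π g v)) (h g)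
    simpa using this.symm
  · intro h g
    ext v
    simp [← h]

section
variable {G : Type} [Group G] [Fintype G] {ι : Type} [Fintype ι]
    {W : ι → Type} [∀ i, AddCommGroup (W i)] [∀ i, Module ℂ (W i)]
    [∀ i, FiniteDimensional ℂ (W i)]
    {Irr : (i : ι) → Representation ℂ G (W i)}
    {V : Type} [AddCommGroup V] [Module ℂ V] [FiniteDimensional ℂ V]

lemma eC_sum (ρ : Representation ℂ G V) :
    ∑ g : G, (Nat.card (Subgroup.centralizer {g}) : ℂ) * (ρ.character g⁻¹ * ρ.character g) =
      ∑ h : G, (Nat.card (Subgroup.centralizer {h}) : ℂ) * (eC ρ h : ℂ) := by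
  classical
  have h1 : ∀ h : G, (Nat.card (Subgroup.centralizer {h}) : ℂ) * (eC ρ h : ℂ) =
      ∑ g : G, if h * g = g * h then ρ.character g⁻¹ * ρ.character g else 0 := by
    intro h
    rw [eC, multHom_eq, ip, ← mul_assoc, mul_inv_cancel₀ (by simp), one_mul]
    rw [← Finset.sum_filter]
    refine (Finset.sum_subtype (p := fun x => x ∈ Subgroup.centralizer {h}) _ ?_
      (f := fun g => ρ.character g⁻¹ * ρ.character g)).symm
    · intro x
      simp only [Finset.mem_filter, Finset.mem_univ, true_and,
        Subgroup.mem_centralizer_singleton_iff]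
      exact eq_comm
  simp only [h1]
  rw [Finset.sum_comm]
  refine Finset.sum_congr rfl fun g _ => ?_
  rw [← Finset.sum_filter, Finset.sum_const, Nat.card_eq_fintype_card, Fintype.card_subtype,
    nsmul_eq_mul]
  congr 3
  ext y
  simp [Subgroup.mem_centralizer_singleton_iff]

lemma IrrSys.sum_deg (S : IrrSys W Irr) (ρ : Representation ℂ G V) :
    (Nat.card G : ℂ) * ∑ i, (multHom ((Irr i).tprod ρ) ((Irr i).tprod ρ) : ℂ) =
      ∑ h : G, (Nat.card (Subgroup.centralizer {h}) : ℂ) * (eC ρ h : ℂ) := by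
  rw [← eC_sum]
  simp only [multHom_eq, ip, ← S.col]
  rw [← Finset.mul_sum, ← mul_assoc, mul_inv_cancel₀ (by simp), one_mul, Finset.sum_comm]
  refine Finset.sum_congr rfl fun g _ => ?_
  rw [Finset.sum_mul]
  refine Finset.sum_congr rfl fun i _ => ?_
  simp only [char_tensor, Pi.mul_apply]
  ring

lemma IrrSys.sum_one (S : IrrSys W Irr) :
    (Nat.card G : ℂ) * (Fintype.card ι : ℂ) =
      ∑ h : G, (Nat.card (Subgroup.centralizer {h}) : ℂ) := by
  classical
  simp only [← S.col]
  rw [Finset.sum_comm]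
  have : ∀ i, ∑ y, (Irr i).character y⁻¹ * (Irr i).character y = (Nat.card G : ℂ) := by
    intro i
    have := S.orth i i
    rw [ip, if_pos rfl, inv_mul_eq_one₀ (by simp)] at this
    exact this.symm
  simp only [this]
  simp [mul_comm]

lemma IrrSys.self_mult (S : IrrSys W Irr) (ρ : Representation ℂ G V) 
    (hle : ∀ i j, multHom ((Irr i).tprod ρ) (Irr j) ≤ 1) (i : ι) :
    multHom ((Irr i).tprod ρ) ((Irr i).tprod ρ) = ∑ j, multHom ((Irr i).tprod ρ) (Irr j) := by
  have h : (multHom ((Irr i).tprod ρ) ((Irr i).tprod ρ) : ℂ) =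
      ((∑ j, multHom ((Irr i).tprod ρ) (Irr j) : ℕ) : ℂ) := by
    rw [multHom_eq, S.parseval _ _ (fun g h => char_conj _ _ _)]
    push_cast
    refine Finset.sum_congr rfl fun j _ => ?_
    rw [ip_comm (Irr j).character, ← multHom_eq]
    rcases Nat.le_one_iff_eq_zero_or_eq_one.1 (hle i j) with h | h <;> simp [h]
  exact_mod_cast h

lemma adj_iff (A : ι → ι → ℕ) (hsym : ∀ i j, A i j = A j i) (hloop : ∀ i, A i i = 0) (i j : ι) :
    (SimpleGraph.fromRel fun i j => A i j = 1).Adj i j ↔ A i j = 1 := by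
  rw [SimpleGraph.fromRel_adj, hsym j i, or_self]
  constructor
  · exact fun h => h.2
  · intro h
    refine ⟨?_, h⟩
    rintro rfl
    simp [hloop] at h

open Classical in
lemma deg_eq (A : ι → ι → ℕ) (hsym : ∀ i j, A i j = A j i) (hloop : ∀ i, A i i = 0)
    (hle : ∀ i j, A i j ≤ 1) (i : ι) :
    (SimpleGraph.fromRel fun i j => A i j = 1).degree i = ∑ j, A i j := by
  rw [← SimpleGraph.card_neighborFinset_eq_degree, Finset.card_eq_sum_ones,
    SimpleGraph.neighborFinset_eq_filter, Finset.sum_filter]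
  refine Finset.sum_congr rfl fun j _ => ?_
  simp only [adj_iff A hsym hloop]
  rcases Nat.le_one_iff_eq_zero_or_eq_one.1 (hle i j) with h | h <;> simp [h]

lemma tree_sum (A : ι → ι → ℕ) (hsym : ∀ i j, A i j = A j i) (hloop : ∀ i, A i i = 0)
    (hle : ∀ i j, A i j ≤ 1)
    (htree : (SimpleGraph.fromRel fun i j => A i j = 1).IsTree) :
    ∑ i, ∑ j, A i j + 2 = 2 * Fintype.card ι := by
  classical
  have h1 := htree.card_edgeFinset
  have h2 := SimpleGraph.sum_degrees_eq_twice_card_edges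
    (SimpleGraph.fromRel fun i j => A i j = 1)
  have h3 : ∑ i, ∑ j, A i j = ∑ i, (SimpleGraph.fromRel fun i j => A i j = 1).degree i := by
    refine Finset.sum_congr rfl fun i _ => ?_
    rw [← deg_eq A hsym hloop hle]
  rw [h3, h2]
  have h1' : (SimpleGraph.fromRel fun i j => A i j = 1).edgeFinset.card + 1 =
    Fintype.card ι := by
    rw [← h1]
  omega

/-- The key identity. -/
lemma key_sum (S : IrrSys W Irr) (ρ : Representation ℂ G V)
    (hsym : ∀ i j, multHom ((Irr i).tprod ρ) (Irr j) = multHom ((Irr j).tprod ρ) (Irr i))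
    (hle : ∀ i j, multHom ((Irr i).tprod ρ) (Irr j) ≤ 1)
    (hloop : ∀ i, multHom ((Irr i).tprod ρ) (Irr i) = 0)
    (htree : (SimpleGraph.fromRel fun i j => multHom ((Irr i).tprod ρ) (Irr j) = 1).IsTree) :
    ∑ h : G, (Nat.card (Subgroup.centralizer {h}) : ℤ) * ((eC ρ h : ℤ) - 2) =
      - 2 * (Nat.card G : ℤ) := by
  have h1 := tree_sum (fun i j => multHom ((Irr i).tprod ρ) (Irr j)) hsym hloop hle htree
  simp only [← S.self_mult ρ hle] at h1
  have h2 := S.sum_deg ρ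
  have h3 := S.sum_one
  have h1' : ∑ i, (multHom ((Irr i).tprod ρ) ((Irr i).tprod ρ) : ℂ) + 2 =
    2 * (Fintype.card ι : ℂ) := by exact_mod_cast h1
  have : ∑ h : G, (Nat.card (Subgroup.centralizer {h}) : ℂ) * ((eC ρ h : ℂ) - 2) =
      - 2 * (Nat.card G : ℂ) := by
    simp only [mul_sub, Finset.sum_sub_distrib]
    rw [← h2, ← Finset.sum_mul, ← h3]
    linear_combination (Nat.card G : ℂ) * h1'
  exact_mod_cast this

lemma one_le_eC (ρ : Representation ℂ G V) [Nontrivial V] (h : G) : 1 ≤ eC ρ h := by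
  rw [eC, multHom, Nat.one_le_iff_ne_zero, ← Nat.pos_iff_ne_zero, Module.finrank_pos_iff]
  refine ⟨⟨⟨LinearMap.id, ?_⟩, 0, ?_⟩⟩
  · rw [mem_inv_iff]; intros; rfl
  · intro hh
    obtain ⟨v, hv⟩ := exists_ne (0 : V)
    exact hv (congrArg (fun (L : V →ₗ[ℂ] V) => L v) (congrArg Subtype.val hh))

lemma indep_of_noncentral (ρ : Representation ℂ G V) (hinj : Function.Injective ρ) (h : G)
    (hh : h ∉ Subgroup.center G) : LinearIndependent ℂ ![(1 : V →ₗ[ℂ] V), ρ h] := by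
  have hns : ∀ c : ℂ, ρ h ≠ c • 1 := by
    intro c hc
    apply hh
    rw [Subgroup.mem_center_iff]
    intro g
    apply hinj
    rw [map_mul, map_mul, hc]
    simp
  rw [LinearIndependent.pair_iff]
  intro s t hst
  have ht : t = 0 := by
    by_contra ht
    apply hns (-(t⁻¹ * s))
    have : ρ h = t⁻¹ • (t • ρ h) := by rw [smul_smul, inv_mul_cancel₀ ht, one_smul]
    rw [this, eq_neg_of_add_eq_zero_right hst, smul_neg, smul_smul, neg_smul]
  subst ht
  refine ⟨?_, rfl⟩
  by_contra hs
  apply hns 0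
  have h1 : (1 : V →ₗ[ℂ] V) = 0 := by
    simpa [hs] using hst
  rw [zero_smul, ← mul_one (ρ h), h1, mul_zero]

lemma span_le_inv (ρ : Representation ℂ G V) (h : G) :
    Submodule.span ℂ (Set.range ![(1 : V →ₗ[ℂ] V), ρ h]) ≤
      (linHom (ρ.comp (Subgroup.centralizer {h}).subtype)
        (ρ.comp (Subgroup.centralizer {h}).subtype)).invariants := by
  rw [Submodule.span_le]
  rintro _ ⟨i, rfl⟩
  fin_cases i
  · simp only [SetLike.mem_coe]
    rw [mem_inv_iff]; intros; rfl
  · simp only [SetLike.mem_coe]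
    rw [mem_inv_iff]
    rintro ⟨g, hg⟩ v
    rw [Subgroup.mem_centralizer_singleton_iff] at hg
    change (ρ h * ρ g) v = (ρ g * ρ h) v
    rw [← map_mul, ← map_mul, hg]

lemma two_le_eC (ρ : Representation ℂ G V) (hinj : Function.Injective ρ) (h : G)
    (hh : h ∉ Subgroup.center G) : 2 ≤ eC ρ h := by
  have h1 := finrank_span_eq_card (indep_of_noncentral ρ hinj h hh)
  have h2 := Submodule.finrank_mono (span_le_inv ρ h)
  rw [h1] at h2
  exact h2

lemma eC_two (ρ : Representation ℂ G V) (hinj : Function.Injective ρ) (h : G)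
    (hh : h ∉ Subgroup.center G) (he : eC ρ h = 2) (T : V →ₗ[ℂ] V)
    (hT : ∀ g, g * h = h * g → T * ρ g = ρ g * T) : ∃ a b : ℂ, T = a • 1 + b • ρ h := by
  have h1 := finrank_span_eq_card (indep_of_noncentral ρ hinj h hh)
  have h2 := Submodule.eq_of_le_of_finrank_eq (span_le_inv ρ h) (by
    rw [h1]; exact he.symm)
  have h3 : T ∈ Submodule.span ℂ (Set.range ![(1 : V →ₗ[ℂ] V), ρ h]) := by
    rw [h2, mem_inv_iff]
    rintro ⟨g, hg⟩ v
    rw [Subgroup.mem_centralizer_singleton_iff] at hg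
    exact congrArg (fun L => L v) (hT g hg)
  rw [Matrix.range_cons, Matrix.range_cons, Matrix.range_empty, Set.union_empty] at h3
  obtain ⟨a, b, hab⟩ := Submodule.mem_span_pair.1 (by simpa using h3)
  exact ⟨b, a, by rw [← hab, add_comm]⟩

lemma center_conc (ρ : Representation ℂ G V) (hinj : Function.Injective ρ) [Nontrivial V]
    (hZ : Nat.card (Subgroup.center G) ≤ 2)
    (hs : ∑ h : G, (Nat.card (Subgroup.centralizer {h}) : ℤ) * ((eC ρ h : ℤ) - 2) =
      - 2 * (Nat.card G : ℤ)) :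
    Nat.card (Subgroup.center G) = 2 ∧ ∀ h ∉ Subgroup.center G, eC ρ h = 2 := by
  classical
  set t : G → ℤ := fun h => (Nat.card (Subgroup.centralizer {h}) : ℤ) * ((eC ρ h : ℤ) - 2) +
    if h ∈ Subgroup.center G then (Nat.card G : ℤ) else 0 with ht
  have t0 : ∀ h ∈ Finset.univ, 0 ≤ t h := by
    intro h _
    simp only [ht]
    have h1 := one_le_eC ρ h
    by_cases hc : h ∈ Subgroup.center G
    · rw [if_pos hc]
      have : (Nat.card (Subgroup.centralizer {h}) : ℤ) ≤ Nat.card G := by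
        exact_mod_cast Subgroup.card_le_card_group _
      have h1' : (1 : ℤ) ≤ eC ρ h := by exact_mod_cast h1
      nlinarith [Int.natCast_nonneg (Nat.card (Subgroup.centralizer {h}))]
    · rw [if_neg hc]
      have h1' : (2 : ℤ) ≤ eC ρ h := by exact_mod_cast two_le_eC ρ hinj h hc
      nlinarith [Int.natCast_nonneg (Nat.card (Subgroup.centralizer {h}))]
  have tsum : ∑ h, t h = ((Nat.card (Subgroup.center G) : ℤ) - 2) * Nat.card G := by
    simp only [ht, Finset.sum_add_distrib]
    rw [hs, ← Finset.sum_filter, Finset.sum_const]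
    have : (Finset.univ.filter (fun h : G => h ∈ Subgroup.center G)).card =
        Nat.card (Subgroup.center G) := by
      rw [Nat.card_eq_fintype_card, Fintype.card_subtype]
    rw [this, nsmul_eq_mul]
    ring
  have hp : (0 : ℤ) < Nat.card G := by exact_mod_cast Nat.card_pos
  have h2 := Finset.sum_nonneg t0
  have hZ' : (Nat.card (Subgroup.center G) : ℤ) = 2 := by
    rw [tsum] at h2
    have : 0 ≤ (Nat.card (Subgroup.center G) : ℤ) - 2 := by
      by_contra hlt
      push Not at hlt
      nlinarith
    have : (Nat.card (Subgroup.center G) : ℤ) ≤ 2 := by exact_mod_cast hZ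
    linarith
  refine ⟨by exact_mod_cast hZ', ?_⟩
  intro h hh
  rw [hZ', sub_self, zero_mul] at tsum
  have := (Finset.sum_eq_zero_iff_of_nonneg t0).1 tsum h (Finset.mem_univ _)
  simp only [ht, if_neg hh, add_zero] at this
  rcases mul_eq_zero.1 this with h3 | h3
  · have : Nat.card (Subgroup.centralizer {h}) = 0 := by exact_mod_cast h3
    exact absurd this Nat.card_pos.ne'
  · have : (eC ρ h : ℤ) = 2 := by linarith
    exact_mod_cast this

end

lemma mult_pos_of_ne {G V W : Type} [Group G] [AddCommGroup V] [Module ℂ V]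
    [AddCommGroup W] [Module ℂ W] [FiniteDimensional ℂ V] [FiniteDimensional ℂ W]
    (π : Representation ℂ G V) (τ : Representation ℂ G W) (f : V →ₗ[ℂ] W) (hf : f ≠ 0)
    (h : ∀ g v, f (π g v) = τ g (f v)) : multHom π τ ≠ 0 := by
  rw [multHom, ← Nat.pos_iff_ne_zero, Module.finrank_pos_iff]
  refine ⟨⟨⟨f, (mem_inv_iff _ _ _).2 h⟩, 0, ?_⟩⟩
  intro hh
  exact hf (congrArg Subtype.val hh)

lemma exists_of_mult_ne {G V W : Type} [Group G] [AddCommGroup V] [Module ℂ V]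
    [AddCommGroup W] [Module ℂ W] [FiniteDimensional ℂ V] [FiniteDimensional ℂ W]
    (π : Representation ℂ G V) (τ : Representation ℂ G W) (hm : multHom π τ ≠ 0) :
    ∃ f : V →ₗ[ℂ] W, f ≠ 0 ∧ ∀ g v, f (π g v) = τ g (f v) := by
  rw [multHom, ← Nat.pos_iff_ne_zero, Module.finrank_pos_iff] at hm
  obtain ⟨⟨f, hf⟩, hne⟩ := exists_ne (0 : (linHom π τ).invariants)
  exact ⟨f, fun h => hne (Subtype.ext h), (mem_inv_iff _ _ _).1 hf⟩

lemma tmul_inj {W V : Type} [AddCommGroup V] [Module ℂ V] [AddCommGroup W] [Module ℂ W]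
    (w : W) (hw : w ≠ 0) (v v' : V) (h : w ⊗ₜ[ℂ] v = w ⊗ₜ[ℂ] v') : v = v' := by
  obtain ⟨φ, hφ⟩ := Module.Projective.exists_dual_eq_one ℂ hw
  have := congrArg (fun x => TensorProduct.lid ℂ V (LinearMap.rTensor V φ x)) h
  simpa [hφ] using this

section
variable {G : Type} [Group G] [Fintype G] {ι : Type} [Fintype ι]
    {W : ι → Type} [∀ i, AddCommGroup (W i)] [∀ i, Module ℂ (W i)]
    [∀ i, FiniteDimensional ℂ (W i)]
    {Irr : (i : ι) → Representation ℂ G (W i)}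
    {V : Type} [AddCommGroup V] [Module ℂ V] [FiniteDimensional ℂ V]

lemma irr_of_leaf {U : Type} [AddCommGroup U] [Module ℂ U] [FiniteDimensional ℂ U]
    [Nontrivial U] [Nontrivial V] (μ : Representation ℂ G U) (ρ : Representation ℂ G V)
    (h : multHom (μ.tprod ρ) (μ.tprod ρ) = 1) : IsIrreducibleRep ρ := by
  refine ⟨inferInstance, fun p hp => ?_⟩
  obtain ⟨q, hq⟩ := exists_compl_rep ρ ⟨p, fun g v hv => hp g v hv⟩
  set P : Subrepresentation ρ := ⟨p, fun g v hv => hp g v hv⟩ with hP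
  obtain ⟨w, hw⟩ := exists_ne (0 : U)
  obtain ⟨v0, hv0⟩ := exists_ne (0 : V)
  have hw0 : w ⊗ₜ[ℂ] v0 ≠ 0 := by
    intro h0
    exact hv0 (tmul_inj w hw v0 0 (by rw [h0, TensorProduct.tmul_zero]))
  set e : V →ₗ[ℂ] V := P.toSubmodule.projection q.toSubmodule hq with he
  have e1 : ∀ v ∈ p, e v = v := by
    intro v hv
    exact Submodule.projection_apply_left hq ⟨v, hv⟩
  have e2 : ∀ v ∈ q.toSubmodule, e v = 0 := by
    intro v hv
    exact (Submodule.projection_apply_eq_zero_iff hq).2 hv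
  have eeq : ∀ g v, e (ρ g v) = ρ g (e v) := by
    intro g v
    obtain ⟨a, ha, b, hb, rfl⟩ := Submodule.mem_sup.1
        (show v ∈ P.toSubmodule ⊔ q.toSubmodule by rw [hq.sup_eq_top]; trivial)
    rw [map_add, map_add, map_add, e1 _ (hp g a ha), e1 a ha, e2 b hb,
      e2 _ (q.apply_mem_toSubmodule g hb), add_zero, add_zero]
  have m1 : (LinearMap.id : U ⊗[ℂ] V →ₗ[ℂ] U ⊗[ℂ] V) ∈
      (linHom (μ.tprod ρ) (μ.tprod ρ)).invariants := by
    rw [mem_inv_iff]; intros; rfl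
  have m2 : (LinearMap.lTensor U e : U ⊗[ℂ] V →ₗ[ℂ] U ⊗[ℂ] V) ∈
      (linHom (μ.tprod ρ) (μ.tprod ρ)).invariants := by
    rw [mem_inv_iff]
    intro g x
    induction x using TensorProduct.induction_on with
    | zero => simp
    | tmul x y => simp [eeq]
    | add x y hx hy => rw [map_add, map_add, hx, hy, map_add, map_add]
  obtain ⟨c, hc⟩ := (finrank_eq_one_iff_of_nonzero'
    (⟨LinearMap.id, m1⟩ : (linHom (μ.tprod ρ) (μ.tprod ρ)).invariants) (by
      intro h0
      exact hw0 (congrArg (fun (L : U ⊗[ℂ] V →ₗ[ℂ] U ⊗[ℂ] V) => L (w ⊗ₜ[ℂ] v0))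
        (congrArg Subtype.val h0)))).1 h ⟨_, m2⟩
  have hc' : ∀ v, e v = c • v := by
    intro v
    apply tmul_inj w hw
    have := congrArg (fun (L : U ⊗[ℂ] V →ₗ[ℂ] U ⊗[ℂ] V) => L (w ⊗ₜ[ℂ] v))
        (congrArg Subtype.val hc)
    simpa using this.symm
  by_cases hb : p = ⊥
  · exact Or.inl hb
  · right
    obtain ⟨v, hv, hv0⟩ := Submodule.exists_mem_ne_zero_of_ne_bot hb
    have h1 : c = 1 := by
      have := (hc' v).symm.trans (e1 v hv)
      have h2 : (c - 1) • v = 0 := by rw [sub_smul, this, one_smul, sub_self]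
      rcases smul_eq_zero.1 h2 with h | h
      · exact sub_eq_zero.1 h
      · exact absurd h hv0
    rw [eq_top_iff]
    intro x _
    have : e x = x := by rw [hc', h1, one_smul]
    rw [← this]
    exact Submodule.projection_apply_mem hq x

lemma rho_irr (S : IrrSys W Irr) (ρ : Representation ℂ G V) [Nontrivial V]
    (hsym : ∀ i j, multHom ((Irr i).tprod ρ) (Irr j) = multHom ((Irr j).tprod ρ) (Irr i))
    (hle : ∀ i j, multHom ((Irr i).tprod ρ) (Irr j) ≤ 1)
    (hloop : ∀ i, multHom ((Irr i).tprod ρ) (Irr i) = 0)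
    (htree : (SimpleGraph.fromRel fun i j => multHom ((Irr i).tprod ρ) (Irr j) = 1).IsTree) :
    IsIrreducibleRep ρ := by
  classical
  have hne := htree.connected.nonempty
  have hnt : Nontrivial ι := by
    by_contra hn
    rw [not_nontrivial_iff_subsingleton] at hn
    obtain ⟨i⟩ := hne
    have h1 := S.self_mult ρ hle i
    have : ∑ j, multHom ((Irr i).tprod ρ) (Irr j) = 0 := by
      refine Finset.sum_eq_zero fun j _ => ?_
      rw [Subsingleton.elim j i, hloop]
    rw [this] at h1
    have := (S.hirr i).1
    obtain ⟨w, hw⟩ := exists_ne (0 : W i)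
    obtain ⟨v, hv⟩ := exists_ne (0 : V)
    refine mult_pos_of_ne ((Irr i).tprod ρ) ((Irr i).tprod ρ) LinearMap.id ?_
      (fun _ _ => rfl) h1
    intro h0
    apply hv
    apply tmul_inj w hw
    have := congrArg (fun (L : W i ⊗[ℂ] V →ₗ[ℂ] W i ⊗[ℂ] V) => L (w ⊗ₜ[ℂ] v)) h0
    simpa using this
  obtain ⟨i, hi⟩ := htree.exists_vert_degree_one_of_nontrivial
  have h2 := deg_eq (fun i j => multHom ((Irr i).tprod ρ) (Irr j)) hsym hloop hle i
  have := (S.hirr i).1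
  apply irr_of_leaf (Irr i) ρ
  rw [S.self_mult ρ hle, ← h2, ← hi]
  congr!

lemma trivial_irr : IsIrreducibleRep (Representation.trivial ℂ G ℂ) := by
  refine ⟨inferInstance, fun p _ => ?_⟩
  exact eq_bot_or_eq_top p

lemma exists_triv (S : IrrSys W Irr) :
    ∃ i, RepIso (Representation.trivial ℂ G ℂ) (Irr i) := S.hcompl _ _ trivial_irr

lemma rho_faithful (S : IrrSys W Irr) (ρ : Representation ℂ G V)
    (hsym : ∀ i j, multHom ((Irr i).tprod ρ) (Irr j) = multHom ((Irr j).tprod ρ) (Irr i))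
    (hloop : ∀ i, multHom ((Irr i).tprod ρ) (Irr i) = 0)
    (htree : (SimpleGraph.fromRel fun i j => multHom ((Irr i).tprod ρ) (Irr j) = 1).IsTree) :
    Function.Injective ρ := by
  have key : ∀ x, ρ x = 1 → x = 1 := by
    intro x hx
    obtain ⟨i0, e, he⟩ := exists_triv S
    have h0 : Irr i0 x = 1 := by
      ext w
      have := he x (e.symm w)
      simpa using this.symm
    have hall : ∀ j, Irr j x = 1 := by
      intro j
      have hr := htree.connected.preconnected i0 j
      rw [SimpleGraph.reachable_iff_reflTransGen] at hr
      induction hr with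
      | refl => exact h0
      | @tail b c _ hadj ih =>
        rw [adj_iff (fun i j => multHom ((Irr i).tprod ρ) (Irr j)) hsym hloop] at hadj
        obtain ⟨f, hf0, hf⟩ := exists_of_mult_ne _ _ (show multHom ((Irr b).tprod ρ) (Irr c) ≠ 0 by
          rw [hadj]; exact one_ne_zero)
        rcases (S.hirr c).2 (LinearMap.range f) (by
          rintro g _ ⟨y, rfl⟩
          exact ⟨_, hf g y⟩) with h | h
        · exact absurd (LinearMap.range_eq_bot.1 h) hf0
        · ext v
          obtain ⟨y, rfl⟩ := LinearMap.range_eq_top.1 h v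
          rw [← hf]
          have : ((Irr b).tprod ρ) x = 1 := by
            rw [Representation.tprod_apply, ih, hx]
            exact TensorProduct.map_id
          rw [this]
          rfl
    apply S.sep
    intro i
    simp only [Representation.character, hall, map_one]
  exact (injective_iff_map_eq_one ρ).2 key

lemma exists_form (S : IrrSys W Irr) (ρ : Representation ℂ G V) (hρ : IsIrreducibleRep ρ)
    (hsym : ∀ i j, multHom ((Irr i).tprod ρ) (Irr j) = multHom ((Irr j).tprod ρ) (Irr i)) :
    ∃ B : V →ₗ[ℂ] V →ₗ[ℂ] ℂ, (∀ g v w, B (ρ g v) w = B v (ρ g⁻¹ w)) ∧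
      ∀ w w', (∀ v, B v w = B v w') → w = w' := by
  classical
  obtain ⟨i0, h0⟩ := exists_triv S
  obtain ⟨r, hr⟩ := S.hcompl _ ρ hρ
  have c0 := char_eq_of_iso h0
  have cr := char_eq_of_iso hr
  have t1 : (Representation.trivial ℂ G ℂ).character = 1 := by
    funext g
    simp [Representation.character]
  have h1 : (multHom (ρ.tprod ρ) (Representation.trivial ℂ G ℂ) : ℂ) = 1 := by
    have h2 : (multHom ((Irr r).tprod ρ) (Irr i0) : ℂ) = multHom ((Irr i0).tprod ρ) (Irr r) := by
      rw [hsym]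
    rw [multHom_eq, multHom_eq] at h2
    rw [multHom_eq]
    simp only [char_tensor, ← c0, ← cr, t1, one_mul] at h2 ⊢
    rw [h2, ip_irr _ _ hρ hρ, if_pos]
    exact ⟨LinearEquiv.refl _ _, fun _ _ => rfl⟩
  have h1' : multHom (ρ.tprod ρ) (Representation.trivial ℂ G ℂ) ≠ 0 := by
    intro h
    rw [h] at h1
    simp at h1
  obtain ⟨f, hf0, hf⟩ := exists_of_mult_ne _ _ h1'
  have hinv : ∀ g v w, f (ρ g v ⊗ₜ[ℂ] w) = f (v ⊗ₜ[ℂ] ρ g⁻¹ w) := by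
    intro g v w
    have := hf g (v ⊗ₜ[ℂ] ρ g⁻¹ w)
    simpa using this
  refine ⟨TensorProduct.curry f, fun g v w => ?_, ?_⟩
  · simpa using hinv g v w
  · intro w w' hw
    let K : Submodule ℂ V := LinearMap.ker (TensorProduct.curry f).flip
    have hK : ∀ x, x ∈ K ↔ ∀ v, f (v ⊗ₜ[ℂ] x) = 0 := by
      intro x
      simp only [K, LinearMap.mem_ker]
      rw [LinearMap.ext_iff]
      simp
    rcases hρ.2 K (by
      intro g x hx
      rw [hK] at hx ⊢
      intro v
      have := hinv g⁻¹ v x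
      rw [inv_inv] at this
      rw [← this]
      exact hx _) with h | h
    · have : w - w' ∈ K := by
        rw [hK]
        intro v
        have := hw v
        simp only [TensorProduct.curry_apply] at this
        rw [TensorProduct.tmul_sub, map_sub, this, sub_self]
      rw [h] at this
      exact sub_eq_zero.1 this
    · exfalso
      apply hf0
      ext v x
      have : x ∈ K := h ▸ Submodule.mem_top
      simpa using (hK x).1 this v

lemma center_scalar {U : Type} [AddCommGroup U] [Module ℂ U] [FiniteDimensional ℂ U]
    (ρ : Representation ℂ G U) (hρ : IsIrreducibleRep ρ) (x : G)
    (hx : x ∈ Subgroup.center G) : ∃ c : ℂ, ρ x = c • 1 := by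
  refine schur_scalar ρ hρ (ρ x) ?_
  intro g v
  rw [Subgroup.mem_center_iff] at hx
  change (ρ x * ρ g) v = (ρ g * ρ x) v
  rw [← map_mul, ← map_mul, hx]

lemma center_sq (ρ : Representation ℂ G V) (hρ : IsIrreducibleRep ρ) 
    (B : V →ₗ[ℂ] V →ₗ[ℂ] ℂ) (hB : ∀ g v w, B (ρ g v) w = B v (ρ g⁻¹ w))
    (hB2 : ∀ w w', (∀ v, B v w = B v w') → w = w') (x : G)
    (hx : x ∈ Subgroup.center G) : ρ x = 1 ∨ ρ x = -1 := by
  obtain ⟨c, hc⟩ := center_scalar ρ hρ x hx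
  have h1 : ρ x * ρ x = 1 := by
    ext w
    apply hB2
    intro v
    have := hB x v (ρ x w)
    have e : ρ x⁻¹ (ρ x w) = w := by
      rw [← Module.End.mul_apply, ← map_mul]; simp
    rw [e] at this
    rw [Module.End.one_apply, ← this, Module.End.mul_apply]
    simp [hc]
  obtain ⟨hV, -⟩ := hρ
  obtain ⟨v, hv⟩ := exists_ne (0 : V)
  have h2 : (c * c - 1) • v = 0 := by
    have := congrArg (fun L => L v) h1
    simp only [hc, Module.End.mul_apply, LinearMap.smul_apply, Module.End.one_apply, smul_smul]
      at this
    rw [sub_smul, this, one_smul, sub_self]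
  have h3 : c * c = 1 := by
    rcases smul_eq_zero.1 h2 with h | h
    · exact sub_eq_zero.1 h
    · exact absurd h hv
  rcases mul_self_eq_one_iff.1 h3 with h | h
  · left; rw [hc, h, one_smul]
  · right; rw [hc, h, neg_smul, one_smul]

lemma center_le (ρ : Representation ℂ G V) (hinj : Function.Injective ρ)
    (h : ∀ x ∈ Subgroup.center G, ρ x = 1 ∨ ρ x = -1) : Nat.card (Subgroup.center G) ≤ 2 := by
  classical
  have : Function.Injective (fun x : Subgroup.center G => decide (ρ x = 1)) := by
    rintro ⟨x, hx⟩ ⟨y, hy⟩ hxy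
    simp only [decide_eq_decide] at hxy
    apply Subtype.ext
    apply hinj
    rcases h x hx with h1 | h1 <;> rcases h y hy with h2 | h2
    · rw [h1, h2]
    · rw [h1, hxy.1 h1]
    · rw [h2, hxy.2 h2]
    · rw [h1, h2]
  have := Nat.card_le_card_of_injective _ this
  simpa using this

end

section
variable {R : Type} [Ring R] [Algebra ℂ R]

lemma alg1 (a a' b b' : R) (s t u : ℂ) (h1 : a * a' = 1) (h2 : a + a' = t • 1)
    (h3 : b + b' = u • 1) (h5 : a * b + a' * b' = s • 1) (ht : t ^ 2 ≠ 4) :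
    ∃ p q : ℂ, b = p • 1 + q • a := by
  have ea : a' = t • 1 - a := eq_sub_of_add_eq' h2
  have eb : b' = u • 1 - b := eq_sub_of_add_eq' h3
  subst ea eb
  have h6 : a * a = t • a - 1 := by
    rw [mul_sub, mul_smul_comm, mul_one] at h1
    rw [← h1]; abel
  have E : (2 : ℂ) • (a * b) = t • b + u • a + (s - t * u) • 1 := by
    simp only [mul_sub, sub_mul, smul_mul_assoc, mul_smul_comm, one_mul, mul_one] at h5
    linear_combination (norm := module) (1 : ℂ) • h5
  have E2 : (2 : ℂ) • (t • (a * b) - b) = t • (a * b) + u • (t • a - 1) + (s - t * u) • a := by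
    have := congrArg (fun x => a * x) E
    simp only [mul_add, mul_smul_comm, mul_one, ← mul_assoc, h6, sub_mul, smul_mul_assoc,
      one_mul] at this
    exact this
  have hd : t ^ 2 - 4 ≠ 0 := sub_ne_zero.2 ht
  refine ⟨(t ^ 2 - 4)⁻¹ * (t ^ 2 * u - t * s - 2 * u), (t ^ 2 - 4)⁻¹ * (2 * s - t * u), ?_⟩
  have E3 : (t ^ 2 - 4) • b = (t ^ 2 * u - t * s - 2 * u) • (1 : R) + (2 * s - t * u) • a := by
    linear_combination (norm := module) (2 : ℂ) • E2 - t • E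
  rw [mul_smul, mul_smul, ← smul_add, ← E3, smul_smul, inv_mul_cancel₀ hd, one_smul]

lemma unip (a : R) (t : ℂ) (n : ℕ) (hn : n ≠ 0) (ha : a ^ n = 1) (h6 : a * a = t • a - 1)
    (ht : t ^ 2 = 4) : ∃ c : ℂ, a = c • 1 := by
  obtain ⟨e, he⟩ : ∃ e : ℂ, e = t / 2 := ⟨_, rfl⟩
  have ht2 : t = 2 * e := by rw [he]; ring
  have he2 : e * e = 1 := by rw [he]; linear_combination ht / 4
  have hcc : (e • a) * (e • a) = (2 : ℂ) • (e • a) - 1 := by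
    rw [smul_mul_smul_comm, he2, one_smul, h6, ht2, mul_smul]
  have hk : ∀ k : ℕ, (e • a) ^ k = 1 + (k : ℂ) • (e • a - 1) := by
    generalize e • a = c at hcc
    intro k
    induction k with
    | zero => simp
    | succ k ih =>
      rw [pow_succ, ih, add_mul, smul_mul_assoc, sub_mul, hcc, one_mul, Nat.cast_add, Nat.cast_one]
      module
  have h1 := hk (2 * n)
  rw [smul_pow, mul_comm 2 n, pow_mul, pow_mul, ha, mul_comm n 2, one_pow,
    pow_right_comm, pow_two e, he2, one_pow, one_smul] at h1
  have h2 : ((2 * n : ℕ) : ℂ) • (e • a - 1) = 0 := by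
    rw [eq_comm, add_eq_left] at h1
    exact h1
  rcases smul_eq_zero.1 h2 with h | h
  · exfalso
    apply hn
    have := Nat.cast_eq_zero.1 h
    omega
  · refine ⟨e, ?_⟩
    rw [← sub_eq_zero.1 h, smul_smul, he2, one_smul]

end

section
variable {V : Type} [AddCommGroup V] [Module ℂ V] [FiniteDimensional ℂ V]

lemma onedim (a : V →ₗ[ℂ] V) (α β : ℂ) (hne : α ≠ β)
    (h1 : ∀ x, a (a x) = (α + β) • a x - (α * β) • x)
    (hT : ∀ T : V →ₗ[ℂ] V, T * a = a * T → ∃ p q : ℂ, T = p • 1 + q • a)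
    (v w : V) (hv : v ≠ 0) (hav : a v = α • v) (haw : a w = α • w) : ∃ c : ℂ, w = c • v := by
  obtain ⟨f, hf⟩ := Module.Projective.exists_dual_eq_one ℂ hv
  let P : V →ₗ[ℂ] V := a - β • 1
  have hP : ∀ x, P x = a x - β • x := fun x => rfl
  have hPa : ∀ x, P (a x) = α • P x := by
    intro x; rw [hP, hP, h1]; module
  have haP : ∀ x, a (P x) = α • P x := by
    intro x; rw [hP, map_sub, map_smul, h1]; module
  obtain ⟨p, q, hpq⟩ := hT (P * f.smulRight w * P) (by
    ext x
    simp only [Module.End.mul_apply, hPa, haP]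
    simp only [map_smul])
  have h2 := congrArg (fun L => L v) hpq
  have hPv : P v = (α - β) • v := by rw [hP, hav]; module
  have hPw : P w = (α - β) • w := by rw [hP, haw]; module
  simp only [Module.End.mul_apply, hPv, map_smul, LinearMap.smulRight_apply, hf, one_smul, hPw,
    LinearMap.add_apply, LinearMap.smul_apply, Module.End.one_apply, hav] at h2
  have hd : α - β ≠ 0 := sub_ne_zero.2 hne
  refine ⟨(α - β)⁻¹ * (α - β)⁻¹ * (p + q * α), ?_⟩
  rw [mul_smul, add_smul, mul_smul q, ← h2, smul_smul, smul_smul,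
    show (α - β)⁻¹ * (α - β)⁻¹ * (α - β) * (α - β) = 1 by field_simp, one_smul]

lemma dim_two (a : V →ₗ[ℂ] V) (t : ℂ) (hns : ∀ c : ℂ, a ≠ c • 1) (h6 : a * a = t • a - 1)
    (ht : t ^ 2 ≠ 4) (hT : ∀ T : V →ₗ[ℂ] V, T * a = a * T → ∃ p q : ℂ, T = p • 1 + q • a) :
    Module.finrank ℂ V = 2 := by
  classical
  obtain ⟨r, hr⟩ := IsAlgClosed.exists_pow_nat_eq (t ^ 2 - 4) (n := 2) (by norm_num)
  have hr0 : r ≠ 0 := by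
    rintro rfl
    apply ht
    linear_combination -hr
  obtain ⟨α, hα⟩ : ∃ α, α = (t + r) / 2 := ⟨_, rfl⟩
  obtain ⟨β, hβ⟩ : ∃ β, β = (t - r) / 2 := ⟨_, rfl⟩
  have hab : α - β = r := by rw [hα, hβ]; ring
  have hne : α ≠ β := sub_ne_zero.1 (hab ▸ hr0)
  have hsum : α + β = t := by rw [hα, hβ]; ring
  have hprod : α * β = 1 := by rw [hα, hβ]; linear_combination -hr / 4
  have h1 : ∀ x, a (a x) = (α + β) • a x - (α * β) • x := by
    intro x
    have := congrArg (fun L => L x) h6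
    rw [hsum, hprod, one_smul]
    exact this
  have hex : ∀ γ : ℂ, ∃ x, a x - γ • x ≠ 0 := by
    intro γ
    by_contra hcon
    push Not at hcon
    exact hns γ (LinearMap.ext fun x => sub_eq_zero.1 (hcon x))
  obtain ⟨x, hx⟩ := hex β
  obtain ⟨y, hy⟩ := hex α
  have hA : ∀ x, a (a x - β • x) = α • (a x - β • x) := by
    intro x; rw [map_sub, map_smul, h1]; module
  have hB : ∀ x, a (a x - α • x) = β • (a x - α • x) := by
    intro x; rw [map_sub, map_smul, h1]; module
  have hle : Module.finrank ℂ V ≤ 2 := by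
    have htop : Submodule.span ℂ (({a x - β • x, a y - α • y} : Finset V) : Set V) = ⊤ := by
      rw [eq_top_iff]
      intro z _
      obtain ⟨c, hc⟩ := onedim a α β hne h1 hT _ (a z - β • z) hx (hA x) (hA z)
      obtain ⟨d, hd⟩ := onedim a β α hne.symm (by
        intro x; rw [add_comm β, mul_comm β]; exact h1 x) hT _ (a z - α • z) hy (hB y) (hB z)
      have hz : z = r⁻¹ • ((a z - β • z) - (a z - α • z)) := by
        have : (a z - β • z) - (a z - α • z) = r • z := by rw [← hab]; module
        rw [this, smul_smul, inv_mul_cancel₀ hr0, one_smul]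
      rw [hz, hc, hd]
      refine Submodule.smul_mem _ _ (Submodule.sub_mem _ (Submodule.smul_mem _ _ ?_)
        (Submodule.smul_mem _ _ ?_))
      · exact Submodule.subset_span (by simp)
      · exact Submodule.subset_span (by simp)
    rw [← finrank_top ℂ V, ← htop]
    exact (finrank_span_finset_le_card _).trans Finset.card_le_two
  have hge : ¬ Module.finrank ℂ V ≤ 1 := by
    intro h
    rw [finrank_le_one_iff] at h
    obtain ⟨v, hv⟩ := h
    obtain ⟨c, hc⟩ := hv (a v)
    apply hns c
    ext w
    obtain ⟨d, rfl⟩ := hv w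
    rw [map_smul, ← hc]
    simp
  omega

end

section
variable {G : Type} [Group G] [Fintype G]
    {V : Type} [AddCommGroup V] [Module ℂ V] [FiniteDimensional ℂ V]

lemma central_of_scalar (ρ : Representation ℂ G V) (hinj : Function.Injective ρ) (x : G) (c : ℂ)
    (h : ρ x = c • 1) : x ∈ Subgroup.center G := by
  rw [Subgroup.mem_center_iff]
  intro g
  apply hinj
  rw [map_mul, map_mul, h]
  simp

lemma star (ρ : Representation ℂ G V) (hinj : Function.Injective ρ)
    (B : V →ₗ[ℂ] V →ₗ[ℂ] ℂ) (hB : ∀ g v w, B (ρ g v) w = B v (ρ g⁻¹ w))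
    (hB2 : ∀ w w', (∀ v, B v w = B v w') → w = w')
    (hC : ∀ x ∈ Subgroup.center G, ρ x = 1 ∨ ρ x = -1)
    (hE : ∀ h ∉ Subgroup.center G, eC ρ h = 2) (x : G) :
    x ^ 2 = 1 ∨ ∃ s : ℂ, ρ x + ρ x⁻¹ = s • 1 := by
  by_cases hx : x ∈ Subgroup.center G
  · left
    apply hinj
    rw [map_pow, map_one]
    rcases hC x hx with h | h <;> rw [h] <;> simp
  · obtain ⟨p, q, h1⟩ := eC_two ρ hinj x hx (hE x hx) (ρ x⁻¹) (by
      intro g hg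
      rw [← map_mul, ← map_mul]
      congr 1
      rw [inv_mul_eq_iff_eq_mul, ← mul_assoc, ← hg, mul_assoc, mul_inv_cancel, mul_one])
    have h2 : ρ x = p • 1 + q • ρ x⁻¹ := by
      ext w
      apply hB2
      intro v
      have e1 := hB x⁻¹ v w
      rw [inv_inv] at e1
      rw [← e1, h1]
      simp only [LinearMap.add_apply, LinearMap.smul_apply, Module.End.one_apply, map_add,
        map_smul]
      rw [hB, h1]
      simp
    have h3 : (1 - q ^ 2) • ρ x = (p + q * p) • (1 : V →ₗ[ℂ] V) := by
      linear_combination (norm := module) (1 : ℂ) • h2 + q • h1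
    have hq : q ^ 2 = 1 := by
      by_contra hne
      apply hx
      have hd : 1 - q ^ 2 ≠ 0 := sub_ne_zero.2 (Ne.symm hne)
      refine central_of_scalar ρ hinj x ((1 - q ^ 2)⁻¹ * (p + q * p)) ?_
      rw [mul_smul, ← h3, smul_smul, inv_mul_cancel₀ hd, one_smul]
    rcases mul_self_eq_one_iff.1 ((pow_two q).symm.trans hq) with h | h
    · left
      subst h
      have : (2 : ℂ) • (ρ x - ρ x⁻¹) = 0 := by
        linear_combination (norm := module) (1 : ℂ) • h2 - (1 : ℂ) • h1
      rcases smul_eq_zero.1 this with h | h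
      · norm_num at h
      · have := hinj (sub_eq_zero.1 h)
        rw [pow_two]
        nth_rewrite 1 [this]
        simp
    · right
      refine ⟨p, ?_⟩
      subst h
      linear_combination (norm := module) (1 : ℂ) • h1

lemma caseA (ρ : Representation ℂ G V) (hinj : Function.Injective ρ)
    (hst : ∀ x : G, x ^ 2 = 1 ∨ ∃ s : ℂ, ρ x + ρ x⁻¹ = s • 1)
    (hE : ∀ h ∉ Subgroup.center G, eC ρ h = 2) (g : G) (hg : g ^ 2 ∉ Subgroup.center G) :
    Module.finrank ℂ V = 2 := by
  have hg1 : g ∉ Subgroup.center G := fun h => hg (Subgroup.pow_mem _ h 2)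
  have hg2 : g ^ 2 ≠ 1 := fun h => hg (h ▸ Subgroup.one_mem _)
  obtain ⟨t, h2⟩ := (hst g).resolve_left hg2
  have h1 : ρ g * ρ g⁻¹ = 1 := by rw [← map_mul]; simp
  have h1' : ρ g⁻¹ * ρ g = 1 := by rw [← map_mul]; simp
  have hns : ∀ c : ℂ, ρ g ≠ c • 1 := fun c hc => hg1 (central_of_scalar ρ hinj g c hc)
  have h6 : ρ g * ρ g = t • ρ g - 1 := by
    have := congrArg (fun x => ρ g * x) h2
    simp only [mul_add, mul_smul_comm, mul_one, h1] at this
    exact eq_sub_of_add_eq this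
  have ht4 : t ^ 2 ≠ 4 := by
    intro ht
    obtain ⟨c, hc⟩ := unip (ρ g) t (orderOf g) (orderOf_pos g).ne'
      (by rw [← map_pow, pow_orderOf_eq_one, map_one]) h6 ht
    exact hns c hc
  have ht0 : t ≠ 0 := by
    rintro rfl
    apply hg
    apply central_of_scalar ρ hinj _ (-1)
    rw [pow_two, map_mul, h6]
    simp
  have hg4 : g⁻¹ ^ 2 ≠ g ^ 2 := by
    intro h
    have e1 : ρ g * ρ g = ρ g⁻¹ * ρ g⁻¹ := by
      rw [← map_mul, ← map_mul, ← pow_two, ← pow_two, h]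
    have e2 : ρ g⁻¹ * ρ g⁻¹ = t • ρ g⁻¹ - 1 := by
      have := congrArg (fun x => ρ g⁻¹ * x) h2
      simp only [mul_add, mul_smul_comm, mul_one, h1'] at this
      exact eq_sub_of_add_eq' this
    rw [h6, e2, sub_left_inj] at e1
    have := hinj (smul_right_injective _ ht0 e1)
    apply hg2
    rw [pow_two]
    nth_rewrite 1 [this]
    simp
  apply dim_two (ρ g) t hns h6 ht4
  intro T hTa
  apply eC_two ρ hinj g hg1 (hE g hg1)
  intro h hh
  have hc : Commute g h := hh.symm
  have key : ∃ p q : ℂ, ρ h = p • 1 + q • ρ g := by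
    rcases hst h with hh1 | ⟨u, hu⟩
    · have e1 : (g * h) ^ 2 ≠ 1 := by rw [hc.mul_pow, hh1, mul_one]; exact hg2
      obtain ⟨s, hs⟩ := (hst (g * h)).resolve_left e1
      have e2 : h⁻¹ = h := by
        rw [inv_eq_iff_mul_eq_one, ← pow_two, hh1]
      rw [mul_inv_rev, e2, ← (hc.inv_left).eq, map_mul, map_mul, ← add_mul, h2,
        smul_mul_assoc, one_mul] at hs
      refine ⟨t⁻¹ * s, 0, ?_⟩
      rw [mul_smul, ← hs, smul_smul, inv_mul_cancel₀ ht0, one_smul, zero_smul, add_zero]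
    · rcases hst (g * h) with e1 | ⟨s, hs⟩
      · rw [hc.mul_pow] at e1
        have e2 : (g⁻¹ * h) ^ 2 ≠ 1 := by
          rw [hc.inv_left.mul_pow]
          intro e3
          exact hg4 (mul_right_cancel (e3.trans e1.symm))
        obtain ⟨s, hs⟩ := (hst (g⁻¹ * h)).resolve_left e2
        rw [mul_inv_rev, inv_inv, ((hc.inv_right).eq).symm, map_mul, map_mul] at hs
        obtain ⟨p, q, hpq⟩ := alg1 (ρ g⁻¹) (ρ g) (ρ h) (ρ h⁻¹) s t u h1'
          (by rw [add_comm]; exact h2) hu hs ht4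
        refine ⟨p + q * t, -q, ?_⟩
        rw [hpq, eq_sub_of_add_eq' h2]
        module
      · rw [mul_inv_rev, ((hc.inv_inv).eq).symm, map_mul, map_mul] at hs
        exact alg1 (ρ g) (ρ g⁻¹) (ρ h) (ρ h⁻¹) s t u h1 h2 hu hs ht4
  obtain ⟨p, q, hpq⟩ := key
  rw [hpq]
  simp only [mul_add, add_mul, mul_smul_comm, smul_mul_assoc, hTa, one_mul, mul_one]

end

section
variable {G : Type} [Group G] [Fintype G]
    {V : Type} [AddCommGroup V] [Module ℂ V] [FiniteDimensional ℂ V]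

lemma char_sum_two (z : G) (hz1 : z ≠ 1) (F : G → ℂ) (hF : ∀ g, g ≠ 1 → g ≠ z → F g = 0) :
    ∑ g, F g = F 1 + F z := by
  classical
  rw [← Finset.sum_pair hz1.symm]
  symm
  apply Finset.sum_subset (Finset.subset_univ _)
  intro x _ hx
  simp only [Finset.mem_insert, Finset.mem_singleton, not_or] at hx
  exact hF x hx.1 hx.2

lemma char_zero {U : Type} [AddCommGroup U] [Module ℂ U] [FiniteDimensional ℂ U]
    (σ : Representation ℂ G U) (z : G) (hz : σ z = -1) (g h : G) (hh : h * g * h⁻¹ = z * g) :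
    σ.character g = 0 := by
  have h1 : σ.character (h * g * h⁻¹) = σ.character g := σ.char_conj g h
  rw [hh] at h1
  simp only [Representation.character, map_mul, hz, neg_mul, one_mul, map_neg] at h1 ⊢
  exact self_eq_neg.1 h1.symm

lemma caseB (ρ : Representation ℂ G V) (hinj : Function.Injective ρ) (hρ : IsIrreducibleRep ρ)
    (hC : ∀ x ∈ Subgroup.center G, ρ x = 1 ∨ ρ x = -1)
    (hZ : Nat.card (Subgroup.center G) = 2) (hsq : ∀ g : G, g ^ 2 ∈ Subgroup.center G) :
    Fintype.card G = 2 * Module.finrank ℂ V ^ 2 ∧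
      ∀ (U : Type) [AddCommGroup U] [Module ℂ U] [FiniteDimensional ℂ U]
        (σ : Representation ℂ G U), IsIrreducibleRep σ → ¬ RepIso σ ρ →
          Module.finrank ℂ U = 1 := by
  classical
  obtain ⟨z, hzc, hz1, hzall⟩ : ∃ z ∈ Subgroup.center G, z ≠ 1 ∧
      ∀ x ∈ Subgroup.center G, x = 1 ∨ x = z := by
    obtain ⟨z, hz, hzu⟩ := (Nat.card_eq_two_iff' (1 : Subgroup.center G)).1 hZ
    refine ⟨z, z.2, fun h => hz (Subtype.ext h), fun x hx => ?_⟩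
    by_cases h : x = 1
    · exact Or.inl h
    · right
      exact congrArg Subtype.val (hzu ⟨x, hx⟩ (fun h' => h (congrArg Subtype.val h')))
  have hρz : ρ z = -1 := by
    refine (hC z hzc).resolve_left fun h => hz1 (hinj (by rw [h, map_one]))
  have hzz : z * z = 1 := by
    apply hinj
    rw [map_mul, hρz, map_one]
    simp
  have hzinv : z⁻¹ = z := by rw [inv_eq_iff_mul_eq_one, hzz]
  have hcomm : ∀ g h : G, h * g * h⁻¹ = g ∨ h * g * h⁻¹ = z * g := by
    intro g h
    have e : h * g * h⁻¹ * g⁻¹ = (h * g) ^ 2 * (g⁻¹ * (h⁻¹) ^ 2 * g⁻¹⁻¹) * (g⁻¹) ^ 2 := by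
      simp [pow_two, mul_assoc]
    have hm : h * g * h⁻¹ * g⁻¹ ∈ Subgroup.center G := by
      rw [e]
      exact Subgroup.mul_mem _ (Subgroup.mul_mem _ (hsq _)
        ((inferInstance : (Subgroup.center G).Normal).conj_mem _ (hsq _) _)) (hsq _)
    rcases hzall _ hm with h1 | h1
    · left; exact mul_inv_eq_one.1 h1
    · right; exact mul_inv_eq_iff_eq_mul.1 h1
  have hnc : ∀ g, g ≠ 1 → g ≠ z → ∃ h, h * g * h⁻¹ = z * g := by
    intro g hg1 hgz
    by_contra hcon
    push Not at hcon
    have : g ∈ Subgroup.center G := by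
      rw [Subgroup.mem_center_iff]
      intro h
      exact mul_inv_eq_iff_eq_mul.1 ((hcomm g h).resolve_right (hcon h))
    rcases hzall g this with h | h
    · exact hg1 h
    · exact hgz h
  have hip : ∀ (U : Type) [AddCommGroup U] [Module ℂ U] [FiniteDimensional ℂ U]
      (σ : Representation ℂ G U), σ z = -1 →
      ip σ.character ρ.character =
        (Nat.card G : ℂ)⁻¹ * (2 * Module.finrank ℂ U * Module.finrank ℂ V) := by
    intro U _ _ _ σ hσ
    rw [ip, char_sum_two z hz1]
    · rw [inv_one, hzinv, char_one, char_one]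
      simp only [Representation.character, hσ, hρz, map_neg, LinearMap.trace_one]
      ring
    · intro g hg1 hgz
      obtain ⟨h, hh⟩ := hnc g hg1 hgz
      rw [char_zero ρ z hρz g h hh, mul_zero]
  have hG0 : (Nat.card G : ℂ) ≠ 0 := by simp
  have hVn := hρ.1
  have hV0 : (Module.finrank ℂ V : ℂ) ≠ 0 := by
    exact_mod_cast Module.finrank_pos.ne'
  refine ⟨?_, ?_⟩
  · have h1 := hip V ρ hρz
    rw [ip_irr ρ ρ hρ hρ, if_pos ⟨LinearEquiv.refl _ _, fun _ _ => rfl⟩] at h1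
    rw [eq_inv_mul_iff_mul_eq₀ hG0, mul_one, Nat.card_eq_fintype_card] at h1
    have h2 : (Fintype.card G : ℂ) = ((2 * Module.finrank ℂ V ^ 2 : ℕ) : ℂ) := by
      rw [h1]; push_cast; ring
    exact_mod_cast h2
  · intro U _ _ _ σ hσ hnot
    obtain ⟨c, hc⟩ := center_scalar σ hσ z hzc
    have hUn := hσ.1
    obtain ⟨v, hv⟩ := exists_ne (0 : U)
    have hcc : c * c = 1 := by
      have h1 : σ (z * z) = 1 := by rw [hzz, map_one]
      rw [map_mul, hc] at h1
      have h2 := congrArg (fun L => L v) h1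
      simp only [Module.End.mul_apply, LinearMap.smul_apply, Module.End.one_apply,
        smul_smul] at h2
      have h3 : (c * c - 1) • v = 0 := by rw [sub_smul, h2, one_smul, sub_self]
      rcases smul_eq_zero.1 h3 with h | h
      · exact sub_eq_zero.1 h
      · exact absurd h hv
    rcases mul_self_eq_one_iff.1 hcc with h | h
    · have hz' : σ z = 1 := by rw [hc, h, one_smul]
      have hsc : ∀ x, ∃ d : ℂ, σ x = d • LinearMap.id := by
        intro x
        apply schur_scalar σ hσ
        intro g w
        change (σ x * σ g) w = (σ g * σ x) w
        have e : σ (g * x * g⁻¹) = σ x := by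
          rcases hcomm x g with h1 | h1
          · rw [h1]
          · rw [h1, map_mul, hz', one_mul]
        have e2 : σ g * σ x = σ x * σ g := by
          have e3 : σ g * σ x = σ (g * x * g⁻¹) * σ g := by
            rw [← map_mul, ← map_mul]
            simp
          rw [e3, e]
        rw [e2]
      rcases hσ.2 (Submodule.span ℂ {v}) (by
        intro g w hw
        obtain ⟨d, hd⟩ := hsc g
        rw [hd]
        exact Submodule.smul_mem _ d hw) with h1 | h1
      · rw [Submodule.span_singleton_eq_bot] at h1
        exact absurd h1 hv
      · rw [← finrank_top ℂ U, ← h1, finrank_span_singleton hv]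
    · exfalso
      have hz' : σ z = -1 := by rw [hc, h, neg_smul, one_smul]
      have h1 := hip U σ hz'
      rw [ip_irr σ ρ hσ hρ, if_neg hnot] at h1
      have hU0 : (Module.finrank ℂ U : ℂ) ≠ 0 := by
        exact_mod_cast Module.finrank_pos.ne'
      exact (mul_ne_zero (inv_ne_zero hG0) (mul_ne_zero (mul_ne_zero two_ne_zero hU0) hV0)) h1.symm

end

/-- If the McKay graph `Γ(G,ρ)` of a nonzero representation `ρ` of a finite
group `G` is a tree, then `ρ` is irreducible and faithful, and either `dim ρ = 2`, or `G` is an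
extra special 2-group of order `2·(dim ρ)²` whose irreducible representations other than `ρ`
are all 1-dimensional. -/
theorem mckay_tree_classification
    {G : Type} [Group G] [Fintype G]
    {V : Type} [AddCommGroup V] [Module ℂ V] [FiniteDimensional ℂ V]
    (ρ : Representation ℂ G V) (hV : Module.finrank ℂ V ≠ 0)
    {ι : Type} [Fintype ι]
    (W : ι → Type) [∀ i, AddCommGroup (W i)] [∀ i, Module ℂ (W i)]
    [∀ i, FiniteDimensional ℂ (W i)]
    (Irr : (i : ι) → Representation ℂ G (W i))
    (hirr : ∀ i, IsIrreducibleRep (Irr i))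
    (hdist : ∀ i j, RepIso (Irr i) (Irr j) → i = j)
    (hcompl : ∀ (U : Type) [AddCommGroup U] [Module ℂ U] [FiniteDimensional ℂ U]
      (σ : Representation ℂ G U), IsIrreducibleRep σ → ∃ i, RepIso σ (Irr i))
    (hsym : ∀ i j, multHom ((Irr i).tprod ρ) (Irr j) = multHom ((Irr j).tprod ρ) (Irr i))
    (hle : ∀ i j, multHom ((Irr i).tprod ρ) (Irr j) ≤ 1)
    (hloop : ∀ i, multHom ((Irr i).tprod ρ) (Irr i) = 0)
    (htree : (SimpleGraph.fromRel fun i j => multHom ((Irr i).tprod ρ) (Irr j) = 1).IsTree) :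
    IsIrreducibleRep ρ ∧ Function.Injective ⇑ρ ∧
      (Module.finrank ℂ V = 2 ∨
        (Nat.card (Subgroup.center G) = 2 ∧ (∀ g : G, g ^ 2 ∈ Subgroup.center G) ∧
          Fintype.card G = 2 * Module.finrank ℂ V ^ 2 ∧
          ∀ (U : Type) [AddCommGroup U] [Module ℂ U] [FiniteDimensional ℂ U]
            (σ : Representation ℂ G U), IsIrreducibleRep σ → ¬ RepIso σ ρ →
              Module.finrank ℂ U = 1)) := by
  have S : IrrSys W Irr := ⟨hirr, hdist, hcompl⟩
  have hVn : Nontrivial V := Module.finrank_pos_iff.1 (Nat.pos_of_ne_zero hV)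
  have hρ := rho_irr S ρ hsym hle hloop htree
  have hinj := rho_faithful S ρ hsym hloop htree
  refine ⟨hρ, hinj, ?_⟩
  obtain ⟨B, hB, hB2⟩ := exists_form S ρ hρ hsym
  have hC := center_sq ρ hρ B hB hB2
  obtain ⟨hZ, hE⟩ := center_conc ρ hinj (center_le ρ hinj hC)
    (key_sum S ρ hsym hle hloop htree)
  have hst := star ρ hinj B hB hB2 hC hE
  by_cases hsq : ∀ g : G, g ^ 2 ∈ Subgroup.center G
  · exact Or.inr ⟨hZ, hsq, caseB ρ hinj hρ hC hZ hsq⟩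
  · left
    push Not at hsq
    obtain ⟨g, hg⟩ := hsq
    exact caseA ρ hinj hst hE g hg
end

section
/- Let G be a finite group and ρ a nonzero finite-dimensional complex representation of G such that the McKay graph Γ(G,ρ) is a forest (for all μ,λ ∈ Irr(G), [μ⊗ρ:λ] = [λ⊗ρ:μ] ≤ 1 and [μ⊗ρ:μ] = 0, and the simple graph on Irr(G) with μ adjacent to λ iff [μ⊗ρ:λ] = 1 is acyclic), and assume dim ρ ≥ 3. Let N = ker ρ. Then: (1) for every irreducible complex representation τ of N and every g ∈ G, the conjugate representation τ^g (given by τ^g(x) = τ(g⁻¹xg)) is isomorphic to τ; and (2) every vertex μ ∈ Irr(G) of the graph has degree Σ_{λ∈Irr(G)} [μ⊗ρ:λ] equal to either 1 or (dim ρ)² (i.e. every connected component is a star with (dim ρ)² leaves). -/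
open scoped TensorProduct

open scoped TensorProduct

namespace McKayAux

theorem graph_leaf {ι : Type} [Fintype ι] (H : SimpleGraph ι) (hH : H.IsAcyclic) (S : Set ι)
    (hne : S.Nonempty) (hS : ∀ v ∈ S, ∃ a ∈ S, ∃ b ∈ S, a ≠ b ∧ H.Adj v a ∧ H.Adj v b) : False := by
  classical
  let P : ℕ → Prop := fun l => ∃ (u v : ι) (p : H.Walk u v), p.IsPath ∧ p.length = l ∧ u ∈ S
  have hP0 : ∃ l, P l := by
    obtain ⟨v, hv⟩ := hne
    exact ⟨0, v, v, SimpleGraph.Walk.nil, by simp, by simp, hv⟩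
  have hbd : ∀ l, P l → l ≤ Fintype.card ι := by
    rintro l ⟨u, v, p, hp, rfl, -⟩
    exact hp.length_lt.le
  obtain ⟨l0, hl0⟩ := hP0
  have hmax := Nat.findGreatest_spec (P := P) (hbd l0 hl0) hl0
  obtain ⟨u, v, p, hp, hl, hu⟩ := hmax
  obtain ⟨a, ha, b, hb, hab, hua, hub⟩ := hS u hu
  have key : ∀ a ∈ S, H.Adj u a → a = p.snd := by
    intro a ha hua
    by_cases hmem : a ∈ p.support
    · exact hH.eq_snd_of_adj_start hp hua hmem
    · exfalso
      have h1 : P (p.length + 1) :=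
        ⟨a, v, SimpleGraph.Walk.cons hua.symm p, by
          rw [SimpleGraph.Walk.cons_isPath_iff]; exact ⟨hp, hmem⟩, by simp, ha⟩
      have h2 := Nat.le_findGreatest (hbd _ h1) h1
      omega
  exact hab ((key a ha hua).trans (key b hb hub).symm)

theorem graph_c4 {ι : Type} (H : SimpleGraph ι) (hH : H.IsAcyclic) {a b c d : ι}
    (h1 : H.Adj a b) (h2 : H.Adj b c) (h3 : H.Adj a d) (h4 : H.Adj d c) : a = c ∨ b = d := by
  by_contra hcon
  push Not at hcon
  obtain ⟨hac, hbd⟩ := hcon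
  have hp : (SimpleGraph.Walk.cons h1 (SimpleGraph.Walk.cons h2 SimpleGraph.Walk.nil)).IsPath := by
    simp [SimpleGraph.Walk.cons_isPath_iff, h1.ne, h2.ne, hac]
  have hq : (SimpleGraph.Walk.cons h3 (SimpleGraph.Walk.cons h4 SimpleGraph.Walk.nil)).IsPath := by
    simp [SimpleGraph.Walk.cons_isPath_iff, h3.ne, h4.ne, hac]
  have := (hH.subsingleton_path a c).elim ⟨_, hp⟩ ⟨_, hq⟩
  simp at this
  exact hbd this.1

theorem exists_eigenbasis {V : Type} [AddCommGroup V] [Module ℂ V] [FiniteDimensional ℂ V]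
    (f : Module.End ℂ V) (m : ℕ) (hm : 0 < m) (hf : f ^ m = 1) :
    ∃ (b : Module.Basis (Fin (Module.finrank ℂ V)) ℂ V) (ζ : Fin (Module.finrank ℂ V) → ℂ),
      (∀ i, f (b i) = ζ i • b i) ∧ ∀ i, ζ i ^ m = 1 := by
  classical
  have hss : f.IsSemisimple := by
    have : Squarefree (Polynomial.X ^ m - 1 : Polynomial ℂ) := by
      apply Polynomial.Separable.squarefree
      exact Polynomial.separable_X_pow_sub_C 1 (by exact_mod_cast hm.ne') one_ne_zero
    exact Module.End.isSemisimple_of_squarefree_aeval_eq_zero this (by simp [hf])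
  have htop : ⨆ μ : ℂ, f.eigenspace μ = ⊤ := by
    rw [← Module.End.iSup_maxGenEigenspace_eq_top f]
    congr 1; ext1 μ
    exact (hss.isFinitelySemisimple.maxGenEigenspace_eq_eigenspace μ).symm
  have hint : DirectSum.IsInternal (fun μ : ℂ => f.eigenspace μ) := by
    rw [DirectSum.isInternal_submodule_iff_iSupIndep_and_iSup_eq_top]
    exact ⟨f.eigenspaces_iSupIndep, htop⟩
  let B := hint.collectedBasis (fun μ => Module.finBasis ℂ (f.eigenspace μ))
  have hfin : Finite ((μ : ℂ) × Fin (Module.finrank ℂ (f.eigenspace μ))) := Module.Finite.finite_basis B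
  have : Fintype ((μ : ℂ) × Fin (Module.finrank ℂ (f.eigenspace μ))) := Fintype.ofFinite _
  have hc : Fintype.card ((μ : ℂ) × Fin (Module.finrank ℂ (f.eigenspace μ))) = Module.finrank ℂ V :=
    (Module.finrank_eq_card_basis B).symm
  let e := Fintype.equivFinOfCardEq hc
  have hB : ∀ i, f (B i) = i.1 • B i := by
    intro i
    have := hint.collectedBasis_mem (fun μ => Module.finBasis ℂ (f.eigenspace μ)) i
    exact Module.End.mem_eigenspace_iff.mp this
  have hev : ∀ i, f ((B.reindex e) i) = (e.symm i).1 • (B.reindex e) i := by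
    intro i; simp [hB]
  refine ⟨B.reindex e, fun i => (e.symm i).1, hev, ?_⟩
  intro i
  have hk : ∀ k, (f ^ k) ((B.reindex e) i) = ((e.symm i).1 ^ k) • (B.reindex e) i := by
    intro k
    induction k with
    | zero => simp
    | succ k ih => rw [pow_succ', Module.End.mul_apply, ih, map_smul, hev, smul_smul, pow_succ]
  have := hk m
  rw [hf, Module.End.one_apply] at this
  have h0 := (B.reindex e).ne_zero i
  have h2 : ((1:ℂ) - (e.symm i).1 ^ m) • (B.reindex e) i = 0 := by
    rw [sub_smul, one_smul, ← this, sub_self]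
  rcases smul_eq_zero.mp h2 with h | h
  · exact (sub_eq_zero.mp h).symm
  · exact absurd h h0

theorem char_eigen {G : Type} [Group G] [Fintype G] {V : Type} [AddCommGroup V] [Module ℂ V]
    [FiniteDimensional ℂ V] (ρ : Representation ℂ G V) (g : G) :
    ∃ ζ : Fin (Module.finrank ℂ V) → ℂ, (∀ i, ζ i ^ Fintype.card G = 1) ∧
      (∀ k : ℕ, ρ.character (g ^ k) = ∑ i, ζ i ^ k) ∧ ((∀ i, ζ i = 1) → ρ g = 1) := by
  classical
  obtain ⟨b, ζ, h1, h2⟩ := exists_eigenbasis (ρ g) (Fintype.card G) Fintype.card_pos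
    (by rw [← map_pow, pow_card_eq_one, map_one])
  refine ⟨ζ, h2, ?_, ?_⟩
  · intro k
    have hk : ∀ i, ((ρ g) ^ k) (b i) = (ζ i ^ k) • b i := by
      intro i
      induction k with
      | zero => simp
      | succ k ih => rw [pow_succ', Module.End.mul_apply, ih, map_smul, h1, smul_smul, pow_succ]
    rw [Representation.character, map_pow, LinearMap.trace_eq_matrix_trace ℂ b, Matrix.trace]
    refine Finset.sum_congr rfl fun i _ => ?_
    simp [LinearMap.toMatrix_apply, hk]
  · intro h
    apply b.ext
    intro i
    simp [h1, h]

theorem char_inv {G : Type} [Group G] [Fintype G] {V : Type} [AddCommGroup V] [Module ℂ V]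
    [FiniteDimensional ℂ V] (ρ : Representation ℂ G V) (g : G) :
    ρ.character g⁻¹ = (starRingEnd ℂ) (ρ.character g) := by
  obtain ⟨ζ, h1, h2, -⟩ := char_eigen ρ g
  have hg : g⁻¹ = g ^ (Fintype.card G - 1) := by
    rw [inv_eq_iff_mul_eq_one, ← pow_succ', Nat.sub_add_cancel Fintype.card_pos, pow_card_eq_one]
  have e1 := h2 1
  rw [pow_one] at e1
  rw [hg, h2, e1, map_sum]
  refine Finset.sum_congr rfl fun i _ => ?_
  have hn : ‖ζ i‖ = 1 := Complex.norm_eq_one_of_pow_eq_one (h1 i) Fintype.card_ne_zero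
  have h0 : ζ i ≠ 0 := by intro h; simp [h] at hn
  rw [pow_one, ← Complex.inv_eq_conj hn]
  apply eq_inv_of_mul_eq_one_left
  rw [← pow_succ, Nat.sub_add_cancel Fintype.card_pos, h1]

end McKayAux

namespace McKayAux

theorem trichotomy_real {G : Type} [Group G] [Fintype G] (y : G → ℝ) (n : ℕ) (hn : 3 ≤ n)
    (heig : ∀ g, ∃ c : Fin n → ℝ, (∀ i, |c i| ≤ 1) ∧ y g = ∑ i, c i ∧
      y (g ^ 3) = ∑ i, (4 * c i ^ 3 - 3 * c i))
    (hf : ∀ g, y (g ^ 3) = y g ^ 3 - ((n:ℝ) ^ 2 - 1) * y g) (g : G) :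
    y g = 0 ∨ y g = n ∨ y g = -n := by
  classical
  have hn' : (3:ℝ) ≤ n := by exact_mod_cast hn
  have hb : ∀ g, |y g| ≤ n := by
    intro g
    obtain ⟨c, hc, h1, -⟩ := heig g
    rw [h1]
    calc |∑ i, c i| ≤ ∑ i, |c i| := Finset.abs_sum_le_sum_abs _ _
      _ ≤ ∑ i : Fin n, (1:ℝ) := Finset.sum_le_sum fun i _ => hc i
      _ = n := by simp
  have h9 : ∀ g, n - y (g ^ 3) ≤ 9 * (n - y g) ∧ n + y (g ^ 3) ≤ 9 * (n + y g) := by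
    intro g
    obtain ⟨c, hc, h1, h2⟩ := heig g
    have hN : (n:ℝ) = ∑ i : Fin n, (1:ℝ) := by simp
    rw [h1, h2, hN]
    constructor
    · rw [← Finset.sum_sub_distrib, ← Finset.sum_sub_distrib, Finset.mul_sum]
      refine Finset.sum_le_sum fun i _ => ?_
      have := abs_le.mp (hc i)
      nlinarith [mul_nonneg (mul_nonneg (sub_nonneg.mpr this.2) (by linarith : 0 ≤ 1 + c i)) (by linarith : 0 ≤ 2 - c i), mul_nonneg (sub_nonneg.mpr this.2) (by linarith : 0 ≤ 1 + c i), mul_nonneg (sub_nonneg.mpr this.2) (mul_nonneg (sub_nonneg.mpr this.2) (by linarith : 0 ≤ 1 + c i))]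
    · rw [← Finset.sum_add_distrib, ← Finset.sum_add_distrib, Finset.mul_sum]
      refine Finset.sum_le_sum fun i _ => ?_
      have := abs_le.mp (hc i)
      nlinarith [mul_nonneg (by linarith : 0 ≤ 1 + c i) (mul_nonneg (sub_nonneg.mpr this.2) (by linarith : 0 ≤ 1 + c i)), mul_nonneg (sub_nonneg.mpr this.2) (by linarith : 0 ≤ 1 + c i)]
  have step : ∀ g, y g = n ∨ y g = -n ∨ |y g| < 1 := by
    intro g
    by_contra hcon
    push Not at hcon
    obtain ⟨e1, e2, e3⟩ := hcon
    obtain ⟨k1, k2⟩ := h9 g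
    have hb1 := abs_le.mp (hb g)
    have hb3 := abs_le.mp (hb (g ^ 3))
    rw [hf g] at k1 k2 hb3
    have p1 : 0 < n - y g := lt_of_le_of_ne (by linarith) (by intro h; apply e1; linarith)
    have p2 : 0 < n + y g := lt_of_le_of_ne (by linarith) (by intro h; apply e2; linarith)
    have q1 : y g ^ 2 + n * y g + 1 ≤ 9 := by
      by_contra h
      push Not at h
      nlinarith [mul_lt_mul_of_pos_left h p1]
    have q2 : y g ^ 2 - n * y g + 1 ≤ 9 := by
      by_contra h
      push Not at h
      nlinarith [mul_lt_mul_of_pos_left h p2]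
    rcases le_abs.mp e3 with h | h
    · have h2 : y g < 2 := by nlinarith
      nlinarith [mul_nonneg (sub_nonneg.mpr h) (sub_nonneg.mpr h2.le), mul_nonneg (sub_nonneg.mpr h) (sub_nonneg.mpr hn'), mul_nonneg (mul_nonneg (sub_nonneg.mpr h) (sub_nonneg.mpr h2.le)) (by linarith : 0 ≤ y g), mul_nonneg (sub_nonneg.mpr h) (mul_nonneg (sub_nonneg.mpr hn') (sub_nonneg.mpr hn'))]
    · have h2 : - y g < 2 := by nlinarith
      nlinarith [mul_nonneg (sub_nonneg.mpr h) (sub_nonneg.mpr h2.le), mul_nonneg (sub_nonneg.mpr h) (sub_nonneg.mpr hn'), mul_nonneg (mul_nonneg (sub_nonneg.mpr h) (sub_nonneg.mpr h2.le)) (by linarith : 0 ≤ -y g), mul_nonneg (sub_nonneg.mpr h) (mul_nonneg (sub_nonneg.mpr hn') (sub_nonneg.mpr hn'))]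
  by_contra hcon
  push Not at hcon
  obtain ⟨c0, c1, c2⟩ := hcon
  have c3 : |y g| < 1 := by
    rcases step g with h | h | h
    · exact absurd h c1
    · exact absurd h c2
    · exact h
  let S : Finset G := Finset.univ.filter fun g => y g ≠ 0 ∧ |y g| < 1
  have hSne : S.Nonempty := ⟨g, by simp [S, c0, c3]⟩
  obtain ⟨h, hhS, hmax⟩ := Finset.exists_max_image S (fun g => |y g|) hSne
  simp only [S, Finset.mem_filter, Finset.mem_univ, true_and] at hhS hmax
  obtain ⟨hh0, hh1⟩ := hhS
  have hlt := abs_lt.mp hh1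
  have hpos : 0 < |y h| := abs_pos.mpr hh0
  have hy2 : y h ^ 2 < 1 := by nlinarith
  have habs : |y (h ^ 3)| = |y h| * ((n:ℝ) ^ 2 - 1 - y h ^ 2) := by
    rw [hf h, show y h ^ 3 - ((n:ℝ) ^ 2 - 1) * y h = - (y h * ((n:ℝ) ^ 2 - 1 - y h ^ 2)) by ring,
      abs_neg, abs_mul, abs_of_pos (a := (n:ℝ) ^ 2 - 1 - y h ^ 2) (by nlinarith)]
  have hgt : |y h| < |y (h ^ 3)| := by
    rw [habs]
    have : 1 < (n:ℝ) ^ 2 - 1 - y h ^ 2 := by nlinarith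
    nlinarith
  have hnot : ¬ |y (h ^ 3)| < 1 := by
    intro hc
    have := hmax (h ^ 3) ⟨by intro h0; rw [h0, abs_zero] at hgt; linarith, hc⟩
    linarith
  obtain ⟨c, hc, s1, s2⟩ := heig h
  have fin : ∀ ε : ℤ, (ε = 1 ∨ ε = -1) → y (h ^ 3) = ε * n → False := by
    intro ε hε hy
    have hε2 : (ε:ℝ) * ε = 1 := by rcases hε with r | r <;> rw [r] <;> norm_num
    -- all terms equal ε
    have hterm : ∀ i, ε * c i = 1 ∨ 2 * (ε * c i) = -1 := by
      have hz : ∑ i, (1 - ε * (4 * c i ^ 3 - 3 * c i)) = 0 := by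
        rw [Finset.sum_sub_distrib, ← Finset.mul_sum, ← s2, hy]
        simp [← mul_assoc, hε2]
      have hcub : ∀ i, 1 - ε * (4 * c i ^ 3 - 3 * c i) = (1 - ε * c i) * (2 * (ε * c i) + 1) ^ 2 := by
        intro i
        linear_combination (4 * c i ^ 3 * ε) * hε2
      have hnn : ∀ i ∈ Finset.univ, 0 ≤ 1 - ε * (4 * c i ^ 3 - 3 * c i) := by
        intro i _
        rw [hcub]
        have := abs_le.mp (hc i)
        apply mul_nonneg _ (sq_nonneg _)
        rcases hε with r | r <;> rw [r] <;> push_cast <;> linarith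
      intro i
      have := (Finset.sum_eq_zero_iff_of_nonneg hnn).mp hz i (Finset.mem_univ i)
      rw [hcub] at this
      rcases mul_eq_zero.mp this with h | h
      · left; linarith
      · right; have := pow_eq_zero_iff (two_ne_zero) |>.mp h; linarith
    have hint : ∃ k : ℤ, 2 * (ε * y h) = k := by
      have : ∀ i, ∃ k : ℤ, 2 * (ε * c i) = k := by
        intro i
        rcases hterm i with h | h
        · exact ⟨2, by rw [h]; norm_num⟩
        · exact ⟨-1, by rw [h]; norm_num⟩
      choose k hk using this
      refine ⟨∑ i, k i, ?_⟩
      rw [s1, Finset.mul_sum, Finset.mul_sum]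
      push_cast
      exact Finset.sum_congr rfl fun i _ => hk i
    obtain ⟨k, hk⟩ := hint
    have hpoly : (ε * y h - n) * ((ε * y h) ^ 2 + n * (ε * y h) + 1) = 0 := by
      have := hf h
      rw [hy] at this
      linear_combination (-(ε:ℝ)) * this + (y h ^ 3 * ε + n) * hε2
    have habs1 : |(ε:ℝ) * y h| < 1 := by
      rcases hε with r | r <;> rw [r] <;> simpa using hh1
    have hl := abs_lt.mp habs1
    rcases mul_eq_zero.mp hpoly with h | h
    · linarith
    · have hkk : (k:ℝ) ^ 2 + 2 * n * k + 4 = 0 := by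
        rw [← hk]; linear_combination 4 * h
      have hki : k ^ 2 + 2 * (n:ℤ) * k + 4 = 0 := by exact_mod_cast hkk
      have b1 : k < 2 := by
        have : (k:ℝ) < 2 := by rw [← hk]; linarith
        exact_mod_cast this
      have b2 : -2 < k := by
        have : (-2:ℝ) < k := by rw [← hk]; linarith
        exact_mod_cast this
      interval_cases k <;> omega
  rcases step (h ^ 3) with h1 | h1 | h1
  · exact fin 1 (Or.inl rfl) (by simpa using h1)
  · exact fin (-1) (Or.inr rfl) (by simpa using h1)
  · exact hnot h1

theorem trichotomy {G : Type} [Group G] [Fintype G] (x : G → ℂ) (n : ℕ) (hn : 3 ≤ n)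
    (heig : ∀ g, ∃ ζ : Fin n → ℂ, (∀ i, ζ i ^ Fintype.card G = 1) ∧ ∀ k : ℕ, x (g ^ k) = ∑ i, ζ i ^ k)
    (hreal : ∀ g, (starRingEnd ℂ) (x g) = x g)
    (hf : ∀ g, x (g ^ 3) = x g ^ 3 - ((n:ℂ) ^ 2 - 1) * x g) (g : G) :
    x g = 0 ∨ x g = n ∨ x g = -n := by
  have hre : ∀ g, x g = ((x g).re : ℂ) := fun g => (Complex.conj_eq_iff_re.mp (hreal g)).symm
  have := trichotomy_real (fun g => (x g).re) n hn ?_ ?_ g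
  · rw [hre g]
    rcases this with h | h | h
    · left; rw [h]; simp
    · right; left; rw [h]; simp
    · right; right; rw [h]; simp
  · intro g
    obtain ⟨ζ, h1, h2⟩ := heig g
    have hnorm : ∀ i, ‖ζ i‖ = 1 := fun i => Complex.norm_eq_one_of_pow_eq_one (h1 i) Fintype.card_ne_zero
    refine ⟨fun i => (ζ i).re, fun i => (Complex.abs_re_le_norm _).trans (hnorm i).le, ?_, ?_⟩
    · have := h2 1
      simp only [pow_one] at this
      simp [this]
    · simp only [h2 3, Complex.re_sum]
      refine Finset.sum_congr rfl fun i _ => ?_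
      have hs : (ζ i).re ^ 2 + (ζ i).im ^ 2 = 1 := by
        have := Complex.sq_norm (ζ i)
        rw [hnorm i, Complex.normSq_apply] at this
        nlinarith
      simp only [pow_succ, pow_zero, one_mul, Complex.mul_re, Complex.mul_im]
      linear_combination (-3 * (ζ i).re) * hs
  · intro g
    have h := hf g
    rw [hre (g ^ 3), hre g] at h
    exact_mod_cast h

end McKayAux

namespace McKayAux
open Representation

theorem toIrr {G V : Type} [Group G] [AddCommGroup V] [Module ℂ V]
    {ρ : Representation ℂ G V} (h : IsIrreducibleRep ρ) : ρ.IsIrreducible := by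
  obtain ⟨hn, h⟩ := h
  refine { exists_pair_ne := ⟨⊥, ⊤, ?_⟩, eq_bot_or_eq_top := ?_ }
  · intro he
    have : (⊥ : Subrepresentation ρ).toSubmodule = (⊤ : Subrepresentation ρ).toSubmodule := by rw [he]
    exact bot_ne_top (α := Submodule ℂ V) this
  · intro p
    rcases h p.toSubmodule (fun g v hv => p.apply_mem_toSubmodule g hv) with h | h
    · left; exact Subrepresentation.toSubmodule_injective h
    · right; exact Subrepresentation.toSubmodule_injective h

theorem repIso_iff {G V W : Type} [Group G] [AddCommGroup V] [Module ℂ V] [AddCommGroup W]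
    [Module ℂ W] (π : Representation ℂ G V) (τ : Representation ℂ G W) :
    RepIso π τ ↔ Nonempty (π.Equiv τ) := by
  constructor
  · rintro ⟨e, he⟩
    exact ⟨Representation.Equiv.mk e (fun g => by ext v; exact he g v)⟩
  · rintro ⟨e⟩
    exact ⟨e.toLinearEquiv, fun g v => by
      have := IntertwiningMap.isIntertwining _ _ e.toIntertwiningMap g v
      exact this⟩

theorem char_compl {G U : Type} [Group G] [AddCommGroup U] [Module ℂ U] [FiniteDimensional ℂ U]
    (σ : Representation ℂ G U) (p q : Subrepresentation σ)
    (h : IsCompl p.toSubmodule q.toSubmodule) (g : G) :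
    σ.character g = p.toRepresentation.character g + q.toRepresentation.character g := by
  let e := Submodule.prodEquivOfIsCompl _ _ h
  have : σ g = e.conj ((p.toRepresentation g).prodMap (q.toRepresentation g)) := by
    rw [LinearEquiv.conj_apply]
    rw [LinearEquiv.eq_comp_toLinearMap_symm]
    apply LinearMap.ext
    rintro ⟨a, b⟩
    simp only [LinearMap.comp_apply, LinearEquiv.coe_coe, LinearMap.prodMap_apply, e, Submodule.coe_prodEquivOfIsCompl', map_add]
    rfl
  rw [Representation.character, this, LinearMap.trace_conj', LinearMap.trace_prodMap']
  rfl

/-- nonnegative integer combination -/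
def IsCh {G ι : Type} [Fintype ι] (χ : ι → G → ℂ) (f : G → ℂ) : Prop :=
  ∃ m : ι → ℕ, ∀ g, f g = ∑ i, (m i : ℂ) * χ i g

theorem rep_isCh {G : Type} [Group G] [Fintype G]
    {ι : Type} [Fintype ι]
    (W : ι → Type) [∀ i, AddCommGroup (W i)] [∀ i, Module ℂ (W i)]
    [∀ i, FiniteDimensional ℂ (W i)]
    (Irr : (i : ι) → Representation ℂ G (W i))
    (hcompl : ∀ (U : Type) [AddCommGroup U] [Module ℂ U] [FiniteDimensional ℂ U]
      (σ : Representation ℂ G U), IsIrreducibleRep σ → ∃ i, RepIso σ (Irr i)) :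
    ∀ (d : ℕ) (U : Type) [AddCommGroup U] [Module ℂ U] [FiniteDimensional ℂ U]
      (σ : Representation ℂ G U), Module.finrank ℂ U = d →
      IsCh (fun i => (Irr i).character) σ.character := by
  classical
  intro d
  induction d using Nat.strong_induction_on with
  | _ d ih =>
    intro U _ _ _ σ hd
    by_cases hirr : IsIrreducibleRep σ
    · obtain ⟨i, hi⟩ := hcompl U σ hirr
      obtain ⟨e⟩ := (repIso_iff _ _).mp hi
      refine ⟨fun j => if j = i then 1 else 0, fun g => ?_⟩
      rw [char_iso e]
      simp
    · by_cases hU : Nontrivial U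
      · have : ¬ ∀ p : Submodule ℂ U, (∀ g : G, ∀ v ∈ p, σ g v ∈ p) → p = ⊥ ∨ p = ⊤ :=
          fun h => hirr ⟨hU, h⟩
        push Not at this
        obtain ⟨p, hp, hb, ht⟩ := this
        let P : Subrepresentation σ := ⟨p, fun g v hv => hp g v hv⟩
        have hss : σ.IsSemisimpleRepresentation := by
          rw [isSemisimpleRepresentation_iff_isSemisimpleModule_asModule]
          infer_instance
        obtain ⟨Q, hQ⟩ := hss.exists_isCompl P
        have hc : IsCompl P.toSubmodule Q.toSubmodule := by
          constructor
          · rw [disjoint_iff, ← Subrepresentation.toSubmodule_inf, hQ.inf_eq_bot]; rfl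
          · rw [codisjoint_iff, ← Subrepresentation.toSubmodule_sup, hQ.sup_eq_top]; rfl
        have hsum := Submodule.finrank_add_eq_of_isCompl hc
        have hP0 : Module.finrank ℂ P.toSubmodule < Module.finrank ℂ U :=
          Submodule.finrank_lt ht
        have hP1 : 0 < Module.finrank ℂ P.toSubmodule := by
          rw [Nat.pos_iff_ne_zero]
          intro h
          exact hb (Submodule.finrank_eq_zero.mp h)
        obtain ⟨m1, h1⟩ := ih _ (by omega) _ P.toRepresentation rfl
        obtain ⟨m2, h2⟩ := ih _ (by omega) _ Q.toRepresentation rfl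
        refine ⟨m1 + m2, fun g => ?_⟩
        rw [char_compl σ P Q hc, h1, h2, ← Finset.sum_add_distrib]
        refine Finset.sum_congr rfl fun i _ => ?_
        simp [add_mul]
      · refine ⟨0, fun g => ?_⟩
        rw [not_nontrivial_iff_subsingleton] at hU
        have : σ g = 0 := by ext v; exact Subsingleton.elim _ _
        simp [Representation.character, this]

theorem idem_isCh {G : Type} [Group G] [Fintype G]
    {ι : Type} [Fintype ι]
    (W : ι → Type) [∀ i, AddCommGroup (W i)] [∀ i, Module ℂ (W i)]
    [∀ i, FiniteDimensional ℂ (W i)]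
    (Irr : (i : ι) → Representation ℂ G (W i))
    (hcompl : ∀ (U : Type) [AddCommGroup U] [Module ℂ U] [FiniteDimensional ℂ U]
      (σ : Representation ℂ G U), IsIrreducibleRep σ → ∃ i, RepIso σ (Irr i))
    {I : Type} [Fintype I] [DecidableEq I] (K : G →* Matrix I I ℂ) (P : Matrix I I ℂ)
    (hP : P * P = P) (hc : ∀ g, P * K g = K g * P) :
    IsCh (fun i => (Irr i).character) (fun g => (P * K g).trace) := by
  let σ : Representation ℂ G (I → ℂ) := (Matrix.toLinAlgEquiv' (R := ℂ) (n := I)).toMonoidHom.comp K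
  have hσ : ∀ g, σ g = Matrix.toLin' (K g) := fun g => rfl
  have hPP : IsIdempotentElem (Matrix.toLin' P) := by
    show Matrix.toLin' P * Matrix.toLin' P = _
    rw [Module.End.mul_eq_comp, ← Matrix.toLin'_mul, hP]
  have hcomm : ∀ g v, Matrix.toLin' P (σ g v) = σ g (Matrix.toLin' P v) := by
    intro g v
    rw [hσ, ← Matrix.toLin'_mul_apply, hc, Matrix.toLin'_mul_apply]
  let R : Subrepresentation σ := ⟨LinearMap.range (Matrix.toLin' P), by
    rintro g _ ⟨v, rfl⟩
    exact ⟨σ g v, hcomm g v⟩⟩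
  let S : Subrepresentation σ := ⟨LinearMap.ker (Matrix.toLin' P), by
    intro g v hv
    rw [LinearMap.mem_ker] at hv ⊢
    rw [hcomm, hv, map_zero]⟩
  have hcompl' : IsCompl R.toSubmodule S.toSubmodule := LinearMap.IsIdempotentElem.isCompl hPP
  obtain ⟨m, hm⟩ := rep_isCh W Irr hcompl _ _ R.toRepresentation rfl
  refine ⟨m, fun g => ?_⟩
  rw [← hm]
  let e := Submodule.prodEquivOfIsCompl _ _ hcompl'
  have : Matrix.toLin' (P * K g) = e.conj ((R.toRepresentation g).prodMap 0) := by
    rw [LinearEquiv.conj_apply]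
    rw [LinearEquiv.eq_comp_toLinearMap_symm]
    apply LinearMap.ext
    rintro ⟨a, b⟩
    have hb : Matrix.toLin' P (b : I → ℂ) = 0 := b.2
    have ha : Matrix.toLin' P (a : I → ℂ) = a := by
      obtain ⟨w, hw⟩ := a.2
      rw [← hw, ← Module.End.mul_apply, hPP.eq]
    simp only [LinearMap.comp_apply, LinearEquiv.coe_coe, LinearMap.prodMap_apply, e, Submodule.coe_prodEquivOfIsCompl', map_add, hc, Matrix.toLin'_mul_apply, ha, hb]
    simp
    rfl
  have h2 : LinearMap.trace ℂ _ (Matrix.toLin' (P * K g)) = R.toRepresentation.character g := by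
    rw [this, LinearMap.trace_conj', LinearMap.trace_prodMap']
    simp [Representation.character]
  rw [← h2, Matrix.trace_toLin'_eq]

end McKayAux

namespace McKayAux
open Representation Matrix
open scoped Kronecker

section
variable {I : Type} [Fintype I] [DecidableEq I]

theorem pm_comm (e : Equiv.Perm I) (M : Matrix I I ℂ) (h : ∀ a b, M (e a) (e b) = M a b) :
    e.permMatrix ℂ * M = M * e.permMatrix ℂ := by
  ext a b
  rw [Equiv.Perm.permMatrix, PEquiv.toMatrix_toPEquiv_mul, PEquiv.mul_toMatrix_toPEquiv]
  simp only [submatrix_apply, id]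
  rw [← h a (e.symm b), Equiv.apply_symm_apply]

theorem pm_trace (e : Equiv.Perm I) (M : Matrix I I ℂ) :
    (e.permMatrix ℂ * M).trace = ∑ a, M (e a) a := by
  rw [Equiv.Perm.permMatrix, PEquiv.toMatrix_toPEquiv_mul, trace]
  rfl

theorem pm_mul (e f : Equiv.Perm I) : e.permMatrix ℂ * f.permMatrix ℂ = (f * e).permMatrix ℂ := by
  rw [Matrix.permMatrix_mul]
end

variable {N : Type} [Fintype N] [DecidableEq N]

def sw2 (N : Type) : Equiv.Perm (N × N) := Equiv.prodComm N N

def cyc (N : Type) : Equiv.Perm (N × N × N) where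
  toFun p := (p.2.1, p.2.2, p.1)
  invFun p := (p.2.2, p.1, p.2.1)
  left_inv _ := rfl
  right_inv _ := rfl

def sw3 (N : Type) : Equiv.Perm (N × N × N) where
  toFun p := (p.2.1, p.1, p.2.2)
  invFun p := (p.2.1, p.1, p.2.2)
  left_inv _ := rfl
  right_inv _ := rfl

theorem tr2 (M : Matrix N N ℂ) : ((sw2 N).permMatrix ℂ * (M ⊗ₖ M)).trace = (M * M).trace := by
  rw [pm_trace, Fintype.sum_prod_type]
  simp only [trace, diag_apply, mul_apply, sw2, Equiv.prodComm_apply, Prod.swap, kroneckerMap_apply]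
  exact Finset.sum_congr rfl fun a _ => Finset.sum_congr rfl fun b _ => by ring

theorem tr3s (M : Matrix N N ℂ) :
    ((sw3 N).permMatrix ℂ * (M ⊗ₖ (M ⊗ₖ M))).trace = (M * M).trace * M.trace := by
  rw [pm_trace, Fintype.sum_prod_type]
  rw [trace, Finset.sum_mul]
  simp only [diag_apply, mul_apply, sw3, Equiv.coe_fn_mk, kroneckerMap_apply, Fintype.sum_prod_type]
  simp only [Finset.sum_mul]
  simp only [trace, diag_apply, Finset.mul_sum]
  exact Finset.sum_congr rfl fun a _ => Finset.sum_congr rfl fun b _ => Finset.sum_congr rfl fun c _ => by ring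

theorem tr3c (M : Matrix N N ℂ) :
    ((cyc N).permMatrix ℂ * (M ⊗ₖ (M ⊗ₖ M))).trace = (M * M * M).trace := by
  rw [pm_trace, Fintype.sum_prod_type]
  simp only [trace, diag_apply, mul_apply, cyc, Equiv.coe_fn_mk, kroneckerMap_apply, Fintype.sum_prod_type, Finset.sum_mul, Finset.mul_sum]
  refine Finset.sum_congr rfl fun a _ => ?_
  refine Finset.sum_congr rfl fun b _ => ?_
  refine Finset.sum_congr rfl fun c _ => by ring

theorem tr3cc (M : Matrix N N ℂ) :
    (((cyc N) * (cyc N)).permMatrix ℂ * (M ⊗ₖ (M ⊗ₖ M))).trace = (M * M * M).trace := by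
  rw [pm_trace, Fintype.sum_prod_type]
  simp only [trace, diag_apply, mul_apply, cyc, Equiv.coe_fn_mk, Equiv.Perm.mul_apply, kroneckerMap_apply, Fintype.sum_prod_type, Finset.sum_mul, Finset.mul_sum]
  refine Finset.sum_congr rfl fun a _ => ?_
  rw [Finset.sum_comm' (t' := Finset.univ) (s' := fun _ => Finset.univ) (by simp)]
  refine Finset.sum_congr rfl fun b _ => ?_
  refine Finset.sum_congr rfl fun c _ => by ring

theorem ring_idem {A : Type} [Ring A] [Algebra ℂ A] (C T : A) (hC : C * C * C = 1) (hT : T * T = 1)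
    (hTC : T * C = C * C * T) (ε : ℂ) (hε : ε * ε = 1) :
    ((1/6 : ℂ) • ((1 + C + C * C) * (1 + ε • T))) * ((1/6 : ℂ) • ((1 + C + C * C) * (1 + ε • T)))
      = (1/6 : ℂ) • ((1 + C + C * C) * (1 + ε • T)) := by
  have hT2 : T * (C * C) = C * T := by
    rw [← mul_assoc, hTC, mul_assoc, hTC, ← mul_assoc, ← mul_assoc, hC, one_mul]
  have h1 : (1 + ε • T) * (1 + C + C * C) = (1 + C + C * C) * (1 + ε • T) := by
    simp only [add_mul, mul_add, one_mul, mul_one, smul_mul_assoc, mul_smul_comm, hTC, hT2]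
    module
  have h2 : (1 + C + C * C) * (1 + C + C * C) = (3:ℂ) • (1 + C + C * C) := by
    have e1 : C * (C * C) = 1 := by rw [← mul_assoc, hC]
    have e2 : C * C * (C * C) = C := by rw [← mul_assoc, hC, one_mul]
    simp only [add_mul, mul_add, one_mul, mul_one, e1, e2, hC]
    module
  have h3 : (1 + ε • T) * (1 + ε • T) = (2:ℂ) • (1 + ε • T) := by
    have hTT : (ε • T) * (ε • T) = 1 := by rw [smul_mul_smul_comm, hT, hε, one_smul]
    simp only [add_mul, mul_add, one_mul, mul_one, hTT]
    module
  have h4 : ((1 + C + C * C) * (1 + ε • T)) * ((1 + C + C * C) * (1 + ε • T))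
      = (6:ℂ) • ((1 + C + C * C) * (1 + ε • T)) := by
    rw [mul_assoc, ← mul_assoc (1 + ε • T), h1, mul_assoc (1 + C + C * C) (1 + ε • T), h3, ← mul_assoc, h2]
    simp only [smul_mul_assoc, mul_smul_comm, smul_smul]
    norm_num
  rw [smul_mul_smul_comm, h4, smul_smul]
  norm_num

theorem ring_idemQ {A : Type} [Ring A] [Algebra ℂ A] (C : A) (hC : C * C * C = 1) :
    ((1/3 : ℂ) • ((2:ℂ) • 1 - C - C * C)) * ((1/3 : ℂ) • ((2:ℂ) • 1 - C - C * C))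
      = (1/3 : ℂ) • ((2:ℂ) • 1 - C - C * C) := by
  have e1 : C * (C * C) = 1 := by rw [← mul_assoc, hC]
  have e2 : C * C * (C * C) = C := by rw [← mul_assoc, hC, one_mul]
  simp only [sub_mul, mul_sub, one_mul, mul_one, smul_mul_assoc, mul_smul_comm, e1, e2, hC, smul_sub, smul_smul]
  module

section
variable {G : Type} [Group G] [Fintype G]
    {ι : Type} [Fintype ι]
    (W : ι → Type) [∀ i, AddCommGroup (W i)] [∀ i, Module ℂ (W i)]
    [∀ i, FiniteDimensional ℂ (W i)]
    (Irr : (i : ι) → Representation ℂ G (W i))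
    (hcompl : ∀ (U : Type) [AddCommGroup U] [Module ℂ U] [FiniteDimensional ℂ U]
      (σ : Representation ℂ G U), IsIrreducibleRep σ → ∃ i, RepIso σ (Irr i))
    (K : G →* Matrix N N ℂ)
include hcompl

theorem isCh2 (ε : ℂ) (hε : ε * ε = 1) : IsCh (fun i => (Irr i).character)
    (fun g => ((K g).trace ^ 2 + ε * (K (g ^ 2)).trace) / 2) := by
  let K2 : G →* Matrix (N × N) (N × N) ℂ :=
    { toFun := fun g => K g ⊗ₖ K g
      map_one' := by simp
      map_mul' := fun a b => by simp [mul_kronecker_mul] }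
  have hT : (sw2 N).permMatrix ℂ * (sw2 N).permMatrix ℂ = 1 := by
    rw [pm_mul]
    have : sw2 N * sw2 N = 1 := rfl
    rw [this, Matrix.permMatrix_one]
  have hc : ∀ g, (sw2 N).permMatrix ℂ * K2 g = K2 g * (sw2 N).permMatrix ℂ := by
    intro g
    apply pm_comm
    rintro ⟨a, b⟩ ⟨c, d⟩
    simp [K2, sw2, mul_comm]
  have key := idem_isCh W Irr hcompl K2 ((1/2:ℂ) • (1 + ε • (sw2 N).permMatrix ℂ)) ?_ ?_
  · convert key using 2 with g
    have h1 : ((sw2 N).permMatrix ℂ * K2 g).trace = (K (g ^ 2)).trace := by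
      rw [pow_two, map_mul]; exact tr2 (K g)
    have h2 : (K2 g).trace = (K g).trace ^ 2 := by
      rw [pow_two]; exact trace_kronecker _ _
    simp only [smul_mul_assoc, add_mul, one_mul, trace_smul, trace_add, h1, h2, smul_eq_mul]
    ring
  · have hTT : (ε • (sw2 N).permMatrix ℂ) * (ε • (sw2 N).permMatrix ℂ) = 1 := by
      rw [smul_mul_smul_comm, hT, hε, one_smul]
    rw [smul_mul_smul_comm]
    simp only [add_mul, mul_add, one_mul, mul_one, hTT]
    module
  · intro g
    simp only [smul_mul_assoc, mul_smul_comm, add_mul, mul_add, one_mul, mul_one, hc g]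

theorem isCh3aux : ∃ (K3 : G →* Matrix (N × N × N) (N × N × N) ℂ) (C T : Matrix (N × N × N) (N × N × N) ℂ),
    C * C * C = 1 ∧ T * T = 1 ∧ T * C = C * C * T ∧
    ∀ g, C * K3 g = K3 g * C ∧ T * K3 g = K3 g * T ∧ (K3 g).trace = (K g).trace ^ 3 ∧
      (C * K3 g).trace = (K (g ^ 3)).trace ∧ (C * C * K3 g).trace = (K (g ^ 3)).trace ∧
      (T * K3 g).trace = (K (g ^ 2)).trace * (K g).trace := by
  let K3 : G →* Matrix (N × N × N) (N × N × N) ℂ :=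
    { toFun := fun g => K g ⊗ₖ (K g ⊗ₖ K g)
      map_one' := by simp
      map_mul' := fun a b => by simp [mul_kronecker_mul] }
  refine ⟨K3, (cyc N).permMatrix ℂ, (sw3 N).permMatrix ℂ, ?_, ?_, ?_, ?_⟩
  · rw [pm_mul, pm_mul]
    have : cyc N * (cyc N * cyc N) = 1 := rfl
    rw [this, Matrix.permMatrix_one]
  · rw [pm_mul]
    have : sw3 N * sw3 N = 1 := rfl
    rw [this, Matrix.permMatrix_one]
  · rw [pm_mul, pm_mul, pm_mul]
    rfl
  · intro g
    refine ⟨?_, ?_, ?_, ?_, ?_, ?_⟩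
    · apply pm_comm
      rintro ⟨a, b, c⟩ ⟨a', b', c'⟩
      simp only [K3, cyc, MonoidHom.coe_mk, OneHom.coe_mk, Equiv.coe_fn_mk, kroneckerMap_apply]
      ring
    · apply pm_comm
      rintro ⟨a, b, c⟩ ⟨a', b', c'⟩
      simp only [K3, sw3, MonoidHom.coe_mk, OneHom.coe_mk, Equiv.coe_fn_mk, kroneckerMap_apply]
      ring
    · have : (K3 g).trace = (K g).trace * ((K g).trace * (K g).trace) := by
        rw [← trace_kronecker, ← trace_kronecker]; rfl
      rw [this]; ring
    · rw [pow_succ, pow_two, map_mul, map_mul]; exact tr3c (K g)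
    · rw [pow_succ, pow_two, map_mul, map_mul, pm_mul]; exact tr3cc (K g)
    · rw [pow_two, map_mul]; exact tr3s (K g)

theorem isCh3 (ε : ℂ) (hε : ε * ε = 1) : IsCh (fun i => (Irr i).character)
    (fun g => ((K g).trace ^ 3 + 3 * ε * ((K (g ^ 2)).trace * (K g).trace) + 2 * (K (g ^ 3)).trace) / 6) := by
  obtain ⟨K3, C, T, hC, hT, hTC, h⟩ := isCh3aux W Irr hcompl K
  have key := idem_isCh W Irr hcompl K3 ((1/6 : ℂ) • ((1 + C + C * C) * (1 + ε • T)))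
    (ring_idem C T hC hT hTC ε hε) ?_
  · convert key using 2 with g
    obtain ⟨hCK, hTK, t0, t1, t2, t3⟩ := h g
    have t4 : (C * T * K3 g).trace = (K (g ^ 2)).trace * (K g).trace := by
      rw [← t3]
      have e : C * T = C * C * (T * C) := by
        rw [hTC]
        have e2 : C * C * (C * C * T) = (C * C * C) * (C * T) := by simp only [mul_assoc]
        rw [e2, hC, one_mul]
      rw [e, mul_assoc, trace_mul_comm, mul_assoc T, hCK, mul_assoc, mul_assoc,
        show C * (C * C) = 1 by rw [← mul_assoc, hC], mul_one]
    have t5 : (C * C * T * K3 g).trace = (K (g ^ 2)).trace * (K g).trace := by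
      rw [← t3]
      have e : C * C * T = C * (T * (C * C)) := by
        rw [← mul_assoc T, hTC, mul_assoc (C * C) T C, hTC]
        have e2 : C * (C * C * (C * C * T)) = (C * C * C) * (C * C * T) := by simp only [mul_assoc]
        rw [e2, hC, one_mul]
      rw [e, mul_assoc, trace_mul_comm, mul_assoc T, mul_assoc C C (K3 g), hCK, ← mul_assoc C (K3 g), hCK,
        mul_assoc, mul_assoc, mul_assoc, show C * (C * C) = 1 by rw [← mul_assoc, hC], mul_one]
    simp only [smul_mul_assoc, mul_smul_comm, add_mul, mul_add, one_mul, mul_one, trace_smul, trace_add, smul_eq_mul,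
      t0, t1, t2, t3, t4, t5]
    ring
  · intro g
    obtain ⟨hCK, hTK, -⟩ := h g
    have c1 : Commute C (K3 g) := hCK
    have c2 : Commute T (K3 g) := hTK
    have c3 : Commute ((1 + C + C * C) * (1 + ε • T)) (K3 g) :=
      (((Commute.one_left _).add_left c1).add_left (c1.mul_left c1)).mul_left
        ((Commute.one_left _).add_left (c2.smul_left ε))
    exact c3.smul_left _

theorem isChQ : IsCh (fun i => (Irr i).character)
    (fun g => (2 * (K g).trace ^ 3 - 2 * (K (g ^ 3)).trace) / 3) := by
  obtain ⟨K3, C, T, hC, hT, hTC, h⟩ := isCh3aux W Irr hcompl K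
  have key := idem_isCh W Irr hcompl K3 ((1/3 : ℂ) • ((2:ℂ) • 1 - C - C * C)) (ring_idemQ C hC) ?_
  · convert key using 2 with g
    obtain ⟨hCK, hTK, t0, t1, t2, t3⟩ := h g
    simp only [smul_mul_assoc, sub_mul, one_mul, trace_smul, trace_sub, smul_eq_mul, t0, t1, t2]
    ring
  · intro g
    obtain ⟨hCK, hTK, -⟩ := h g
    have c1 : Commute C (K3 g) := hCK
    have c3 : Commute ((2:ℂ) • 1 - C - C * C) (K3 g) :=
      ((((Commute.one_left _).smul_left _).sub_left c1).sub_left (c1.mul_left c1))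
    exact c3.smul_left _
end
end McKayAux

namespace McKayAux
open Finset

section
variable {G : Type} [Group G] [Fintype G] {ι : Type} [Fintype ι]

noncomputable def ip (f h : G → ℂ) : ℂ := (Fintype.card G : ℂ)⁻¹ * ∑ g, f g * h g⁻¹

theorem ip_coef [DecidableEq ι] (χ : ι → G → ℂ)
    (orth : ∀ i j, ip (χ i) (χ j) = if i = j then 1 else 0)
    (m : ι → ℂ) (f : G → ℂ) (hf : ∀ g, f g = ∑ i, m i * χ i g) (k : ι) : ip f (χ k) = m k := by
  have : ip f (χ k) = ∑ i, m i * ip (χ i) (χ k) := by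
    simp only [ip, hf, sum_mul, mul_sum]
    rw [sum_comm]
    exact sum_congr rfl fun i _ => sum_congr rfl fun g _ => by ring
  rw [this]
  simp [orth]

theorem coef_unique [DecidableEq ι] (χ : ι → G → ℂ)
    (orth : ∀ i j, ip (χ i) (χ j) = if i = j then 1 else 0)
    (m m' : ι → ℕ) (h : ∀ g, ∑ i, (m i : ℂ) * χ i g = ∑ i, (m' i : ℂ) * χ i g) (k : ι) : m k = m' k := by
  have h1 := ip_coef χ orth (fun i => (m i : ℂ)) _ (fun g => rfl) k
  have h2 := ip_coef χ orth (fun i => (m' i : ℂ)) (fun g => ∑ i, (m i : ℂ) * χ i g) h k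
  rw [h1] at h2
  exact_mod_cast h2

structure Hyp [DecidableEq ι] (χ : ι → G → ℂ) (x : G → ℂ) (A : ι → ι → ℕ) (i0 : ι) (n : ℕ) : Prop where
  orth : ∀ i j, ip (χ i) (χ j) = if i = j then 1 else 0
  hx : ∀ i g, χ i g * x g = ∑ j, (A i j : ℂ) * χ j g
  hsym : ∀ i j, A i j = A j i
  hle : ∀ i j, A i j ≤ 1
  hloop : ∀ i, A i i = 0
  hforest : (SimpleGraph.fromRel fun i j => A i j = 1).IsAcyclic
  h0 : ∀ g, χ i0 g = 1
  hnorm : ∀ i, IsCh χ (fun g => χ i g * χ i g⁻¹)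
  hdual : IsCh χ (fun g => x g⁻¹)
  hS : ∀ ε : ℂ, ε * ε = 1 → IsCh χ (fun g => (x g ^ 2 + ε * x (g ^ 2)) / 2)
  hS3 : ∀ ε : ℂ, ε * ε = 1 → IsCh χ (fun g => (x g ^ 3 + 3 * ε * (x (g ^ 2) * x g) + 2 * x (g ^ 3)) / 6)
  hQ : IsCh χ (fun g => (2 * x g ^ 3 - 2 * x (g ^ 3)) / 3)
  heig : ∀ g, ∃ ζ : Fin n → ℂ, (∀ i, ζ i ^ Fintype.card G = 1) ∧ ∀ k : ℕ, x (g ^ k) = ∑ i, ζ i ^ k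
  hconj : ∀ g, x g⁻¹ = (starRingEnd ℂ) (x g)
  hn : 3 ≤ n
  hx1 : x 1 = n
  hχ1 : ∀ i, χ i 1 ≠ 0

namespace Hyp
variable [DecidableEq ι] {χ : ι → G → ℂ} {x : G → ℂ} {A : ι → ι → ℕ} {i0 : ι} {n : ℕ}

theorem adj (H : Hyp χ x A i0 n) {i j : ι} (h : A i j ≠ 0) :
    (SimpleGraph.fromRel fun i j => A i j = 1).Adj i j := by
  rw [SimpleGraph.fromRel_adj]
  refine ⟨?_, Or.inl ?_⟩
  · rintro rfl; exact h (H.hloop i)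
  · have := H.hle i j; omega

theorem real (H : Hyp χ x A i0 n) (g : G) : x g⁻¹ = x g := by
  obtain ⟨m, hm⟩ := H.hdual
  have hk : ∀ k, (m k : ℂ) = A k i0 := by
    intro k
    rw [← ip_coef χ H.orth (fun k => (m k : ℂ)) _ hm k,
      ← ip_coef χ H.orth (fun j => (A k j : ℂ)) _ (H.hx k) i0]
    unfold ip
    congr 1
    rw [← Equiv.sum_comp (Equiv.inv G)]
    refine sum_congr rfl fun g _ => ?_
    simp [H.h0, mul_comm]
  have := hm g
  simp only at this
  rw [this]
  have h2 := H.hx i0 g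
  rw [H.h0, one_mul] at h2
  rw [h2]
  refine sum_congr rfl fun k _ => ?_
  rw [hk, H.hsym]

theorem sq_ip (H : Hyp χ x A i0 n) (i : ι) :
    ((∑ j, A i j : ℕ) : ℂ) = (Fintype.card G : ℂ)⁻¹ * ∑ g, (x g ^ 2) * (χ i g * χ i g⁻¹) := by
  have h1 : ((∑ j, A i j : ℕ) : ℂ) = ∑ j, (A i j : ℂ) * ip (fun g => χ i g * x g) (χ j) := by
    push_cast
    refine sum_congr rfl fun j _ => ?_
    rw [ip_coef χ H.orth (fun j => (A i j : ℂ)) _ (H.hx i) j]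
    have := H.hle i j
    interval_cases (A i j) <;> simp
  rw [h1]
  simp only [ip]
  have : ∀ g, (x g ^ 2) * (χ i g * χ i g⁻¹) = ∑ j, (A i j : ℂ) * (χ i g * x g * χ j g⁻¹) := by
    intro g
    have := H.hx i g⁻¹
    calc _ = χ i g * x g * (χ i g⁻¹ * x g⁻¹) := by rw [H.real]; ring
      _ = _ := by rw [this, mul_sum]; exact sum_congr rfl fun j _ => by ring
  simp only [this, mul_sum]
  rw [sum_comm]
  exact sum_congr rfl fun j _ => sum_congr rfl fun g _ => by ring

theorem deg_ge (H : Hyp χ x A i0 n) (i : ι) : ∑ j, A i0 j ≤ ∑ j, A i j := by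
  obtain ⟨s, hs⟩ := H.hS 1 (by norm_num)
  obtain ⟨a, ha⟩ := H.hS (-1) (by norm_num)
  obtain ⟨d, hd⟩ := H.hnorm i
  have hc : ∀ g, x g ^ 2 = ∑ j, ((s j : ℂ) + a j) * χ j g := by
    intro g
    have h1 := hs g
    have h2 := ha g
    simp only at h1 h2
    simp only [add_mul, sum_add_distrib]
    rw [← h1, ← h2]; ring
  have hd0 : (d i0 : ℂ) = 1 := by
    rw [← ip_coef χ H.orth (fun j => (d j : ℂ)) _ hd i0]
    have := H.orth i i
    simp only [ip, if_true] at this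
    simp only [ip, H.h0, mul_one]
    exact this
  have hc0 : ((s i0 : ℂ) + a i0) = (∑ j, A i0 j : ℕ) := by
    rw [H.sq_ip i0, ← ip_coef χ H.orth (fun j => (s j : ℂ) + a j) _ hc i0]
    simp [ip, H.h0]
  have hi : ((∑ j, A i j : ℕ) : ℂ) = ∑ j, ((s j : ℂ) + a j) * d j := by
    rw [H.sq_ip i]
    have h3 : ∀ j, (d j : ℂ) = (Fintype.card G : ℂ)⁻¹ * ∑ g, (χ j g) * (χ i g * χ i g⁻¹) := by
      intro j
      rw [← ip_coef χ H.orth (fun j => (d j : ℂ)) _ hd j]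
      unfold ip
      congr 1
      rw [← Equiv.sum_comp (Equiv.inv G)]
      refine sum_congr rfl fun g _ => ?_
      simp only [Equiv.inv_apply, inv_inv]
      ring
    simp only [h3, hc, sum_mul, mul_sum]
    rw [sum_comm]
    exact sum_congr rfl fun j _ => sum_congr rfl fun g _ => by ring
  have hi' : ∑ j, A i j = ∑ j, (s j + a j) * d j := by exact_mod_cast hi
  have hc0' : s i0 + a i0 = ∑ j, A i0 j := by exact_mod_cast hc0
  have hd0' : d i0 = 1 := by exact_mod_cast hd0
  rw [hi', ← hc0']
  have := single_le_sum (f := fun j => (s j + a j) * d j) (fun j _ => Nat.zero_le _) (mem_univ i0)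
  simpa [hd0'] using this

theorem deg_pos (H : Hyp χ x A i0 n) (i : ι) : 1 ≤ ∑ j, A i j := by
  by_contra h
  have h0 : ∑ j, A i j = 0 := by omega
  rw [sum_eq_zero_iff] at h0
  have := H.hx i 1
  rw [sum_eq_zero (fun j _ => by rw [h0 j (mem_univ j)]; simp), H.hx1] at this
  have hn := H.hn
  rcases mul_eq_zero.mp this with h | h
  · exact H.hχ1 i h
  · have : n = 0 := by exact_mod_cast h
    omega

theorem two_nbr (H : Hyp χ x A i0 n) (i : ι) (h : 2 ≤ ∑ j, A i j) :
    ∃ a b, a ≠ b ∧ A i a ≠ 0 ∧ A i b ≠ 0 := by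
  have hc : ∑ j, A i j ≤ (univ.filter fun j => A i j ≠ 0).card := by
    rw [card_filter]
    refine sum_le_sum fun j _ => ?_
    have := H.hle i j
    split_ifs with h <;> omega
  obtain ⟨a, ha, b, hb, hab⟩ := one_lt_card.mp (show 1 < (univ.filter fun j => A i j ≠ 0).card by omega)
  exact ⟨a, b, hab, (mem_filter.mp ha).2, (mem_filter.mp hb).2⟩

theorem deg_i0 (H : Hyp χ x A i0 n) : ∑ j, A i0 j = 1 := by
  by_contra hne
  have h1 := H.deg_pos i0
  refine graph_leaf _ H.hforest Set.univ ⟨i0, trivial⟩ ?_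
  intro v _
  have := H.deg_ge v
  obtain ⟨a, b, hab, ha, hb⟩ := H.two_nbr v (by omega)
  exact ⟨a, trivial, b, trivial, hab, H.adj ha, H.adj hb⟩

theorem exists_r (H : Hyp χ x A i0 n) : ∃ r, ∀ g, x g = χ r g := by
  have h1 := H.deg_i0
  have : ∃ r, A i0 r ≠ 0 := by
    by_contra h
    push Not at h
    simp [h] at h1
  obtain ⟨r, hr⟩ := this
  refine ⟨r, fun g => ?_⟩
  have hr1 : A i0 r = 1 := by have := H.hle i0 r; omega
  have h2 := H.hx i0 g
  rw [H.h0, one_mul] at h2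
  rw [h2, sum_eq_single r]
  · simp [hr1]
  · intro j _ hj
    have : A i0 j = 0 := by
      have h3 := add_le_sum (f := fun j => A i0 j) (fun j _ => Nat.zero_le _) (mem_univ j) (mem_univ r) hj
      omega
    simp [this]
  · simp

theorem cube (H : Hyp χ x A i0 n) (g : G) : x (g ^ 3) = x g ^ 3 - ((n:ℂ)^2 - 1) * x g := by
  obtain ⟨r, hr⟩ := H.exists_r
  obtain ⟨s, hs⟩ := H.hS 1 (by norm_num)
  obtain ⟨a, ha⟩ := H.hS (-1) (by norm_num)
  obtain ⟨p, hp⟩ := H.hS3 1 (by norm_num)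
  obtain ⟨q, hq⟩ := H.hS3 (-1) (by norm_num)
  obtain ⟨t, ht⟩ := H.hQ
  simp only at hs ha hp hq ht
  have hsa : ∀ j, s j + a j = A r j := by
    intro j
    refine coef_unique χ H.orth (fun j => s j + a j) (A r) (fun g => ?_) j
    rw [← H.hx r g, ← hr]
    push_cast
    simp only [add_mul, sum_add_distrib]
    rw [← hs, ← ha]; ring
  have hmul : ∀ (c : ι → ℕ) (g : G), (∑ j, (c j : ℂ) * χ j g) * x g
      = ∑ k, ((∑ j, c j * A j k : ℕ) : ℂ) * χ k g := by
    intro c g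
    rw [sum_mul]
    simp only [mul_assoc, H.hx]
    push_cast
    simp only [mul_sum, sum_mul]
    rw [sum_comm]
    exact sum_congr rfl fun j _ => sum_congr rfl fun g _ => by ring
  have hB : ∀ k, 2 * ∑ j, s j * A j k = 2 * p k + t k := by
    intro k
    refine coef_unique χ H.orth (fun k => 2 * ∑ j, s j * A j k) (fun k => 2 * p k + t k) (fun g => ?_) k
    have h1 : ∑ k, ((2 * ∑ j, s j * A j k : ℕ) : ℂ) * χ k g = 2 * ((∑ j, (s j : ℂ) * χ j g) * x g) := by
      rw [hmul, mul_sum]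
      exact sum_congr rfl fun k _ => by push_cast; ring
    have h2 : ∑ k, ((2 * p k + t k : ℕ) : ℂ) * χ k g = 2 * (∑ k, (p k : ℂ) * χ k g) + ∑ k, (t k : ℂ) * χ k g := by
      rw [mul_sum, ← sum_add_distrib]
      exact sum_congr rfl fun k _ => by push_cast; ring
    rw [h1, h2, ← hs, ← hp, ← ht]
    ring
  have hC : ∀ k, 2 * ∑ j, a j * A j k = 2 * q k + t k := by
    intro k
    refine coef_unique χ H.orth (fun k => 2 * ∑ j, a j * A j k) (fun k => 2 * q k + t k) (fun g => ?_) k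
    have h1 : ∑ k, ((2 * ∑ j, a j * A j k : ℕ) : ℂ) * χ k g = 2 * ((∑ j, (a j : ℂ) * χ j g) * x g) := by
      rw [hmul, mul_sum]
      exact sum_congr rfl fun k _ => by push_cast; ring
    have h2 : ∑ k, ((2 * q k + t k : ℕ) : ℂ) * χ k g = 2 * (∑ k, (q k : ℂ) * χ k g) + ∑ k, (t k : ℂ) * χ k g := by
      rw [mul_sum, ← sum_add_distrib]
      exact sum_congr rfl fun k _ => by push_cast; ring
    rw [h1, h2, ← ha, ← hq, ← ht]
    ring
  have htk : ∀ k, k ≠ r → t k = 0 := by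
    intro k hk
    by_contra hne
    have hb : ∑ j, s j * A j k ≠ 0 := by have := hB k; omega
    have hc : ∑ j, a j * A j k ≠ 0 := by have := hC k; omega
    obtain ⟨j, -, hj⟩ := exists_ne_zero_of_sum_ne_zero hb
    obtain ⟨l, -, hl⟩ := exists_ne_zero_of_sum_ne_zero hc
    have hj1 : s j ≠ 0 := left_ne_zero_of_mul hj
    have hl1 : a l ≠ 0 := left_ne_zero_of_mul hl
    rcases graph_c4 _ H.hforest (H.adj (show A r j ≠ 0 by have := hsa j; omega)) (H.adj (right_ne_zero_of_mul hj))
      (H.adj (show A r l ≠ 0 by have := hsa l; omega)) (H.adj (right_ne_zero_of_mul hl)) with h | h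
    · exact hk h.symm
    · subst h
      have := hsa j
      have := H.hle r j
      omega
  have hfin : ∀ g, (2 * x g ^ 3 - 2 * x (g ^ 3)) / 3 = t r * x g := by
    intro g
    rw [ht, sum_eq_single r, hr]
    · intro k _ hk
      simp [htk k hk]
    · simp
  have h1 := hfin 1
  rw [one_pow, H.hx1] at h1
  have hn0 : (n : ℂ) ≠ 0 := by
    have := H.hn
    exact_mod_cast (by omega : n ≠ 0)
  have h2 : (t r : ℂ) = 2 * ((n:ℂ)^2 - 1) / 3 := by
    apply mul_right_cancel₀ hn0
    rw [← h1]; ring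
  have h3 := hfin g
  rw [h2] at h3
  linear_combination (-3/2 : ℂ) * h3

theorem tri (H : Hyp χ x A i0 n) (g : G) : x g = 0 ∨ x g = n ∨ x g = -n :=
  trichotomy x n H.hn H.heig (fun g => by rw [← H.hconj, H.real]) H.cube g

theorem walk3 (H : Hyp χ x A i0 n) (i j : ι) : ∑ k, ∑ l, A i k * A k l * A l j = n ^ 2 * A i j := by
  refine coef_unique χ H.orth (fun j => ∑ k, ∑ l, A i k * A k l * A l j) (fun j => n ^ 2 * A i j) (fun g => ?_) j
  have h3 : x g * x g * x g = (n:ℂ) ^ 2 * x g := by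
    rcases H.tri g with h | h | h <;> rw [h] <;> ring
  have e1 : ∑ j, ((n ^ 2 * A i j : ℕ) : ℂ) * χ j g = χ i g * (x g * x g * x g) := by
    rw [h3, show χ i g * ((n:ℂ) ^ 2 * x g) = (n:ℂ)^2 * (χ i g * x g) by ring, H.hx, mul_sum]
    exact sum_congr rfl fun j _ => by push_cast; ring
  rw [e1, show χ i g * (x g * x g * x g) = χ i g * x g * x g * x g by ring, H.hx]
  rw [sum_mul]
  simp only [mul_assoc, H.hx]
  simp only [← mul_assoc, mul_sum, sum_mul]
  simp only [mul_assoc, H.hx]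
  push_cast
  simp only [mul_sum, sum_mul]
  rw [sum_comm]
  refine sum_congr rfl fun k _ => ?_
  rw [sum_comm]
  exact sum_congr rfl fun l _ => sum_congr rfl fun j _ => by ring

theorem deg_add (H : Hyp χ x A i0 n) (i j : ι) (hij : A i j ≠ 0) :
    ∑ k, A i k + ∑ k, A j k = n ^ 2 + 1 := by
  have hij1 : A i j = 1 := by have := H.hle i j; omega
  have h := H.walk3 i j
  rw [hij1, mul_one] at h
  rw [← h]
  have key : ∀ k l, A i k * A k l * A l j + (if k = j then (if l = i then 1 else 0) else 0)
      = (if k = j then A j l else 0) + (if l = i then A i k else 0) := by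
    intro k l
    by_cases hp : A i k * A k l * A l j = 0
    · rw [hp]
      by_cases hk : k = j
      · subst hk
        rw [H.hsym l k, hij1] at hp
        have hp' : A k l = 0 := by simpa using hp
        by_cases hl : l = i
        · subst hl
          rw [H.hsym] at hij1; omega
        · simp [hl, hp']
      · by_cases hl : l = i
        · subst hl
          rw [H.hsym k l, hij1] at hp
          have hp' : A l k = 0 := by simpa using hp
          simp [hk, hp']
        · simp [hk, hl]
    · have h1 : A i k ≠ 0 := left_ne_zero_of_mul (left_ne_zero_of_mul hp)
      have h2 : A k l ≠ 0 := right_ne_zero_of_mul (left_ne_zero_of_mul hp)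
      have h3 : A l j ≠ 0 := right_ne_zero_of_mul hp
      have c4 := graph_c4 _ H.hforest (H.adj h1) (H.adj h2) (H.adj hij) (H.adj (by rwa [H.hsym]))
      have l1 : A i k = 1 := by have := H.hle i k; omega
      have l2 : A k l = 1 := by have := H.hle k l; omega
      have l3 : A l j = 1 := by have := H.hle l j; omega
      have l4 : A j l = 1 := by rw [H.hsym, l3]
      rw [l1, l2, l3, l4]
      rcases c4 with rfl | rfl
      · by_cases hk : k = j <;> simp [hk]
      · by_cases hl : l = i <;> simp [hl]
  have h5 := sum_congr rfl fun k (_ : k ∈ univ) => sum_congr rfl fun l (_ : l ∈ univ) => key k l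
  simp only [sum_add_distrib] at h5
  have e1 : ∑ k, ∑ l, (if k = j then (if l = i then 1 else 0) else 0) = 1 := by
    rw [sum_eq_single j] <;> simp +contextual
  have e2 : ∑ k, ∑ l, (if k = j then A j l else 0) = ∑ k, A j k := by
    rw [sum_eq_single j] <;> simp +contextual
  have e3 : ∑ k, ∑ l, (if l = i then A i k else 0) = ∑ k, A i k := by simp
  rw [e1, e2, e3] at h5
  omega

theorem exists_nbr (H : Hyp χ x A i0 n) (i : ι) : ∃ j, A i j ≠ 0 := by
  have h1 := H.deg_pos i
  by_contra h
  push Not at h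
  simp [h] at h1

theorem part2 (H : Hyp χ x A i0 n) (i : ι) : ∑ j, A i j = 1 ∨ ∑ j, A i j = n ^ 2 := by
  by_contra hne
  push Not at hne
  have hle : ∀ i, ∑ j, A i j ≤ n ^ 2 := by
    intro i
    obtain ⟨j, hj⟩ := H.exists_nbr i
    have := H.deg_add i j hj
    have := H.deg_pos j
    omega
  refine graph_leaf _ H.hforest {v | ∑ j, A v j ≠ 1 ∧ ∑ j, A v j ≠ n ^ 2} ⟨i, hne⟩ ?_
  rintro v ⟨hv1, hv2⟩
  have := H.deg_pos v
  have := hle v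
  obtain ⟨a, b, hab, ha, hb⟩ := H.two_nbr v (by omega)
  have h1 := H.deg_add v a ha
  have h2 := H.deg_add v b hb
  exact ⟨a, ⟨by omega, by omega⟩, b, ⟨by omega, by omega⟩, hab, H.adj ha, H.adj hb⟩

end Hyp
end
end McKayAux

namespace McKayAux
open Finset

section
variable {G : Type} [Group G] [Fintype G]

theorem ip_comm (f h : G → ℂ) : ip f h = ip h f := by
  unfold ip
  congr 1
  rw [← Equiv.sum_comp (Equiv.inv G)]
  refine sum_congr rfl fun g _ => ?_
  simp [mul_comm]

theorem ip_sub_left (f f' h : G → ℂ) : ip (fun g => f g - f' g) h = ip f h - ip f' h := by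
  unfold ip
  rw [← mul_sub, ← sum_sub_distrib]
  congr 1
  exact sum_congr rfl fun g _ => by ring

theorem ip_smul_left (c : ℂ) (f h : G → ℂ) : ip (fun g => c * f g) h = c * ip f h := by
  unfold ip
  rw [← mul_assoc, mul_comm c, mul_assoc]
  congr 1
  rw [mul_sum]
  exact sum_congr rfl fun g _ => by ring

theorem ip_self_nonneg (f : G → ℂ) (hf : ∀ g, f g⁻¹ = (starRingEnd ℂ) (f g)) : 0 ≤ (ip f f).re := by
  unfold ip
  simp only [hf, Complex.mul_conj]
  rw [← Complex.ofReal_natCast, ← Complex.ofReal_inv, ← Complex.ofReal_sum, ← Complex.ofReal_mul, Complex.ofReal_re]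
  exact mul_nonneg (by positivity) (sum_nonneg fun g _ => Complex.normSq_nonneg _)

theorem bessel (f t u : G → ℂ) (hf : ∀ g, f g⁻¹ = (starRingEnd ℂ) (f g))
    (ht : ∀ g, t g⁻¹ = (starRingEnd ℂ) (t g)) (hu : ∀ g, u g⁻¹ = (starRingEnd ℂ) (u g))
    (m : ℕ) (hm : m ≠ 0) (h1 : ip f f = 1) (h2 : ip t t = 1) (h3 : ip u u = 1) (h4 : ip f t = m)
    (h5 : ip f u = m) (h6 : ip t u = 0) : False := by
  have key := ip_self_nonneg (fun g => (f g - (m:ℂ) * t g) - (m:ℂ) * u g) (by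
    intro g; simp [hf, ht, hu])
  have e : ip (fun g => (f g - (m:ℂ) * t g) - (m:ℂ) * u g) (fun g => (f g - (m:ℂ) * t g) - (m:ℂ) * u g)
      = 1 - 2 * (m:ℂ)^2 := by
    have L : ∀ h : G → ℂ, ip (fun g => (f g - (m:ℂ) * t g) - (m:ℂ) * u g) h = ip f h - m * ip t h - m * ip u h := by
      intro h
      rw [ip_sub_left (fun g => f g - (m:ℂ) * t g) (fun g => (m:ℂ) * u g), ip_sub_left f (fun g => (m:ℂ) * t g),
        ip_smul_left, ip_smul_left]
    rw [L, ip_comm f, ip_comm t, ip_comm u, L, L, L, ip_comm t f, ip_comm u f, ip_comm u t, h1, h2, h3, h4, h5, h6]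
    ring
  rw [e] at key
  have e2 : (1 - 2 * (m:ℂ)^2).re = 1 - 2 * (m:ℝ)^2 := by
    have : (1 - 2 * (m:ℂ)^2) = ((1 - 2 * (m:ℝ)^2 : ℝ) : ℂ) := by push_cast; ring
    rw [this, Complex.ofReal_re]
  rw [e2] at key
  have : (1:ℝ) ≤ m := by exact_mod_cast Nat.one_le_iff_ne_zero.mpr hm
  nlinarith

theorem ip_fin {U U' : Type} [AddCommGroup U] [Module ℂ U] [FiniteDimensional ℂ U]
    [AddCommGroup U'] [Module ℂ U'] [FiniteDimensional ℂ U'] (π : Representation ℂ G U)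
    (σ : Representation ℂ G U') : ip σ.character π.character = multHom π σ := by
  have : Invertible (Nat.card G : ℂ) := invertibleOfNonzero (by simp)
  unfold multHom
  rw [← Representation.card_inv_mul_sum_char_eq_finrank]
  simp only [ip, Representation.char_linHom, Nat.card_eq_fintype_card]
  congr 1
  exact sum_congr rfl fun g _ => mul_comm _ _

open scoped Classical in
theorem ip_orth {U U' : Type} [AddCommGroup U] [Module ℂ U] [FiniteDimensional ℂ U]
    [AddCommGroup U'] [Module ℂ U'] [FiniteDimensional ℂ U'] (π : Representation ℂ G U)
    (σ : Representation ℂ G U') (hπ : IsIrreducibleRep π) (hσ : IsIrreducibleRep σ) :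
    ip π.character σ.character = if RepIso σ π then 1 else 0 := by
  have : Invertible (Nat.card G : ℂ) := invertibleOfNonzero (by simp)
  have := toIrr hπ
  have := toIrr hσ
  have h := Representation.char_orthonormal π σ
  rw [Nat.card_eq_fintype_card] at h
  rw [ip, h]
  simp only [repIso_iff]

theorem reg_isCh {ι : Type} [Fintype ι]
    (W : ι → Type) [∀ i, AddCommGroup (W i)] [∀ i, Module ℂ (W i)]
    [∀ i, FiniteDimensional ℂ (W i)]
    (Irr : (i : ι) → Representation ℂ G (W i))
    (hcompl : ∀ (U : Type) [AddCommGroup U] [Module ℂ U] [FiniteDimensional ℂ U]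
      (σ : Representation ℂ G U), IsIrreducibleRep σ → ∃ i, RepIso σ (Irr i)) [DecidableEq G] :
    IsCh (fun i => (Irr i).character) (fun g => if g = 1 then (Fintype.card G : ℂ) else 0) := by
  let K : G →* Matrix G G ℂ :=
    { toFun := fun g => Matrix.of fun a b => if a = g * b then 1 else 0
      map_one' := by ext a b; simp [Matrix.one_apply]
      map_mul' := fun g h => by
        ext a b
        simp [Matrix.mul_apply, mul_assoc] }
  have := idem_isCh W Irr hcompl K 1 (by simp) (by simp)
  convert this using 2 with g
  rw [one_mul, Matrix.trace]
  simp only [K, MonoidHom.coe_mk, OneHom.coe_mk, Matrix.diag_apply, Matrix.of_apply]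
  by_cases hg : g = 1
  · simp [hg]
  · simp [hg]

variable {ι : Type} [Fintype ι]
namespace Hyp
variable [DecidableEq ι] {χ : ι → G → ℂ} {x : G → ℂ} {A : ι → ι → ℕ} {i0 : ι} {n : ℕ}

open scoped Classical in
theorem leafN' (H : Hyp χ x A i0 n) (i : ι) (hi : ∑ j, A i j = 1) :
    (Fintype.card G : ℂ)⁻¹ * (2 * (n:ℂ)^2 * ∑ g with x g = n, χ i g * χ i g⁻¹) = 1 := by
  have h1 := H.sq_ip i
  rw [hi] at h1
  have h2 := ip_coef χ H.orth (fun j => (A i j : ℂ)) _ (H.hx i) i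
  rw [H.hloop] at h2
  simp only [ip] at h2
  have hn0 : (n : ℂ) ≠ 0 := by
    have := H.hn
    exact_mod_cast (by omega : n ≠ 0)
  have e : 2 * (n:ℂ)^2 * ∑ g with x g = n, χ i g * χ i g⁻¹
      = ∑ g, (x g ^ 2) * (χ i g * χ i g⁻¹) + n * ∑ g, χ i g * x g * χ i g⁻¹ := by
    rw [sum_filter, mul_sum, mul_sum, ← sum_add_distrib]
    refine sum_congr rfl fun g _ => ?_
    rcases H.tri g with h | h | h
    · rw [if_neg (by rw [h]; exact hn0.symm), h]; ring
    · rw [if_pos h, h]; ring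
    · rw [if_neg, h]; · ring
      rw [h]
      intro h'
      apply hn0
      linear_combination (-1/2 : ℂ) * h'
  rw [e, mul_add, ← h1, mul_left_comm, h2]
  simp

open scoped Classical in
theorem leafN (H : Hyp χ x A i0 n) (i : ι) (hi : ∑ j, A i j = 1) :
    ∑ g with x g = n, χ i g * χ i g⁻¹ = ((univ.filter fun g => x g = n).card : ℂ) := by
  have h1 := H.leafN' i hi
  have h2 := H.leafN' i0 H.deg_i0
  simp only [H.h0, mul_one, sum_const, nsmul_eq_mul] at h2
  have hn0 : (n : ℂ) ≠ 0 := by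
    have := H.hn
    exact_mod_cast (by omega : n ≠ 0)
  have hG : (Fintype.card G : ℂ) ≠ 0 := by simp
  rw [← h2] at h1
  have h3 := mul_left_cancel₀ (inv_ne_zero hG) h1
  exact mul_left_cancel₀ (mul_ne_zero two_ne_zero (pow_ne_zero 2 hn0)) h3

theorem exists_leaf (H : Hyp χ x A i0 n) (i : ι) :
    ∃ j, ∑ k, A j k = 1 ∧ ∃ c : ℂ, ∀ g, x g = n → χ i g = c * χ j g := by
  rcases H.part2 i with h | h
  · exact ⟨i, h, 1, fun g _ => by simp⟩
  · obtain ⟨j, hj⟩ := H.exists_nbr i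
    have hd := H.deg_add i j hj
    have hj1 : ∑ k, A j k = 1 := by omega
    refine ⟨j, hj1, n, fun g hg => ?_⟩
    have h2 := H.hx j g
    rw [hg, sum_eq_single i] at h2
    · rw [mul_comm, h2]
      have : A j i = 1 := by
        rw [H.hsym]
        have := H.hle i j; omega
      simp [this]
    · intro k _ hk
      have : A j k = 0 := by
        have h3 := add_le_sum (f := fun k => A j k) (fun j _ => Nat.zero_le _) (mem_univ k) (mem_univ i) hk
        have : A j i ≠ 0 := by rwa [H.hsym]
        omega
      simp [this]
    · simp
end Hyp

theorem ker_iff {V : Type} [AddCommGroup V] [Module ℂ V] [FiniteDimensional ℂ V]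
    (ρ : Representation ℂ G V) (g : G) :
    ρ.character g = Module.finrank ℂ V ↔ g ∈ MonoidHom.ker ρ := by
  rw [MonoidHom.mem_ker]
  constructor
  · intro h
    obtain ⟨ζ, h1, h2, h3⟩ := char_eigen ρ g
    apply h3
    have h4 := h2 1
    simp only [pow_one, h] at h4
    have hnorm : ∀ i, ‖ζ i‖ = 1 := fun i =>
      Complex.norm_eq_one_of_pow_eq_one (h1 i) Fintype.card_ne_zero
    have hre : ∑ i, (1 - (ζ i).re) = 0 := by
      have h5 := congrArg Complex.re h4
      rw [Complex.re_sum] at h5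
      simp only [Complex.natCast_re] at h5
      rw [sum_sub_distrib, ← h5]
      simp
    have hnn : ∀ i ∈ (univ : Finset (Fin (Module.finrank ℂ V))), 0 ≤ 1 - (ζ i).re := by
      intro i _
      have := Complex.re_le_norm (ζ i)
      rw [hnorm] at this
      linarith
    have h6 := (sum_eq_zero_iff_of_nonneg hnn).mp hre
    intro i
    have h7 : (ζ i).re = 1 := by have := h6 i (mem_univ i); linarith
    have h8 := Complex.sq_norm (ζ i)
    rw [hnorm, Complex.normSq_apply, h7] at h8
    have h9 : (ζ i).im = 0 := by nlinarith
    exact Complex.ext (by simp [h7]) (by simp [h9])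
  · intro h
    simp [Representation.character, h]
end
end McKayAux

namespace McKayAux
open Finset

theorem mkHyp
    {G : Type} [Group G] [Fintype G]
    {V : Type} [AddCommGroup V] [Module ℂ V] [FiniteDimensional ℂ V]
    (ρ : Representation ℂ G V)
    (hdim : 3 ≤ Module.finrank ℂ V)
    {ι : Type} [Fintype ι] [DecidableEq ι]
    (W : ι → Type) [∀ i, AddCommGroup (W i)] [∀ i, Module ℂ (W i)]
    [∀ i, FiniteDimensional ℂ (W i)]
    (Irr : (i : ι) → Representation ℂ G (W i))
    (hirr : ∀ i, IsIrreducibleRep (Irr i))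
    (hdist : ∀ i j, RepIso (Irr i) (Irr j) → i = j)
    (hcompl : ∀ (U : Type) [AddCommGroup U] [Module ℂ U] [FiniteDimensional ℂ U]
      (σ : Representation ℂ G U), IsIrreducibleRep σ → ∃ i, RepIso σ (Irr i))
    (hsym : ∀ i j, multHom ((Irr i).tprod ρ) (Irr j) = multHom ((Irr j).tprod ρ) (Irr i))
    (hle : ∀ i j, multHom ((Irr i).tprod ρ) (Irr j) ≤ 1)
    (hloop : ∀ i, multHom ((Irr i).tprod ρ) (Irr i) = 0)
    (hforest :
      (SimpleGraph.fromRel fun i j => multHom ((Irr i).tprod ρ) (Irr j) = 1).IsAcyclic) :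
    ∃ i0, Hyp (fun i => (Irr i).character) ρ.character
      (fun i j => multHom ((Irr i).tprod ρ) (Irr j)) i0 (Module.finrank ℂ V) := by
  classical
  obtain ⟨i0, h0⟩ := hcompl ℂ (Representation.trivial ℂ G ℂ) ⟨inferInstance, by
    intro p _
    exact eq_bot_or_eq_top p⟩
  have orth : ∀ i j, ip (Irr i).character (Irr j).character = if i = j then 1 else 0 := by
    intro i j
    rw [ip_orth _ _ (hirr i) (hirr j)]
    congr 1
    apply propext
    constructor
    · intro h; exact (hdist _ _ h).symm
    · rintro rfl; exact ⟨LinearEquiv.refl _ _, fun _ _ => rfl⟩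
  let b := Module.finBasis ℂ V
  let K : G →* Matrix (Fin (Module.finrank ℂ V)) (Fin (Module.finrank ℂ V)) ℂ :=
    (LinearMap.toMatrixAlgEquiv b).toMonoidHom.comp ρ
  have hK : ∀ g, (K g).trace = ρ.character g := by
    intro g
    exact (LinearMap.trace_eq_matrix_trace ℂ b (ρ g)).symm
  refine ⟨i0, ?_⟩
  refine { orth := orth, hx := ?_, hsym := hsym, hle := hle, hloop := hloop, hforest := hforest,
           h0 := ?_, hnorm := ?_, hdual := ?_, hS := ?_, hS3 := ?_, hQ := ?_, heig := ?_, hconj := ?_,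
           hn := hdim, hx1 := ?_, hχ1 := ?_ }
  · intro i g
    obtain ⟨m, hm⟩ := rep_isCh W Irr hcompl _ _ ((Irr i).tprod ρ) rfl
    have h1 := hm g
    rw [Representation.char_tensor] at h1
    rw [Pi.mul_apply] at h1
    rw [h1]
    refine sum_congr rfl fun j _ => ?_
    have h2 := ip_coef (fun i => (Irr i).character) orth (fun j => (m j : ℂ)) _ hm j
    rw [ip_comm, ip_fin] at h2
    rw [h2]
  · intro g
    obtain ⟨e⟩ := (repIso_iff _ _).mp h0
    rw [← Representation.char_iso e]
    simp [Representation.character]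
  · intro i
    obtain ⟨m, hm⟩ := rep_isCh W Irr hcompl _ _ ((Irr i).linHom (Irr i)) rfl
    refine ⟨m, fun g => ?_⟩
    rw [← hm, Representation.char_linHom, mul_comm]
  · obtain ⟨m, hm⟩ := rep_isCh W Irr hcompl _ _ ρ.dual rfl
    refine ⟨m, fun g => ?_⟩
    rw [← hm, Representation.char_dual]
  · intro ε hε
    have := isCh2 W Irr hcompl K ε hε
    simpa only [hK] using this
  · intro ε hε
    have := isCh3 W Irr hcompl K ε hε
    simpa only [hK] using this
  · have := isChQ W Irr hcompl K
    simpa only [hK] using this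
  · intro g
    obtain ⟨ζ, h1, h2, -⟩ := char_eigen ρ g
    exact ⟨ζ, h1, h2⟩
  · exact char_inv ρ
  · simp
  · intro i
    have := (hirr i).1
    simp only [Representation.char_one]
    exact_mod_cast Module.finrank_pos.ne'

theorem part1
    {G : Type} [Group G] [Fintype G]
    {V : Type} [AddCommGroup V] [Module ℂ V] [FiniteDimensional ℂ V]
    (ρ : Representation ℂ G V)
    {ι : Type} [Fintype ι] [DecidableEq ι]
    (W : ι → Type) [∀ i, AddCommGroup (W i)] [∀ i, Module ℂ (W i)]
    [∀ i, FiniteDimensional ℂ (W i)]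
    (Irr : (i : ι) → Representation ℂ G (W i))
    (hcompl : ∀ (U : Type) [AddCommGroup U] [Module ℂ U] [FiniteDimensional ℂ U]
      (σ : Representation ℂ G U), IsIrreducibleRep σ → ∃ i, RepIso σ (Irr i))
    (i0 : ι) (H : Hyp (fun i => (Irr i).character) ρ.character
      (fun i j => multHom ((Irr i).tprod ρ) (Irr j)) i0 (Module.finrank ℂ V))
    (U : Type) [AddCommGroup U] [Module ℂ U] [FiniteDimensional ℂ U]
      (τ : Representation ℂ (MonoidHom.ker ρ) U) (hτ : IsIrreducibleRep τ) (g : G) :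
        RepIso (τ.comp (MulAut.conjNormal g⁻¹).toMonoidHom) τ := by
  classical
  by_contra hno
  have hUn := hτ.1
  have hN : (Fintype.card (MonoidHom.ker ρ) : ℂ) ≠ 0 := Nat.cast_ne_zero.mpr Fintype.card_ne_zero
  -- a constituent
  have h1 : ∃ i, ip (fun h : MonoidHom.ker ρ => (Irr i).character (h : G)) τ.character ≠ 0 := by
    by_contra hall
    push Not at hall
    obtain ⟨m, hm⟩ := reg_isCh W Irr hcompl
    have h2 : ∑ h : MonoidHom.ker ρ, (if (h : G) = 1 then (Fintype.card G : ℂ) else 0) * τ.character h⁻¹ = 0 := by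
      simp only [hm, sum_mul]
      rw [sum_comm]
      refine sum_eq_zero fun i _ => ?_
      simp only [mul_assoc]
      rw [← mul_sum]
      have := hall i
      rw [ip, mul_eq_zero] at this
      rcases this with h | h
      · exact absurd h (inv_ne_zero hN)
      · rw [h, mul_zero]
    rw [sum_eq_single 1] at h2
    · simp only [OneMemClass.coe_one, if_true, inv_one, Representation.char_one, mul_eq_zero, Nat.cast_eq_zero] at h2
      rcases h2 with h | h
      · exact Fintype.card_ne_zero h
      · exact Module.finrank_pos.ne' h
    · intro b _ hb
      rw [if_neg, zero_mul]
      simpa using hb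
    · simp
  obtain ⟨i, hi⟩ := h1
  obtain ⟨j, hj, c, hc⟩ := H.exists_leaf i
  let π : Representation ℂ (MonoidHom.ker ρ) (W j) := (Irr j).comp (MonoidHom.ker ρ).subtype
  have hπ : ∀ h, π.character h = (Irr j).character (h : G) := fun h => rfl
  let τ' : Representation ℂ (MonoidHom.ker ρ) U := τ.comp (MulAut.conjNormal g⁻¹).toMonoidHom
  have hτ'c : ∀ h, τ'.character h = τ.character (MulAut.conjNormal g⁻¹ h) := fun h => rfl
  have hτ' : IsIrreducibleRep τ' := by
    refine ⟨hUn, fun p hp => hτ.2 p fun h v hv => ?_⟩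
    have := hp ((MulAut.conjNormal g⁻¹).symm h) v hv
    have e : τ' ((MulAut.conjNormal g⁻¹).symm h) = τ h := by
      show τ (MulAut.conjNormal g⁻¹ ((MulAut.conjNormal g⁻¹).symm h)) = _
      rw [MulEquiv.apply_symm_apply]
    rwa [e] at this
  have hm : ip π.character τ.character = multHom τ π := ip_fin τ π
  have hm0 : multHom τ π ≠ 0 := by
    intro h0
    rw [h0] at hm
    apply hi
    have : (fun h : MonoidHom.ker ρ => (Irr i).character (h : G)) = fun h => c * π.character h := by
      funext h
      exact hc h ((ker_iff ρ h).mpr h.2)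
    rw [this, ip_smul_left, hm]
    simp
  have hm' : ip π.character τ'.character = multHom τ π := by
    rw [← hm]
    unfold ip
    congr 1
    rw [← Equiv.sum_comp (MulAut.conjNormal g⁻¹ : MulAut (MonoidHom.ker ρ)).toEquiv
      (fun h => π.character h * τ.character h⁻¹)]
    refine sum_congr rfl fun h _ => ?_
    rw [hτ'c, map_inv]
    congr 1
    rw [hπ, hπ]
    show _ = (Irr j).character ((MulAut.conjNormal g⁻¹ h : MonoidHom.ker ρ) : G)
    rw [MulAut.conjNormal_apply, Representation.char_conj]
  refine bessel π.character τ.character τ'.character (char_inv π) (char_inv τ) (char_inv τ') _ hm0 ?_ ?_ ?_ hm hm' ?_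
  · have h2 := H.leafN j hj
    have hs : ∀ f : G → ℂ, ∑ g with ρ.character g = Module.finrank ℂ V, f g = ∑ h : MonoidHom.ker ρ, f h := by
      intro f
      rw [← Finset.sum_subtype (univ.filter fun g => ρ.character g = Module.finrank ℂ V)
        (p := fun g => g ∈ MonoidHom.ker ρ) (f := f)]
      intro g
      simp [ker_iff ρ g]
    have h3 : ((univ.filter fun g => ρ.character g = Module.finrank ℂ V).card : ℂ) = Fintype.card (MonoidHom.ker ρ) := by
      have := hs (fun _ => 1)
      simpa using this
    rw [hs, h3] at h2
    unfold ip
    rw [inv_mul_eq_one₀ hN, ← h2]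
    rfl
  · rw [ip_orth _ _ hτ hτ, if_pos]
    exact ⟨LinearEquiv.refl _ _, fun _ _ => rfl⟩
  · rw [ip_orth _ _ hτ' hτ', if_pos]
    exact ⟨LinearEquiv.refl _ _, fun _ _ => rfl⟩
  · rw [ip_orth _ _ hτ hτ', if_neg hno]

end McKayAux

/-- If the McKay graph `Γ(G,ρ)` is a forest and `dim ρ ≥ 3`, then with
`N = ker ρ`: (1) every irreducible representation of `N` is isomorphic to all its
`G`-conjugates, and (2) every vertex of the graph has degree `1` or `(dim ρ)²`. -/
theorem mckay_forest_big_dim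
    {G : Type} [Group G] [Fintype G]
    {V : Type} [AddCommGroup V] [Module ℂ V] [FiniteDimensional ℂ V]
    (ρ : Representation ℂ G V) (hV : Module.finrank ℂ V ≠ 0)
    (hdim : 3 ≤ Module.finrank ℂ V)
    {ι : Type} [Fintype ι]
    (W : ι → Type) [∀ i, AddCommGroup (W i)] [∀ i, Module ℂ (W i)]
    [∀ i, FiniteDimensional ℂ (W i)]
    (Irr : (i : ι) → Representation ℂ G (W i))
    (hirr : ∀ i, IsIrreducibleRep (Irr i))
    (hdist : ∀ i j, RepIso (Irr i) (Irr j) → i = j)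
    (hcompl : ∀ (U : Type) [AddCommGroup U] [Module ℂ U] [FiniteDimensional ℂ U]
      (σ : Representation ℂ G U), IsIrreducibleRep σ → ∃ i, RepIso σ (Irr i))
    (hsym : ∀ i j, multHom ((Irr i).tprod ρ) (Irr j) = multHom ((Irr j).tprod ρ) (Irr i))
    (hle : ∀ i j, multHom ((Irr i).tprod ρ) (Irr j) ≤ 1)
    (hloop : ∀ i, multHom ((Irr i).tprod ρ) (Irr i) = 0)
    (hforest :
      (SimpleGraph.fromRel fun i j => multHom ((Irr i).tprod ρ) (Irr j) = 1).IsAcyclic) :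
    (∀ (U : Type) [AddCommGroup U] [Module ℂ U] [FiniteDimensional ℂ U]
      (τ : Representation ℂ (MonoidHom.ker ρ) U), IsIrreducibleRep τ → ∀ g : G,
        RepIso (τ.comp (MulAut.conjNormal g⁻¹).toMonoidHom) τ) ∧
    (∀ i : ι, (∑ j, multHom ((Irr i).tprod ρ) (Irr j)) = 1 ∨
      (∑ j, multHom ((Irr i).tprod ρ) (Irr j)) = Module.finrank ℂ V ^ 2) := by
  classical
  obtain ⟨i0, H⟩ := McKayAux.mkHyp ρ hdim W Irr hirr hdist hcompl hsym hle hloop hforest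
  refine ⟨?_, fun i => H.part2 i⟩
  intro U _ _ _ τ hτ g
  exact McKayAux.part1 ρ W Irr hcompl i0 H U τ hτ g
end

section
/- Let G be a finite group and ρ an irreducible faithful finite-dimensional complex representation of G. Then the following are equivalent: (a) the McKay graph Γ(G,ρ) is bipartite, i.e. there exists a function ε : Irr(G) → ℤ/2ℤ such that for all μ, λ ∈ Irr(G), [μ⊗ρ:λ] ≠ 0 implies ε(λ) ≠ ε(μ); (b) there exists z in the center Z(G) with z ≠ 1 and z² = 1 (a central element of order 2, which then necessarily acts on ρ as −Id). -/
open scoped TensorProduct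

namespace McK

/-- Equivariance. -/
def Eqv {G U X : Type} [Group G] [AddCommGroup U] [Module ℂ U] [AddCommGroup X] [Module ℂ X]
    (σ : Representation ℂ G U) (τ : Representation ℂ G X) (f : U →ₗ[ℂ] X) : Prop :=
  ∀ g u, f (σ g u) = τ g (f u)

/-- Invariance. -/
def Inv {G U : Type} [Group G] [AddCommGroup U] [Module ℂ U]
    (σ : Representation ℂ G U) (p : Submodule ℂ U) : Prop :=
  ∀ g : G, ∀ v ∈ p, σ g v ∈ p

/-- Restriction to an invariant submodule. -/
def sub {G U : Type} [Group G] [AddCommGroup U] [Module ℂ U]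
    (σ : Representation ℂ G U) (p : Submodule ℂ U) (h : Inv σ p) : Representation ℂ G p where
  toFun g := (σ g).restrict (h g)
  map_one' := by ext x; simp
  map_mul' a b := by ext x; simp

section
variable {G U X Y : Type} [Group G] [AddCommGroup U] [Module ℂ U] [AddCommGroup X] [Module ℂ X]
  [AddCommGroup Y] [Module ℂ Y]

lemma Eqv.comp {σ : Representation ℂ G U} {τ : Representation ℂ G X} {κ : Representation ℂ G Y}
    {f : U →ₗ[ℂ] X} {g : X →ₗ[ℂ] Y} (hg : Eqv τ κ g) (hf : Eqv σ τ f) : Eqv σ κ (g ∘ₗ f) := by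
  intro a u
  simp [hf a u, hg a (f u)]

lemma Eqv.inv_ker {σ : Representation ℂ G U} {τ : Representation ℂ G X}
    {f : U →ₗ[ℂ] X} (hf : Eqv σ τ f) : Inv σ (LinearMap.ker f) := by
  intro g v hv
  rw [LinearMap.mem_ker] at *
  rw [hf, hv, map_zero]

lemma Eqv.inv_range {σ : Representation ℂ G U} {τ : Representation ℂ G X}
    {f : U →ₗ[ℂ] X} (hf : Eqv σ τ f) : Inv τ (LinearMap.range f) := by
  rintro g _ ⟨u, rfl⟩
  exact ⟨σ g u, hf g u⟩

lemma inv_inf {σ : Representation ℂ G U} {p q : Submodule ℂ U} (hp : Inv σ p) (hq : Inv σ q) :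
    Inv σ (p ⊓ q) := fun g v hv => ⟨hp g v hv.1, hq g v hv.2⟩

/-- Maschke. -/
lemma maschke [Fintype G] {σ : Representation ℂ G X} {τ : Representation ℂ G U}
    {f : X →ₗ[ℂ] U} (hf : Eqv σ τ f) (hinj : Function.Injective f) :
    ∃ r : U →ₗ[ℂ] X, Eqv τ σ r ∧ ∀ x, r (f x) = x := by
  obtain ⟨q, hq⟩ := f.exists_leftInverse_of_injective (LinearMap.ker_eq_bot.2 hinj)
  have hq' : ∀ x, q (f x) = x := fun x => LinearMap.congr_fun hq x
  have hr : ∀ u, ((Fintype.card G : ℂ)⁻¹ • ∑ g : G, (σ g⁻¹) ∘ₗ q ∘ₗ (τ g)) u =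
      (Fintype.card G : ℂ)⁻¹ • ∑ g : G, σ g⁻¹ (q (τ g u)) := by
    intro u; simp
  refine ⟨(Fintype.card G : ℂ)⁻¹ • ∑ g : G, (σ g⁻¹) ∘ₗ q ∘ₗ (τ g), ?_, ?_⟩
  · intro a u
    rw [hr, hr, map_smul, map_sum]
    congr 1
    refine Fintype.sum_equiv (Equiv.mulRight a) _ _ ?_
    intro g
    simp only [Equiv.coe_mulRight, mul_inv_rev, map_mul, Module.End.mul_apply]
    rw [← Module.End.mul_apply (σ a), ← map_mul]
    simp
  · intro x
    rw [hr]
    have : ∀ g : G, σ g⁻¹ (q (τ g (f x))) = x := by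
      intro g
      rw [← hf, hq', ← Module.End.mul_apply, ← map_mul]
      simp
    simp only [this]
    simp only [Finset.sum_const, Finset.card_univ]
    rw [← Nat.cast_smul_eq_nsmul ℂ, smul_smul, inv_mul_cancel₀, one_smul]
    exact_mod_cast Fintype.card_ne_zero

lemma schur {σ : Representation ℂ G U} {τ : Representation ℂ G X}
    (hσ : IsIrreducibleRep σ) (f : U →ₗ[ℂ] X) (hf : Eqv σ τ f) (h0 : f ≠ 0) :
    Function.Injective f := by
  rcases hσ.2 _ hf.inv_ker with h | h
  · exact LinearMap.ker_eq_bot.1 h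
  · exact absurd (LinearMap.ker_eq_top.1 h) h0

lemma schur_iso {σ : Representation ℂ G U} {τ : Representation ℂ G X}
    (hσ : IsIrreducibleRep σ) (hτ : IsIrreducibleRep τ)
    (f : U →ₗ[ℂ] X) (hf : Eqv σ τ f) (h0 : f ≠ 0) : RepIso σ τ := by
  have hi := schur hσ f hf h0
  have hs : Function.Surjective f := by
    rcases hτ.2 _ hf.inv_range with h | h
    · exact absurd (LinearMap.range_eq_bot.1 h) h0
    · exact LinearMap.range_eq_top.1 h
  exact ⟨LinearEquiv.ofBijective f ⟨hi, hs⟩, fun g v => hf g v⟩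

lemma exists_irr [FiniteDimensional ℂ U] (σ : Representation ℂ G U) :
    ∀ (n : ℕ) (p : Submodule ℂ U), Module.finrank ℂ p = n → Inv σ p → p ≠ ⊥ →
      ∃ (q : Submodule ℂ U) (hq : Inv σ q), q ≤ p ∧ IsIrreducibleRep (sub σ q hq) := by
  intro n
  induction n using Nat.strong_induction_on with
  | _ n ih =>
    intro p hn hp hne
    by_cases hirr : IsIrreducibleRep (sub σ p hp)
    · exact ⟨p, hp, le_rfl, hirr⟩
    · have hnt : Nontrivial p := Submodule.nontrivial_iff_ne_bot.2 hne
      unfold IsIrreducibleRep at hirr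
      push Not at hirr
      obtain ⟨s, hs, hsb, hst⟩ := hirr hnt
      have hle : s.map p.subtype ≤ p := Submodule.map_subtype_le p s
      have hinv : Inv σ (s.map p.subtype) := by
        rintro g _ ⟨v, hv, rfl⟩
        exact ⟨sub σ p hp g v, hs g v hv, rfl⟩
      have hlt : s.map p.subtype < p := by
        refine lt_of_le_of_ne hle fun h => hst ?_
        rw [Submodule.eq_top_iff']
        intro x
        have : (x : U) ∈ s.map p.subtype := by rw [h]; exact x.2
        obtain ⟨y, hy, hyx⟩ := this
        have : y = x := Subtype.ext hyx
        exact this ▸ hy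
      have hb : s.map p.subtype ≠ ⊥ := by
        intro h
        refine hsb ((Submodule.eq_bot_iff _).2 fun x hx => ?_)
        have hx' : (x : U) ∈ s.map p.subtype := ⟨x, hx, rfl⟩
        rw [h, Submodule.mem_bot] at hx'
        exact Subtype.ext hx'
      obtain ⟨q, hq, hqp, hi⟩ := ih _ (hn ▸ Submodule.finrank_lt_finrank_of_lt hlt) _ rfl hinv hb
      exact ⟨q, hq, hqp.trans hle, hi⟩

end

section
variable {G : Type} [Group G] [Fintype G]
    {ι : Type}
    {W : ι → Type} [∀ i, AddCommGroup (W i)] [∀ i, Module ℂ (W i)]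
    {Irr : (i : ι) → Representation ℂ G (W i)}
    {U : Type} [AddCommGroup U] [Module ℂ U] [FiniteDimensional ℂ U]

lemma exists_map (hirr : ∀ i, IsIrreducibleRep (Irr i))
    (hcompl : ∀ (U : Type) [AddCommGroup U] [Module ℂ U] [FiniteDimensional ℂ U]
      (σ : Representation ℂ G U), IsIrreducibleRep σ → ∃ i, RepIso σ (Irr i))
    (σ : Representation ℂ G U) (p : Submodule ℂ U) (hp : Inv σ p) (hne : p ≠ ⊥) :
    ∃ (i : ι) (f : W i →ₗ[ℂ] U), Eqv (Irr i) σ f ∧ LinearMap.range f ≤ p ∧ f ≠ 0 := by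
  obtain ⟨q, hq, hqp, hi⟩ := exists_irr σ _ p rfl hp hne
  obtain ⟨i, e, he⟩ := hcompl q (sub σ q hq) hi
  refine ⟨i, q.subtype ∘ₗ e.symm.toLinearMap, ?_, ?_, ?_⟩
  · intro g w
    have : e.symm (Irr i g w) = sub σ q hq g (e.symm w) := by
      rw [LinearEquiv.symm_apply_eq, he, LinearEquiv.apply_symm_apply]
    simp only [LinearMap.comp_apply, LinearEquiv.coe_coe, this]
    rfl
  · rintro _ ⟨w, rfl⟩
    exact hqp (e.symm w).2
  · intro h
    have hnt := (hirr i).1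
    obtain ⟨w, hw⟩ := exists_ne (0 : W i)
    have := LinearMap.congr_fun h w
    simp at this
    exact hw this

lemma le_of_maps (hirr : ∀ i, IsIrreducibleRep (Irr i))
    (hcompl : ∀ (U : Type) [AddCommGroup U] [Module ℂ U] [FiniteDimensional ℂ U]
      (σ : Representation ℂ G U), IsIrreducibleRep σ → ∃ i, RepIso σ (Irr i))
    (σ : Representation ℂ G U) (p q : Submodule ℂ U) (hp : Inv σ p) (hq : Inv σ q)
    (h : ∀ (i : ι) (f : W i →ₗ[ℂ] U), Eqv (Irr i) σ f → f ≠ 0 → LinearMap.range f ≤ p →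
      LinearMap.range f ≤ q) : p ≤ q := by
  have hpq := inv_inf hp hq
  have hsub : Eqv (sub σ _ hpq) σ (p ⊓ q).subtype := fun g x => rfl
  obtain ⟨r, hr, hrx⟩ := maschke hsub (p ⊓ q).subtype_injective
  have hker : p ⊓ LinearMap.ker r = ⊥ := by
    by_contra hne
    obtain ⟨i, f, hf, hfr, hf0⟩ := exists_map hirr hcompl σ _ (inv_inf hp hr.inv_ker) hne
    apply hf0
    have hfp := hfr.trans inf_le_left
    have hfq := h i f hf hf0 hfp
    ext w
    have h1 : r (f w) = 0 := (hfr ⟨w, rfl⟩).2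
    have h2 := hrx ⟨f w, hfp ⟨w, rfl⟩, hfq ⟨w, rfl⟩⟩
    rw [Submodule.subtype_apply, h1] at h2
    exact (congrArg Subtype.val h2).symm
  intro x hx
  have : x - (r x : U) ∈ p ⊓ LinearMap.ker r := by
    refine ⟨p.sub_mem hx (r x).2.1, ?_⟩
    have := hrx (r x)
    rw [Submodule.subtype_apply] at this
    change r (x - (r x : U)) = 0
    rw [map_sub, this, sub_self]
  rw [hker, Submodule.mem_bot, sub_eq_zero] at this
  rw [this]
  exact (r x).2.2

/-- The part of parity `e`. -/
def part (Irr : (i : ι) → Representation ℂ G (W i)) (σ : Representation ℂ G U)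
    (ε : ι → ZMod 2) (e : ZMod 2) : Submodule ℂ U :=
  Submodule.span ℂ {u | ∃ (i : ι) (f : W i →ₗ[ℂ] U), ε i = e ∧ Eqv (Irr i) σ f ∧
    u ∈ LinearMap.range f}

lemma range_le_part {σ : Representation ℂ G U} {ε : ι → ZMod 2} {i : ι} {f : W i →ₗ[ℂ] U}
    (hf : Eqv (Irr i) σ f) {e : ZMod 2} (he : ε i = e) :
    LinearMap.range f ≤ part Irr σ ε e :=
  fun _ hx => Submodule.subset_span ⟨i, f, he, hf, hx⟩

lemma part_inv (σ : Representation ℂ G U) (ε : ι → ZMod 2) (e : ZMod 2) :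
    Inv σ (part Irr σ ε e) := by
  intro g
  change part Irr σ ε e ≤ (part Irr σ ε e).comap (σ g)
  refine Submodule.span_le.2 ?_
  rintro u ⟨i, f, he, hf, hu⟩
  exact range_le_part hf he (hf.inv_range g u hu)

lemma parity (hirr : ∀ i, IsIrreducibleRep (Irr i))
    (hdist : ∀ i j, RepIso (Irr i) (Irr j) → i = j)
    {σ : Representation ℂ G U} {ε : ι → ZMod 2} {e : ZMod 2} {k : ι} {f : W k →ₗ[ℂ] U}
    (hf : Eqv (Irr k) σ f) (h0 : f ≠ 0) (hle : LinearMap.range f ≤ part Irr σ ε e) :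
    ε k = e := by
  obtain ⟨r, hr, hrf⟩ := maschke hf (schur (hirr k) f hf h0)
  by_contra hk
  have hz : part Irr σ ε e ≤ LinearMap.ker r := by
    refine Submodule.span_le.2 ?_
    rintro _ ⟨i, φ, he, hφ, w, rfl⟩
    by_contra hne
    have : r ∘ₗ φ ≠ 0 := fun h => hne (LinearMap.congr_fun h w)
    have := hdist _ _ (schur_iso (hirr i) (hirr k) _ (hr.comp hφ) this)
    exact hk (this ▸ he)
  apply h0
  ext w
  have h1 : r (f w) = 0 := hz (hle ⟨w, rfl⟩)
  rw [hrf] at h1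
  rw [h1]; simp

lemma part_disjoint (hirr : ∀ i, IsIrreducibleRep (Irr i))
    (hdist : ∀ i j, RepIso (Irr i) (Irr j) → i = j)
    (hcompl : ∀ (U : Type) [AddCommGroup U] [Module ℂ U] [FiniteDimensional ℂ U]
      (σ : Representation ℂ G U), IsIrreducibleRep σ → ∃ i, RepIso σ (Irr i))
    (σ : Representation ℂ G U) (ε : ι → ZMod 2) :
    part Irr σ ε 0 ⊓ part Irr σ ε 1 = ⊥ := by
  by_contra hne
  obtain ⟨i, f, hf, hfr, hf0⟩ := exists_map hirr hcompl σ _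
    (inv_inf (part_inv σ ε 0) (part_inv σ ε 1)) hne
  have h1 := parity hirr hdist hf hf0 (hfr.trans inf_le_left)
  have h2 := parity hirr hdist hf hf0 (hfr.trans inf_le_right)
  rw [h1] at h2
  exact absurd h2 (by decide)

lemma zmod2 (x : ZMod 2) : x = 0 ∨ x = 1 := by
  revert x; decide

lemma part_top (hirr : ∀ i, IsIrreducibleRep (Irr i))
    (hcompl : ∀ (U : Type) [AddCommGroup U] [Module ℂ U] [FiniteDimensional ℂ U]
      (σ : Representation ℂ G U), IsIrreducibleRep σ → ∃ i, RepIso σ (Irr i))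
    (σ : Representation ℂ G U) (ε : ι → ZMod 2) :
    part Irr σ ε 0 ⊔ part Irr σ ε 1 = ⊤ := by
  rw [eq_top_iff]
  refine le_of_maps hirr hcompl σ _ _ (fun _ _ _ => trivial) ?_ ?_
  · intro g v hv
    obtain ⟨a, ha, b, hb, rfl⟩ := Submodule.mem_sup.1 hv
    rw [map_add]
    exact Submodule.add_mem_sup (part_inv σ ε 0 g a ha) (part_inv σ ε 1 g b hb)
  · intro i f hf _ _
    rcases zmod2 (ε i) with h | h
    · exact (range_le_part hf h).trans le_sup_left
    · exact (range_le_part hf h).trans le_sup_right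

/-- Right regular representation on functions. -/
def reg (G : Type) [Group G] : Representation ℂ G (G → ℂ) where
  toFun g := LinearMap.funLeft ℂ ℂ (fun x => x * g)
  map_one' := by ext; simp [LinearMap.funLeft]
  map_mul' a b := by
    apply LinearMap.ext; intro f; funext x
    simp [LinearMap.funLeft_apply, mul_assoc]

lemma reg_apply (g x : G) (f : G → ℂ) : reg G g f x = f (x * g) := rfl

/-- Matrix coefficients. -/
def mc {V : Type} [AddCommGroup V] [Module ℂ V] (ρ : Representation ℂ G V) (l : Module.Dual ℂ V) :
    V →ₗ[ℂ] (G → ℂ) :=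
  LinearMap.pi fun x => l ∘ₗ ρ x

lemma mult_ne {X Y : Type} [AddCommGroup X] [Module ℂ X] [FiniteDimensional ℂ X]
    [AddCommGroup Y] [Module ℂ Y] [FiniteDimensional ℂ Y]
    (π : Representation ℂ G X) (τ : Representation ℂ G Y) :
    multHom π τ ≠ 0 ↔ ∃ f : X →ₗ[ℂ] Y, Eqv π τ f ∧ f ≠ 0 := by
  have key : ∀ f : X →ₗ[ℂ] Y, f ∈ (Representation.linHom π τ).invariants ↔ Eqv π τ f := by
    intro f
    rw [Representation.mem_invariants]
    constructor
    · intro h g u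
      have := LinearMap.congr_fun (h g) (π g u)
      rw [Representation.linHom_apply] at this
      simp only [LinearMap.comp_apply] at this
      rw [← Module.End.mul_apply (π g⁻¹), ← map_mul] at this
      simpa using this.symm
    · intro h g
      rw [Representation.linHom_apply]
      ext u
      simp only [LinearMap.comp_apply]
      rw [← h, ← Module.End.mul_apply (π g), ← map_mul]
      simp
  unfold multHom
  rw [← Nat.pos_iff_ne_zero, Module.finrank_pos_iff, Submodule.nontrivial_iff_ne_bot,
    Submodule.ne_bot_iff]
  exact ⟨fun ⟨f, hf, h0⟩ => ⟨f, (key f).1 hf, h0⟩, fun ⟨f, hf, h0⟩ => ⟨f, (key f).2 hf, h0⟩⟩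

lemma part_mul [∀ i, FiniteDimensional ℂ (W i)]
    {V : Type} [AddCommGroup V] [Module ℂ V] [FiniteDimensional ℂ V]
    (ρ : Representation ℂ G V)
    (hirr : ∀ i, IsIrreducibleRep (Irr i))
    (hcompl : ∀ (U : Type) [AddCommGroup U] [Module ℂ U] [FiniteDimensional ℂ U]
      (σ : Representation ℂ G U), IsIrreducibleRep σ → ∃ i, RepIso σ (Irr i))
    (ε : ι → ZMod 2) (hε : ∀ i j, multHom ((Irr i).tprod ρ) (Irr j) ≠ 0 → ε j ≠ ε i)
    (l : Module.Dual ℂ V) (v : V) (e e' : ZMod 2) (hee : ∀ x : ZMod 2, x ≠ e → x = e')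
    (a : G → ℂ) (ha : a ∈ part Irr (reg G) ε e) : a * mc ρ l v ∈ part Irr (reg G) ε e' := by
  suffices h : part Irr (reg G) ε e ≤
      (part Irr (reg G) ε e').comap (LinearMap.mulRight ℂ (mc ρ l v)) from h ha
  refine Submodule.span_le.2 ?_
  rintro _ ⟨i, f, he, hf, w, rfl⟩
  let F : W i ⊗[ℂ] V →ₗ[ℂ] (G → ℂ) :=
    TensorProduct.lift ((LinearMap.mul ℂ (G → ℂ)).compl₁₂ f (mc ρ l))
  have hFt : ∀ w v, F (w ⊗ₜ v) = f w * mc ρ l v := fun w v => rfl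
  have hmc : Eqv ρ (reg G) (mc ρ l) := by
    intro g v
    funext x
    rw [reg_apply]
    simp [mc]
  have hF : Eqv ((Irr i).tprod ρ) (reg G) F := by
    intro g u
    induction u using TensorProduct.induction_on with
    | zero => simp
    | add x y hx hy => simp only [map_add, hx, hy]
    | tmul w v =>
      rw [Representation.tprod_apply, TensorProduct.map_tmul, hFt, hFt, hf, hmc]
      rfl
  have hr : LinearMap.range F ≤ part Irr (reg G) ε e' := by
    refine le_of_maps hirr hcompl (reg G) _ _ hF.inv_range (part_inv _ _ _) ?_
    intro j φ hφ h0 hle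
    refine range_le_part hφ (hee _ ?_)
    rw [← he]
    apply hε
    rw [mult_ne]
    obtain ⟨r, hr, hrf⟩ := maschke hφ (schur (hirr j) φ hφ h0)
    refine ⟨r ∘ₗ F, hr.comp hF, fun hz => h0 ?_⟩
    ext1 w
    obtain ⟨t, ht⟩ := hle ⟨w, rfl⟩
    have h1 : r (F t) = 0 := LinearMap.congr_fun hz t
    rw [ht, hrf] at h1
    rw [h1]; simp
  exact hr ⟨w ⊗ₜ v, hFt w v⟩

lemma exists_neg [∀ i, FiniteDimensional ℂ (W i)]
    {V : Type} [AddCommGroup V] [Module ℂ V] [FiniteDimensional ℂ V]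
    (ρ : Representation ℂ G V)
    (hirr : ∀ i, IsIrreducibleRep (Irr i))
    (hdist : ∀ i j, RepIso (Irr i) (Irr j) → i = j)
    (hcompl : ∀ (U : Type) [AddCommGroup U] [Module ℂ U] [FiniteDimensional ℂ U]
      (σ : Representation ℂ G U), IsIrreducibleRep σ → ∃ i, RepIso σ (Irr i))
    (ε : ι → ZMod 2) (hε : ∀ i j, multHom ((Irr i).tprod ρ) (Irr j) ≠ 0 → ε j ≠ ε i) :
    ∃ z : G, ∀ v, ρ z v = -v := by
  classical
  have hdis := part_disjoint hirr hdist hcompl (reg G) ε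
  have htop := part_top hirr hcompl (reg G) ε
  have hd : (Pi.single 1 1 : G → ℂ) ∈ part Irr (reg G) ε 0 ⊔ part Irr (reg G) ε 1 := by
    rw [htop]; trivial
  obtain ⟨a, ha, b, hb, hab⟩ := Submodule.mem_sup.1 hd
  have hne : a - b ≠ 0 := by
    intro h
    rw [sub_eq_zero] at h
    have : a ∈ part Irr (reg G) ε 0 ⊓ part Irr (reg G) ε 1 := ⟨ha, h ▸ hb⟩
    rw [hdis, Submodule.mem_bot] at this
    rw [← h, this] at hab
    have := congrFun hab 1
    simp at this
  obtain ⟨z, hz⟩ := Function.ne_iff.1 hne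
  refine ⟨z, fun v => ?_⟩
  rw [← sub_eq_zero, ← Module.forall_dual_apply_eq_zero_iff ℂ]
  intro l
  have h1 := part_mul ρ hirr hcompl ε hε l v 0 1 (by decide) a ha
  have h2 := part_mul ρ hirr hcompl ε hε l v 1 0 (by decide) b hb
  have hm : a * mc ρ l v + b * mc ρ l v = l v • a + l v • b := by
    rw [← add_mul, ← smul_add, hab]
    funext x
    by_cases hx : x = 1
    · subst hx; simp [mc]
    · simp [hx]
  have h3 : a * mc ρ l v - l v • b ∈ part Irr (reg G) ε 0 ⊓ part Irr (reg G) ε 1 := by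
    refine ⟨?_, Submodule.sub_mem _ h1 (Submodule.smul_mem _ _ hb)⟩
    have : a * mc ρ l v - l v • b = l v • a - b * mc ρ l v := by
      linear_combination (exp := 1) hm
    rw [this]
    exact Submodule.sub_mem _ (Submodule.smul_mem _ _ ha) h2
  rw [hdis, Submodule.mem_bot, sub_eq_zero] at h3
  have h4 : b * mc ρ l v = l v • a := by
    rw [h3] at hm
    rw [add_comm] at hm
    exact add_right_cancel hm
  have e1 := congrFun h3 z
  have e2 := congrFun h4 z
  have e3 : mc ρ l v z = l (ρ z v) := rfl
  simp only [Pi.mul_apply, Pi.smul_apply, smul_eq_mul, e3] at e1 e2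
  simp only [Pi.sub_apply, Pi.zero_apply] at hz
  rw [sub_neg_eq_add, map_add]
  have : (a z - b z) * (l (ρ z v) + l v) = 0 := by linear_combination e1 - e2
  exact (mul_eq_zero.1 this).resolve_left hz

end

lemma central_sign {G U : Type} [Group G] [AddCommGroup U] [Module ℂ U]
    {σ : Representation ℂ G U} (hσ : IsIrreducibleRep σ) {z : G}
    (hz : z ∈ Subgroup.center G) (h2 : z ^ 2 = 1) : (∀ u, σ z u = u) ∨ (∀ u, σ z u = -u) := by
  have hsq : ∀ u, σ z (σ z u) = u := by
    intro u
    rw [← Module.End.mul_apply, ← map_mul, ← pow_two, h2]; simp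
  have hinv : Inv σ (LinearMap.ker (σ z - 1)) := by
    intro g v hv
    simp only [LinearMap.mem_ker, LinearMap.sub_apply, Module.End.one_apply, sub_eq_zero] at *
    rw [← Module.End.mul_apply, ← map_mul, ← Subgroup.mem_center_iff.1 hz g, map_mul,
      Module.End.mul_apply, hv]
  rcases hσ.2 _ hinv with h | h
  · right
    intro u
    have : σ z u + u ∈ LinearMap.ker (σ z - 1) := by
      simp [hsq, add_comm]
    rw [h, Submodule.mem_bot] at this
    exact eq_neg_of_add_eq_zero_left this
  · left
    intro u
    have : u ∈ LinearMap.ker (σ z - 1) := h ▸ trivial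
    simpa [sub_eq_zero] using this

end McK

/-- For an irreducible faithful representation `ρ` of a finite group `G`, the
McKay graph `Γ(G,ρ)` is bipartite if and only if `G` has a central element of order `2`. -/
theorem mckay_bipartite_iff_central_involution
    {G : Type} [Group G] [Fintype G]
    {V : Type} [AddCommGroup V] [Module ℂ V] [FiniteDimensional ℂ V]
    (ρ : Representation ℂ G V)
    (hρ : IsIrreducibleRep ρ) (hfaith : Function.Injective ⇑ρ)
    {ι : Type} [Fintype ι]
    (W : ι → Type) [∀ i, AddCommGroup (W i)] [∀ i, Module ℂ (W i)]
    [∀ i, FiniteDimensional ℂ (W i)]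
    (Irr : (i : ι) → Representation ℂ G (W i))
    (hirr : ∀ i, IsIrreducibleRep (Irr i))
    (hdist : ∀ i j, RepIso (Irr i) (Irr j) → i = j)
    (hcompl : ∀ (U : Type) [AddCommGroup U] [Module ℂ U] [FiniteDimensional ℂ U]
      (σ : Representation ℂ G U), IsIrreducibleRep σ → ∃ i, RepIso σ (Irr i)) :
    (∃ ε : ι → ZMod 2, ∀ i j, multHom ((Irr i).tprod ρ) (Irr j) ≠ 0 → ε j ≠ ε i) ↔
      ∃ z ∈ Subgroup.center G, z ≠ 1 ∧ z ^ 2 = 1 := by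
  classical
  have hnt := hρ.1
  obtain ⟨v0, hv0⟩ := exists_ne (0 : V)
  have hself : ∀ {X : Type} [AddCommGroup X] [Module ℂ X] (x : X), x = -x → x = 0 := by
    intro X _ _ x hx
    have h2 : (2 : ℂ) • x = 0 := by
      rw [two_smul]
      nth_rewrite 2 [hx]
      exact add_neg_cancel x
    exact (smul_eq_zero.1 h2).resolve_left two_ne_zero
  constructor
  · rintro ⟨ε, hε⟩
    obtain ⟨z, hz⟩ := McK.exists_neg ρ hirr hdist hcompl ε hε
    refine ⟨z, ?_, ?_, ?_⟩
    · rw [Subgroup.mem_center_iff]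
      intro g
      apply hfaith
      ext v
      simp [hz]
    · rintro rfl
      exact hv0 (hself _ (by simpa using hz v0))
    · apply hfaith
      ext v
      simp [pow_two, hz]
  · rintro ⟨z, hc, h1, h2⟩
    have hzρ : ∀ v, ρ z v = -v := by
      rcases McK.central_sign hρ hc h2 with h | h
      · exact absurd (hfaith (by ext v; simp [h])) h1
      · exact h
    refine ⟨fun i => if ∀ u, Irr i z u = u then 0 else 1, ?_⟩
    intro i j hm
    obtain ⟨f, hf, hf0⟩ := (McK.mult_ne _ _).1 hm
    obtain ⟨w, v, hwv⟩ : ∃ w v, f (w ⊗ₜ v) ≠ 0 := by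
      by_contra! h
      exact hf0 (TensorProduct.ext' fun w v => by simp [h])
    have hfz := hf z (w ⊗ₜ v)
    rw [Representation.tprod_apply, TensorProduct.map_tmul, hzρ, TensorProduct.tmul_neg,
      map_neg] at hfz
    have hnt' := (hirr i).1
    rcases McK.central_sign (hirr i) hc h2 with hi | hi <;>
      rcases McK.central_sign (hirr j) hc h2 with hj | hj
    · rw [hi, hj] at hfz
      exact absurd (hself _ hfz.symm) hwv
    · have : ¬ ∀ u, Irr j z u = u := fun h =>
        hwv (hself _ ((h _).symm.trans (hj _)))
      simp [hi, this]
    · have : ¬ ∀ u, Irr i z u = u := by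
        intro h
        have : w = 0 := hself _ ((h _).symm.trans (hi _))
        simp [this] at hwv
      simp [hj, this]
    · rw [hi, hj, TensorProduct.neg_tmul, map_neg, neg_neg] at hfz
      exact absurd (hself _ hfz) hwv
end
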